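/- Let N_d denote the number of rank functions on the Boolean lattice 2^{[d]}. There exist constants c > 0 and d₀ such that for all integers d ≥ d₀, | N_d − 2e·2^{2^{d−1}} | ≤ e^{−cd}·2^{2^{d−1}}. In particular, N_d = O(2^{2^{d−1}}). -/

import Mathlib

/-- Rank functions on the Boolean lattice `2^[d]`. -/
def RankFun (d : ℕ) : Set (Finset (Fin d) → ℕ) :=
  {f | f ∅ = 0 ∧ ∀ (A : Finset (Fin d)) (x : Fin d),
        f A ≤ f (insert x A) ∧ f (insert x A) ≤ f A + 1}

namespace CubeHom

/-- The discrete cube with coordinates indexed by `ι`. -/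
abbrev Cube (ι : Type*) := ι → ZMod 2

/-- The standard unit vector of the cube in direction `i`. -/
abbrev unit {ι : Type*} [DecidableEq ι] (i : ι) : Cube ι := Pi.single i 1

/-- Two elements of `Fin L` are near if they differ by exactly one. -/
def near {L : ℕ} (a b : Fin L) : Prop := (a : ℕ) + 1 = b ∨ (b : ℕ) + 1 = a

instance {L : ℕ} (a b : Fin L) : Decidable (near a b) := by unfold near; infer_instance

lemma near_comm {L : ℕ} {a b : Fin L} : near a b ↔ near b a := by
  unfold near; tauto

lemma near.symm {L : ℕ} {a b : Fin L} (h : near a b) : near b a := near_comm.1 h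

lemma zmod_two_add_self (a : ZMod 2) : a + a = 0 := CharTwo.add_self_eq_zero a

lemma zmod_two_ne_iff (a b : ZMod 2) : a ≠ b ↔ a = b + 1 := by
  revert a b; decide

lemma zmod_two_eq_or (a b : ZMod 2) : a = b ∨ a = b + 1 := by
  revert a b; decide

lemma cube_add_self {ι : Type*} (x : Cube ι) : x + x = 0 := by
  ext i; exact zmod_two_add_self _

lemma add_add_cancel_self {ι : Type*} (x y : Cube ι) : x + y + y = x := by
  rw [add_assoc, cube_add_self, add_zero]

lemma unit_ne_zero {ι : Type*} [DecidableEq ι] (i : ι) : (unit i : Cube ι) ≠ 0 := by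
  intro h
  have := congrFun h i
  simp at this

lemma add_unit_ne {ι : Type*} [DecidableEq ι] (x : Cube ι) (i : ι) : x + unit i ≠ x := by
  intro h
  exact unit_ne_zero i (by simp at h)

lemma card_cube (ι : Type*) [Fintype ι] [DecidableEq ι] :
    Fintype.card (Cube ι) = 2 ^ Fintype.card ι := by
  simp [ZMod.card]

lemma card_le_two_of_val_mem {L : ℕ} (s : Finset (Fin L)) (p q : ℕ)
    (h : ∀ b ∈ s, (b : ℕ) = p ∨ (b : ℕ) = q) : s.card ≤ 2 := by
  calc s.card ≤ ({p, q} : Finset ℕ).card :=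
        Finset.card_le_card_of_injOn (fun b => (b : ℕ))
          (fun b hb => by simpa using h b hb) (fun a _ b _ hab => Fin.ext hab)
    _ ≤ 2 := Finset.card_le_two

lemma card_near_le {L : ℕ} (a : Fin L) : (Finset.univ.filter fun b => near a b).card ≤ 2 := by
  apply card_le_two_of_val_mem _ (a - 1) (a + 1)
  intro b hb
  rcases (Finset.mem_filter.1 hb).2 with h | h <;> omega

/-- Functions constrained pointwise are at most as many as the product of the numbers of options. -/
lemma card_le_prod_options {X Y : Type*} [Fintype X] [DecidableEq X]
    (F : Finset (X → Y)) (opt : X → Finset Y) (h : ∀ f ∈ F, ∀ x, f x ∈ opt x) :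
    F.card ≤ ∏ x, (opt x).card := by
  rw [← Fintype.card_piFinset]
  exact Finset.card_le_card fun f hf => Fintype.mem_piFinset.2 (h f hf)
section Phase

variable {J : Type*} {k L : ℕ}

/-- Pairs of height functions indexed by `J` on the two sides of `K_{J,J} □ Q_k`. -/
structure RowHom (h : J → Cube (Fin k) → Fin L × Fin L) : Prop where
  cross : ∀ j j' x, near (h j x).1 (h j' x).2
  step : ∀ j x i, near (h j x).1 (h j (x + unit i)).2

def LeftConst (h : J → Cube (Fin k) → Fin L × Fin L) : Prop := ∃ a, ∀ j x, (h j x).1 = a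

def RightConst (h : J → Cube (Fin k) → Fin L × Fin L) : Prop := ∃ a, ∀ j x, (h j x).2 = a

/-- The restriction of a family of functions to a facet of the cube. -/
def face {V : Type*} (i : Fin (k + 1)) (b : ZMod 2) (h : J → Cube (Fin (k + 1)) → V) :
    J → Cube (Fin k) → V :=
  fun j x => h j (i.insertNth b x)

lemma insertNth_add_unit (i : Fin (k + 1)) (b : ZMod 2) (x : Cube (Fin k)) (l : Fin k) :
    (i.insertNth b (x + unit l) : Cube (Fin (k + 1))) = i.insertNth b x + unit (i.succAbove l) := by
  funext j
  rcases Fin.eq_self_or_eq_succAbove i j with rfl | ⟨j, rfl⟩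
  · simp [(Fin.succAbove_ne _ _).symm]
  · simp [Pi.single_apply]

lemma exists_insertNth_eq (i : Fin (k + 1)) (x : Cube (Fin (k + 1))) :
    ∃ y : Cube (Fin k), i.insertNth (x i) y = x :=
  ⟨i.removeNth x, by simp⟩

lemma RowHom.face {h : J → Cube (Fin (k + 1)) → Fin L × Fin L} (hh : RowHom h)
    (i : Fin (k + 1)) (b : ZMod 2) : RowHom (face i b h) where
  cross j j' x := hh.cross j j' _
  step j x l := by
    have := hh.step j (i.insertNth b x) (i.succAbove l)
    rwa [← insertNth_add_unit] at this

lemma RowHom.swap {h : J → Cube (Fin k) → Fin L × Fin L} (hh : RowHom h) :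
    RowHom (fun j x => (h j x).swap) where
  cross j j' x := (hh.cross j' j x).symm
  step j x i := by
    have := hh.step j (x + unit i) i
    rw [add_add_cancel_self] at this
    exact this.symm

lemma prod_quarter_options_le {K : ℕ} (i i' : Fin K) (hi : i ≠ i') (b b' : ZMod 2) :
    ∏ x : Cube (Fin K), (if x i = b then (if x i' = b' then 1 else 2)
      else (if x i' = b' then 2 else 3) : ℝ) ≤ 3 / 4 * 2 ^ 2 ^ K := by
  set c : Cube (Fin K) → ℝ := fun x => if x i = b then (if x i' = b' then 1 else 2)
      else (if x i' = b' then 2 else 3) with hc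
  have hc0 : ∀ x, 0 ≤ c x := by intro x; simp only [hc]; split_ifs <;> norm_num
  let σ : Equiv.Perm (Cube (Fin K)) := Equiv.addRight (unit i + unit i')
  have hσi : ∀ x, σ x i = x i + 1 := by
    intro x; simp [σ, hi]
  have hσi' : ∀ x, σ x i' = x i' + 1 := by
    intro x; simp [σ, hi.symm]
  let p : Cube (Fin K) := Function.update (fun _ => b) i' b'
  have hpi : p i = b := by simp [p, hi]
  have hpi' : p i' = b' := by simp [p]
  have hp : p ≠ σ p := by
    intro h
    have := congrFun h i
    rw [hσi] at this
    simp at this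
  have key : ∀ x, c x * c (σ x) ≤
      4 * (if x = p then 3 / 4 else 1) * (if x = σ p then 3 / 4 else 1) := by
    intro x
    have h1 : c x * c (σ x) = if (x i = b ↔ x i' = b') then 3 else 4 := by
      simp only [hc, hσi, hσi']
      generalize x i = u
      generalize x i' = v
      rcases zmod_two_eq_or u b with h | h <;> rcases zmod_two_eq_or v b' with h' | h' <;>
        subst h <;> subst h' <;> simp [add_assoc, zmod_two_add_self] <;> norm_num
    by_cases hx : x = p
    · have : (x i = b ↔ x i' = b') := by rw [hx, hpi, hpi']; simp
      rw [h1, if_pos this, if_pos hx, if_neg (by rw [hx]; exact hp)]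
      norm_num
    · by_cases hx' : x = σ p
      · have : (x i = b ↔ x i' = b') := by rw [hx', hσi, hσi', hpi, hpi']; simp
        rw [h1, if_pos this, if_neg hx, if_pos hx']
        norm_num
      · rw [h1, if_neg hx, if_neg hx']
        split_ifs <;> norm_num
  have hsq : (∏ x, c x) ^ 2 ≤ (3 / 4 * 2 ^ 2 ^ K) ^ 2 := by
    calc (∏ x, c x) ^ 2 = (∏ x, c x) * ∏ x, c (σ x) := by
          rw [Equiv.prod_comp σ c, sq]
      _ = ∏ x, c x * c (σ x) := by rw [Finset.prod_mul_distrib]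
      _ ≤ ∏ x, 4 * (if x = p then 3 / 4 else 1) * (if x = σ p then 3 / 4 else 1) :=
          Finset.prod_le_prod (fun x _ => mul_nonneg (hc0 _) (hc0 _)) fun x _ => key x
      _ = (3 / 4 * 2 ^ 2 ^ K) ^ 2 := by
          rw [Finset.prod_mul_distrib, Finset.prod_mul_distrib, Finset.prod_ite_eq',
            Finset.prod_ite_eq', Finset.prod_const, Finset.card_univ, card_cube, Fintype.card_fin,
            if_pos (Finset.mem_univ _), if_pos (Finset.mem_univ _)]
          rw [show (4 : ℝ) = 2 ^ 2 by norm_num, ← pow_mul]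
          ring
  exact le_of_sq_le_sq hsq (by positivity)

end Phase
section PhaseCounts

variable {J : Type*} {L : ℕ}

lemma card_near_options {L : ℕ} (a a' : Fin L) (haa : near a a') (P Q : Prop)
    [Decidable P] [Decidable Q] :
    (Finset.univ.filter fun p : Fin L × Fin L => near a p.2 ∧ near p.1 a' ∧ near p.1 p.2 ∧
      (P → p.1 = a) ∧ (Q → p.2 = a')).card ≤
      if P then (if Q then 1 else 2) else (if Q then 2 else 3) := by
  set s := Finset.univ.filter fun p : Fin L × Fin L => near a p.2 ∧ near p.1 a' ∧ near p.1 p.2 ∧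
      (P → p.1 = a) ∧ (Q → p.2 = a') with hs
  have hmem : ∀ p ∈ s, near a p.2 ∧ near p.1 a' ∧ near p.1 p.2 ∧
      (P → p.1 = a) ∧ (Q → p.2 = a') := fun p hp => (Finset.mem_filter.1 hp).2
  clear_value s
  have main : ∀ t : Finset (ℕ × ℕ), (∀ p ∈ s, ((p.1 : ℕ), (p.2 : ℕ)) ∈ t) → s.card ≤ t.card := by
    intro t ht
    apply Finset.card_le_card_of_injOn (fun p => ((p.1 : ℕ), (p.2 : ℕ)))
        (fun p hp => ht p hp)
    rintro ⟨p, q⟩ _ ⟨p', q'⟩ _ h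
    simp only [Prod.mk.injEq] at h
    exact Prod.ext (Fin.ext h.1) (Fin.ext h.2)
  unfold near at *
  by_cases hP : P
  · by_cases hQ : Q
    · rw [if_pos hP, if_pos hQ]
      refine (main {((a : ℕ), (a' : ℕ))} fun p hp => ?_).trans (by simp)
      have := hmem p hp
      simp [this.2.2.2.1 hP, this.2.2.2.2 hQ]
    · rw [if_pos hP, if_neg hQ]
      refine (main {((a : ℕ), (a : ℕ) - 1), ((a : ℕ), (a : ℕ) + 1)} fun p hp => ?_).trans
        Finset.card_le_two
      have := hmem p hp
      simp [this.2.2.2.1 hP]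
      omega
  · by_cases hQ : Q
    · rw [if_neg hP, if_pos hQ]
      refine (main {((a' : ℕ) - 1, (a' : ℕ)), ((a' : ℕ) + 1, (a' : ℕ))} fun p hp => ?_).trans
        Finset.card_le_two
      have := hmem p hp
      simp [this.2.2.2.2 hQ]
      omega
    · rw [if_neg hP, if_neg hQ]
      refine (main {((a : ℕ), (a' : ℕ)), ((a : ℕ), 2 * (a : ℕ) - a'),
        (2 * (a' : ℕ) - a, (a' : ℕ))} fun p hp => ?_).trans Finset.card_le_three
      have := hmem p hp
      simp only [Finset.mem_insert, Finset.mem_singleton, Prod.mk.injEq]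
      omega

variable [Fintype J] [DecidableEq J]

lemma card_crossing_le {K : ℕ} (i i' : Fin K) (hi : i ≠ i') (b b' : ZMod 2) (a a' : Fin L)
    (F : Finset (J → Cube (Fin K) → Fin L × Fin L))
    (hF : ∀ h ∈ F, RowHom h ∧ (∀ j x, x i = b → (h j x).1 = a) ∧
      ∀ j x, x i' = b' → (h j x).2 = a') (hJ : Nonempty J) :
    (F.card : ℝ) ≤ (3 / 4) ^ Fintype.card J * 2 ^ (Fintype.card J * 2 ^ K) := by
  rcases F.eq_empty_or_nonempty with rfl | ⟨h₀, hh₀⟩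
  · simp only [Finset.card_empty, Nat.cast_zero]; positivity
  have hright : ∀ h ∈ F, ∀ j x, near a (h j x).2 := by
    intro h hh j x
    obtain ⟨h1, h2, -⟩ := hF h hh
    by_cases hx : x i = b
    · rw [← h2 j x hx]; exact h1.cross j j x
    · have h3 : (x + unit i) i = b := by
        rw [(zmod_two_ne_iff _ _).1 hx |> fun e => show (x + unit i) i = b + 1 + 1 by
          simp [e]]
        rw [add_assoc, zmod_two_add_self, add_zero]
      rw [← h2 j _ h3]
      have := h1.step j (x + unit i) i
      rwa [add_add_cancel_self] at this
  have hleft : ∀ h ∈ F, ∀ j x, near (h j x).1 a' := by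
    intro h hh j x
    obtain ⟨h1, -, h2⟩ := hF h hh
    by_cases hx : x i' = b'
    · rw [← h2 j x hx]; exact h1.cross j j x
    · have h3 : (x + unit i') i' = b' := by
        rw [(zmod_two_ne_iff _ _).1 hx |> fun e => show (x + unit i') i' = b' + 1 + 1 by
          simp [e]]
        rw [add_assoc, zmod_two_add_self, add_zero]
      rw [← h2 j _ h3]
      exact h1.step j x i'
  have haa : near a a' := by
    obtain ⟨j⟩ := hJ
    have h1 := hright h₀ hh₀ j (fun _ => b')
    rwa [(hF h₀ hh₀).2.2 j _ rfl] at h1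
  set opt : Cube (Fin K) → Finset (Fin L × Fin L) := fun x =>
    Finset.univ.filter fun p : Fin L × Fin L => near a p.2 ∧ near p.1 a' ∧ near p.1 p.2 ∧
      (x i = b → p.1 = a) ∧ (x i' = b' → p.2 = a') with hopt
  have hcard : F.card ≤ ∏ _j : J, ∏ x, (opt x).card := by
    calc F.card ≤ ∏ _j : J, (Fintype.piFinset opt).card := by
          apply card_le_prod_options F
          intro h hh j
          rw [Fintype.mem_piFinset]
          intro x
          rw [hopt, Finset.mem_filter]
          obtain ⟨h1, h2, h3⟩ := hF h hh
          exact ⟨Finset.mem_univ _, hright h hh j x, hleft h hh j x, h1.cross j j x,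
            h2 j x, h3 j x⟩
      _ = _ := Finset.prod_congr rfl fun _ _ => Fintype.card_piFinset opt
  have hprod : ((∏ x, (opt x).card : ℕ) : ℝ) ≤ 3 / 4 * 2 ^ 2 ^ K := by
    rw [Nat.cast_prod]
    refine le_trans (Finset.prod_le_prod (fun _ _ => by positivity) fun x _ => ?_)
      (prod_quarter_options_le i i' hi b b')
    exact_mod_cast card_near_options a a' haa (x i = b) (x i' = b')
  calc (F.card : ℝ) ≤ ((∏ _j : J, ∏ x, (opt x).card : ℕ) : ℝ) := by exact_mod_cast hcard
    _ = ((∏ x, (opt x).card : ℕ) : ℝ) ^ Fintype.card J := by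
        rw [Finset.prod_const, Finset.card_univ, Nat.cast_pow]
    _ ≤ (3 / 4 * 2 ^ 2 ^ K) ^ Fintype.card J := pow_le_pow_left₀ (Nat.cast_nonneg _) hprod _
    _ = _ := by rw [mul_pow, ← pow_mul, mul_comm (2 ^ K)]

lemma card_near_ne_le (a c : Fin L) (h : near a c) :
    (Finset.univ.filter fun b : Fin L => near b c ∧ b ≠ a).card ≤ 1 := by
  rw [Finset.card_le_one]
  intro x hx y hy
  have hx := (Finset.mem_filter.1 hx).2
  have hy := (Finset.mem_filter.1 hy).2
  unfold near at *
  ext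
  have := hx.2
  have := hy.2
  rw [Ne, Fin.ext_iff] at *
  omega

lemma card_single_defect_le {K : ℕ} (z : Cube (Fin (K + 1))) (a c : Fin L) (j₀ : J)
    (F : Finset (J → Cube (Fin (K + 1)) → Fin L × Fin L))
    (hF : ∀ h ∈ F, RowHom h ∧ (∀ j x, x ≠ z → (h j x).1 = a) ∧ (h j₀ z).1 ≠ a ∧
      (h j₀ z).2 = c) :
    (2 : ℝ) ^ (K + 1) * F.card ≤ (3 / 4) ^ Fintype.card J *
      2 ^ (Fintype.card J * 2 ^ (K + 1)) := by
  rcases F.eq_empty_or_nonempty with rfl | ⟨h₀, hh₀⟩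
  · simp only [Finset.card_empty, Nat.cast_zero, mul_zero]; positivity
  have hright : ∀ h ∈ F, ∀ j x, near a (h j x).2 := by
    intro h hh j x
    obtain ⟨h1, h2, -⟩ := hF h hh
    by_cases hx : x = z
    · have h3 : x + unit 0 ≠ z := by rw [← hx]; exact add_unit_ne x 0
      rw [← h2 j _ h3]
      have := h1.step j (x + unit 0) 0
      rwa [add_add_cancel_self] at this
    · rw [← h2 j x hx]; exact h1.cross j j x
  have hac : near a c := by
    rw [← (hF h₀ hh₀).2.2.2]; exact hright h₀ hh₀ j₀ z
  have hz : ∀ h ∈ F, ∀ j, (h j z).2 = c := by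
    intro h hh j
    obtain ⟨h1, -, h2, h3⟩ := hF h hh
    have e1 := h1.cross j₀ j z
    have e2 := h1.cross j₀ j₀ z
    have e3 := hright h hh j z
    rw [h3] at e2
    rw [Ne, Fin.ext_iff] at h2
    unfold near at *
    ext
    omega
  have hnb : ∀ h ∈ F, ∀ j, (h j z).1 ≠ a → ∀ i, (h j (z + unit i)).2 = c := by
    intro h hh j hj i
    have h1 := (hF h hh).1
    have e1 := h1.step j z i
    have e2 := hright h hh j (z + unit i)
    have e3 := h1.cross j j z
    rw [hz h hh j] at e3
    rw [Ne, Fin.ext_iff] at hj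
    unfold near at *
    ext
    omega
  let opt : Cube (Fin (K + 1)) → Finset (Fin L × Fin L) := fun x =>
    if x = z then {(a, c)} else {a} ×ˢ (Finset.univ.filter fun b => near a b)
  let nb : Finset (Cube (Fin (K + 1))) := Finset.univ.image fun i => z + unit i
  let opt' : Cube (Fin (K + 1)) → Finset (Fin L × Fin L) := fun x =>
    if x = z then (Finset.univ.filter fun b : Fin L => near b c ∧ b ≠ a) ×ˢ {c}
    else if x ∈ nb then {(a, c)}
    else {a} ×ˢ (Finset.univ.filter fun b => near a b)
  have hnbcard : nb.card = K + 1 := by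
    rw [Finset.card_image_of_injective, Finset.card_univ, Fintype.card_fin]
    intro i i' h
    have h := congrFun (add_left_cancel h) i
    by_contra hne
    simp [hne] at h
  have hznb : z ∉ nb := by
    simp only [nb, Finset.mem_image, Finset.mem_univ, true_and, not_exists]
    exact fun i => add_unit_ne z i
  set n := 2 ^ (K + 1) with hn
  have hcube : (Finset.univ : Finset (Cube (Fin (K + 1)))).card = n := by
    rw [Finset.card_univ, card_cube, Fintype.card_fin]
  have hoptcard : (Fintype.piFinset opt).card ≤ 2 ^ (n - 1) := by
    rw [Fintype.card_piFinset]
    calc ∏ x, (opt x).card ≤ ∏ x, (if x ∈ ({z} : Finset _) then 1 else 2) := by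
          apply Finset.prod_le_prod' fun x _ => ?_
          by_cases hx : x = z
          · simp [opt, hx]
          · simp only [opt, hx, if_false, Finset.mem_singleton, Finset.card_product,
              Finset.card_singleton, one_mul]
            exact card_near_le a
      _ = 2 ^ (n - 1) := by
          rw [Finset.prod_ite, Finset.prod_const_one, one_mul, Finset.prod_const,
            Finset.filter_notMem_eq_sdiff, Finset.card_sdiff_of_subset (Finset.subset_univ _),
            hcube, Finset.card_singleton]
  have hoptcard' : (Fintype.piFinset opt').card ≤ 2 ^ (n - (K + 2)) := by
    rw [Fintype.card_piFinset]
    calc ∏ x, (opt' x).card ≤ ∏ x, (if x ∈ insert z nb then 1 else 2) := by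
          apply Finset.prod_le_prod' fun x _ => ?_
          by_cases hx : x = z
          · simp only [opt', hx, if_true, Finset.card_product, Finset.card_singleton, mul_one,
              Finset.mem_insert, true_or]
            exact card_near_ne_le a c hac
          · by_cases hx' : x ∈ nb
            · simp [opt', hx, hx']
            · simp only [opt', hx, hx', if_false, Finset.mem_insert, or_self, Finset.card_product,
                Finset.card_singleton, one_mul]
              exact card_near_le a
      _ = 2 ^ (n - (K + 2)) := by
          rw [Finset.prod_ite, Finset.prod_const_one, one_mul, Finset.prod_const,
            Finset.filter_notMem_eq_sdiff, Finset.card_sdiff_of_subset (Finset.subset_univ _),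
            hcube, Finset.card_insert_of_notMem hznb, hnbcard]
  have hmem' : ∀ h ∈ F, ∀ j, (h j z).1 ≠ a → h j ∈ Fintype.piFinset opt' := by
    intro h hh j hj
    rw [Fintype.mem_piFinset]
    intro x
    obtain ⟨h1, h2, -, -⟩ := hF h hh
    by_cases hx : x = z
    · have := h1.cross j j z
      rw [hz h hh j] at this
      rw [show opt' x = _ from if_pos hx, hx, Finset.mem_product, Finset.mem_filter,
        Finset.mem_singleton]
      exact ⟨⟨Finset.mem_univ _, this, hj⟩, hz h hh j⟩
    · by_cases hx' : x ∈ nb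
      · simp only [opt', hx, hx', if_true, if_false, Finset.mem_singleton]
        obtain ⟨i, -, rfl⟩ := Finset.mem_image.1 hx'
        exact Prod.ext (h2 j _ hx) (hnb h hh j hj i)
      · simp only [opt', if_neg hx, if_neg hx', Finset.mem_product, Finset.mem_filter,
          Finset.mem_singleton]
        exact ⟨h2 j x hx, Finset.mem_univ _, hright h hh j x⟩
  have hmem : ∀ h ∈ F, ∀ j, (h j z).1 = a → h j ∈ Fintype.piFinset opt := by
    intro h hh j hj
    rw [Fintype.mem_piFinset]
    intro x
    obtain ⟨h1, h2, -, -⟩ := hF h hh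
    by_cases hx : x = z
    · simp only [opt, hx, if_true, Finset.mem_singleton]
      exact Prod.ext hj (hz h hh j)
    · simp only [opt, if_neg hx, Finset.mem_product, Finset.mem_filter, Finset.mem_singleton]
      exact ⟨h2 j x hx, Finset.mem_univ _, hright h hh j x⟩
  let O : J → Finset (Cube (Fin (K + 1)) → Fin L × Fin L) := fun j =>
    if j = j₀ then Fintype.piFinset opt' else Fintype.piFinset opt ∪ Fintype.piFinset opt'
  have hFO : F.card ≤ ∏ j, (O j).card := by
    apply card_le_prod_options
    intro h hh j
    by_cases hj : j = j₀
    · rw [hj, show O j₀ = Fintype.piFinset opt' from if_pos rfl]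
      exact hmem' h hh j₀ (hF h hh).2.2.1
    · rw [show O j = Fintype.piFinset opt ∪ Fintype.piFinset opt' from if_neg hj,
        Finset.mem_union]
      by_cases h' : (h j z).1 = a
      · exact Or.inl (hmem h hh j h')
      · exact Or.inr (hmem' h hh j h')
  have hKn : K + 2 ≤ n := by
    have : K + 1 < 2 ^ (K + 1) := Nat.lt_two_pow_self
    omega
  have hcardJ : 1 ≤ Fintype.card J := Fintype.card_pos_iff.2 ⟨j₀⟩
  have hA : (2 : ℝ) ^ (n - 1) = 2 ^ n / 2 := by
    rw [eq_div_iff (by norm_num), ← pow_succ]; congr 1; omega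
  have hB : (2 : ℝ) ^ (n - (K + 2)) = 2 ^ n / 2 ^ (K + 2) := by
    rw [eq_div_iff (by positivity), ← pow_add]; congr 1; omega
  have hb2 : (2 : ℝ) ^ n / 2 ^ (K + 2) ≤ 2 ^ n / 4 := by
    gcongr
    calc (4 : ℝ) = 2 ^ 2 := by norm_num
      _ ≤ 2 ^ (K + 2) := by gcongr <;> norm_num
  have hOj : ∀ j, j ≠ j₀ → ((O j).card : ℝ) ≤ 3 / 4 * 2 ^ n := by
    intro j hj
    rw [show O j = Fintype.piFinset opt ∪ Fintype.piFinset opt' from if_neg hj]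
    calc ((Fintype.piFinset opt ∪ Fintype.piFinset opt').card : ℝ)
        ≤ ((2 ^ (n - 1) + 2 ^ (n - (K + 2)) : ℕ) : ℝ) := by
          exact_mod_cast (Finset.card_union_le _ _).trans (add_le_add hoptcard hoptcard')
      _ = 2 ^ n / 2 + 2 ^ n / 2 ^ (K + 2) := by push_cast; rw [hA, hB]
      _ ≤ 3 / 4 * 2 ^ n := by linarith
  have hOj₀ : (2 : ℝ) ^ (K + 1) * ((O j₀).card : ℝ) ≤ 3 / 4 * 2 ^ n := by
    rw [show O j₀ = Fintype.piFinset opt' from if_pos rfl]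
    calc (2 : ℝ) ^ (K + 1) * ((Fintype.piFinset opt').card : ℝ)
        ≤ 2 ^ (K + 1) * (2 ^ n / 2 ^ (K + 2)) := by
          rw [← hB]; gcongr; exact_mod_cast hoptcard'
      _ = 2 ^ n / 2 := by rw [pow_succ 2 (K + 1)]; field_simp
      _ ≤ 3 / 4 * 2 ^ n := by linarith [show (0 : ℝ) < 2 ^ n by positivity]
  calc (2 : ℝ) ^ (K + 1) * F.card ≤ 2 ^ (K + 1) * ∏ j, ((O j).card : ℝ) := by
        refine mul_le_mul_of_nonneg_left ?_ (by positivity)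
        exact_mod_cast hFO
    _ = (2 ^ (K + 1) * ((O j₀).card : ℝ)) * ∏ j ∈ Finset.univ.erase j₀, ((O j).card : ℝ) := by
        rw [← Finset.mul_prod_erase _ _ (Finset.mem_univ j₀)]; ring
    _ ≤ (3 / 4 * 2 ^ n) * ∏ j ∈ Finset.univ.erase j₀, (3 / 4 * 2 ^ n : ℝ) := by
        exact mul_le_mul hOj₀ (Finset.prod_le_prod (fun _ _ => Nat.cast_nonneg _) fun j hj =>
          hOj j (Finset.ne_of_mem_erase hj)) (Finset.prod_nonneg fun _ _ => Nat.cast_nonneg _)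
          (by positivity)
    _ = (3 / 4 * 2 ^ n) ^ Fintype.card J := by
        rw [Finset.prod_const, Finset.card_erase_of_mem (Finset.mem_univ _), Finset.card_univ,
          ← pow_succ']
        congr 1; omega
    _ = _ := by rw [mul_pow, ← pow_mul, mul_comm n]

end PhaseCounts
lemma card_le_sum_of_cover {X I : Type*} [Fintype I] (F : Finset X)
    (G : I → Finset X) (h : ∀ f ∈ F, ∃ i, f ∈ G i) : F.card ≤ ∑ i, (G i).card := by
  classical
  refine le_trans (Finset.card_le_card fun f hf => ?_) Finset.card_biUnion_le
  obtain ⟨i, hi⟩ := h f hf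
  exact Finset.mem_biUnion.2 ⟨i, Finset.mem_univ i, hi⟩

section Unphased

variable {J : Type*} {L : ℕ}

structure Unphased {k : ℕ} (h : J → Cube (Fin k) → Fin L × Fin L) : Prop where
  hom : RowHom h
  left : ¬ LeftConst h
  right : ¬ RightConst h

lemma not_unphased_zero [Nonempty J] (h : J → Cube (Fin 0) → Fin L × Fin L) : ¬ Unphased h := by
  rintro ⟨h1, h2, h3⟩
  obtain ⟨j₀⟩ := ‹Nonempty J›
  have h2' : ∃ j, (h j 0).1 ≠ (h j₀ 0).1 := by
    by_contra! H
    exact h2 ⟨_, fun j x => by rw [Subsingleton.elim x 0, H]⟩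
  have h3' : ∃ j, (h j 0).2 ≠ (h j₀ 0).2 := by
    by_contra! H
    exact h3 ⟨_, fun j x => by rw [Subsingleton.elim x 0, H]⟩
  obtain ⟨j, hj⟩ := h2'
  obtain ⟨l, hl⟩ := h3'
  have e1 := h1.cross j j₀ 0
  have e2 := h1.cross j l 0
  have e3 := h1.cross j₀ l 0
  have e4 := h1.cross j₀ j₀ 0
  rw [Ne, Fin.ext_iff] at hj hl
  unfold near at *
  omega

/-- `h` has constant left side except above the single point `z`. -/
def SingleDefect {K : ℕ} (z : Cube (Fin K)) (a c : Fin L) (j₀ : J)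
    (h : J → Cube (Fin K) → Fin L × Fin L) : Prop :=
  RowHom h ∧ (∀ j x, x ≠ z → (h j x).1 = a) ∧ (h j₀ z).1 ≠ a ∧ (h j₀ z).2 = c

def Crossing {K : ℕ} (i i' : Fin K) (b b' : ZMod 2) (a a' : Fin L)
    (h : J → Cube (Fin K) → Fin L × Fin L) : Prop :=
  RowHom h ∧ (∀ j x, x i = b → (h j x).1 = a) ∧ ∀ j x, x i' = b' → (h j x).2 = a'

lemma exists_singleDefect [Nonempty J] {K : ℕ} {h : J → Cube (Fin (K + 1)) → Fin L × Fin L}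
    (hh : RowHom h) (hl : ¬ LeftConst h) (H : ∀ i, ∃ b a, ∀ j x, x i = b → (h j x).1 = a) :
    ∃ z a c j₀, SingleDefect z a c j₀ h := by
  choose b a hab using H
  have ha : ∀ i, a i = a 0 := by
    intro i
    obtain ⟨j⟩ := ‹Nonempty J›
    rw [← hab i j b rfl, ← hab 0 j b rfl]
  have hz : ∀ j x, x ≠ b + 1 → (h j x).1 = a 0 := by
    intro j x hx
    obtain ⟨i, hi⟩ := Function.ne_iff.1 hx
    rcases zmod_two_eq_or (x i) (b i) with h' | h'
    · rw [hab i j x h', ha]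
    · exact absurd h' hi
  have : ∃ j₀, (h j₀ (b + 1)).1 ≠ a 0 := by
    by_contra! H
    exact hl ⟨a 0, fun j x => by
      by_cases hx : x = b + 1
      · rw [hx, H]
      · exact hz j x hx⟩
  obtain ⟨j₀, hj₀⟩ := this
  exact ⟨b + 1, a 0, _, j₀, hh, hz, hj₀, rfl⟩

lemma Unphased.classify [Nonempty J] {K : ℕ} {h : J → Cube (Fin (K + 1)) → Fin L × Fin L}
    (hh : Unphased h) :
    (∃ i, ∀ b, Unphased (face i b h)) ∨
    (∃ i i' b b' a a', i ≠ i' ∧ Crossing i i' b b' a a' h) ∨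
    (∃ z a c j₀, SingleDefect z a c j₀ h) ∨
    (∃ z a c j₀, SingleDefect z a c j₀ (fun j x => (h j x).swap)) := by
  by_cases H1 : ∃ i, ∀ b, Unphased (face i b h)
  · exact Or.inl H1
  right
  push Not at H1
  have H2 : ∀ i, (∃ b a, ∀ j x, x i = b → (h j x).1 = a) ∨
      (∃ b a, ∀ j x, x i = b → (h j x).2 = a) := by
    intro i
    obtain ⟨b, hb⟩ := H1 i
    by_cases hl : LeftConst (face i b h)
    · obtain ⟨a, ha⟩ := hl
      refine Or.inl ⟨b, a, fun j x hx => ?_⟩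
      obtain ⟨y, hy⟩ := exists_insertNth_eq i x
      rw [← hy, hx]
      exact ha j y
    · by_cases hr : RightConst (face i b h)
      · obtain ⟨a, ha⟩ := hr
        refine Or.inr ⟨b, a, fun j x hx => ?_⟩
        obtain ⟨y, hy⟩ := exists_insertNth_eq i x
        rw [← hy, hx]
        exact ha j y
      · exact absurd ⟨hh.hom.face i b, hl, hr⟩ hb
  by_cases hL : ∀ i, ∃ b a, ∀ j x, x i = b → (h j x).1 = a
  · exact Or.inr (Or.inl (exists_singleDefect hh.hom hh.left hL))
  by_cases hR : ∀ i, ∃ b a, ∀ j x, x i = b → (h j x).2 = a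
  · exact Or.inr (Or.inr (exists_singleDefect hh.hom.swap hh.right hR))
  left
  rw [not_forall] at hL hR
  obtain ⟨i', hi'⟩ := hL
  obtain ⟨i, hi⟩ := hR
  obtain ⟨b', a', h'⟩ := (H2 i').resolve_left hi'
  obtain ⟨b, a, h''⟩ := (H2 i).resolve_right hi
  refine ⟨i, i', b, b', a, a', ?_, hh.hom, h'', h'⟩
  rintro rfl
  exact hi ⟨b', a', h'⟩

variable [Fintype J] [DecidableEq J]

open scoped Classical in
noncomputable def unphased (J : Type*) [Fintype J] [DecidableEq J] (k L : ℕ) :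
    Finset (J → Cube (Fin k) → Fin L × Fin L) :=
  Finset.univ.filter Unphased

lemma mem_unphased {k : ℕ} {h : J → Cube (Fin k) → Fin L × Fin L} :
    h ∈ unphased J k L ↔ Unphased h := by
  simp [unphased]

lemma card_unphased_zero [Nonempty J] : (unphased J 0 L).card = 0 := by
  rw [Finset.card_eq_zero, Finset.eq_empty_iff_forall_notMem]
  exact fun h hh => not_unphased_zero h (mem_unphased.1 hh)

open scoped Classical in
lemma card_faces_unphased_le {K : ℕ} (i : Fin (K + 1)) :
    (Finset.univ.filter fun h : J → Cube (Fin (K + 1)) → Fin L × Fin L =>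
      ∀ b, Unphased (face i b h)).card ≤ (unphased J K L).card ^ 2 := by
  rw [sq, ← Finset.card_product]
  apply Finset.card_le_card_of_injOn (fun h => (face i 0 h, face i 1 h))
  · intro h hh
    have := (Finset.mem_filter.1 hh).2
    exact Finset.mem_product.2 ⟨mem_unphased.2 (this 0), mem_unphased.2 (this 1)⟩
  · intro h _ h' _ e
    simp only [Prod.mk.injEq] at e
    funext j x
    obtain ⟨y, hy⟩ := exists_insertNth_eq i x
    rw [← hy]
    rcases zmod_two_eq_or (x i) 0 with h0 | h1
    · rw [h0]; exact congrFun (congrFun e.1 j) y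
    · rw [h1, zero_add]; exact congrFun (congrFun e.2 j) y

open scoped Classical in
lemma card_unphased_succ [Nonempty J] (K : ℕ) :
    ((unphased J (K + 1) L).card : ℝ) ≤ (K + 1) * ((unphased J K L).card : ℝ) ^ 2 +
      (4 * (K + 1) ^ 2 * L ^ 2 + 2 * L ^ 2 * Fintype.card J) *
        ((3 / 4) ^ Fintype.card J * 2 ^ (Fintype.card J * 2 ^ (K + 1))) := by
  set X : ℝ := (3 / 4) ^ Fintype.card J * 2 ^ (Fintype.card J * 2 ^ (K + 1)) with hX
  have hX0 : 0 ≤ X := by positivity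
  let A := J → Cube (Fin (K + 1)) → Fin L × Fin L
  let G1 : Fin (K + 1) → Finset A := fun i => Finset.univ.filter fun h => ∀ b, Unphased (face i b h)
  let I2 := Fin (K + 1) × Fin (K + 1) × ZMod 2 × ZMod 2 × Fin L × Fin L
  let G2 : I2 → Finset A := fun p => Finset.univ.filter fun h =>
    p.1 ≠ p.2.1 ∧ Crossing p.1 p.2.1 p.2.2.1 p.2.2.2.1 p.2.2.2.2.1 p.2.2.2.2.2 h
  let I3 := Cube (Fin (K + 1)) × Fin L × Fin L × J
  let G3 : I3 → Finset A := fun p => Finset.univ.filter fun h =>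
    SingleDefect p.1 p.2.1 p.2.2.1 p.2.2.2 h
  let G4 : I3 → Finset A := fun p => Finset.univ.filter fun h =>
    SingleDefect p.1 p.2.1 p.2.2.1 p.2.2.2 (fun j x => (h j x).swap)
  let G : Fin (K + 1) ⊕ I2 ⊕ I3 ⊕ I3 → Finset A := Sum.elim G1 (Sum.elim G2 (Sum.elim G3 G4))
  have hcov : (unphased J (K + 1) L).card ≤ ∑ i, (G i).card := by
    apply card_le_sum_of_cover
    intro h hh
    rcases (mem_unphased.1 hh).classify with ⟨i, hi⟩ | ⟨i, i', b, b', a, a', hi⟩ | ⟨z, a, c, j, hi⟩ | ⟨z, a, c, j, hi⟩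
    · exact ⟨Sum.inl i, Finset.mem_filter.2 ⟨Finset.mem_univ _, hi⟩⟩
    · exact ⟨Sum.inr (Sum.inl (i, i', b, b', a, a')),
        Finset.mem_filter.2 ⟨Finset.mem_univ _, hi⟩⟩
    · exact ⟨Sum.inr (Sum.inr (Sum.inl (z, a, c, j))),
        Finset.mem_filter.2 ⟨Finset.mem_univ _, hi⟩⟩
    · exact ⟨Sum.inr (Sum.inr (Sum.inr (z, a, c, j))),
        Finset.mem_filter.2 ⟨Finset.mem_univ _, hi⟩⟩
  have b1 : ∑ i, ((G1 i).card : ℝ) ≤ (K + 1) * ((unphased J K L).card : ℝ) ^ 2 := by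
    calc ∑ i, ((G1 i).card : ℝ) ≤ ∑ _i : Fin (K + 1), ((unphased J K L).card : ℝ) ^ 2 := by
          refine Finset.sum_le_sum fun i _ => ?_
          exact_mod_cast card_faces_unphased_le i
      _ = _ := by simp
  have b2 : ∑ i, ((G2 i).card : ℝ) ≤ 4 * (K + 1) ^ 2 * L ^ 2 * X := by
    calc ∑ i, ((G2 i).card : ℝ) ≤ ∑ _i : I2, X := by
          refine Finset.sum_le_sum fun p _ => ?_
          by_cases hp : p.1 = p.2.1
          · have : G2 p = ∅ := Finset.filter_eq_empty_iff.2 fun h _ h' => h'.1 hp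
            rw [this, Finset.card_empty, Nat.cast_zero]; exact hX0
          · exact card_crossing_le _ _ hp _ _ _ _ (G2 p)
              (fun h hh => (Finset.mem_filter.1 hh).2.2) inferInstance
      _ = _ := by
          rw [Finset.sum_const, nsmul_eq_mul, Finset.card_univ]
          congr 1
          simp only [I2, Fintype.card_prod, Fintype.card_fin, ZMod.card]
          push_cast; ring
  have b34 : ∀ G' : I3 → Finset A, (∀ p, 2 ^ (K + 1) * ((G' p).card : ℝ) ≤ X) →
      ∑ i, ((G' i).card : ℝ) ≤ L ^ 2 * Fintype.card J * X := by
    intro G' hG'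
    calc ∑ i, ((G' i).card : ℝ) ≤ ∑ _i : I3, X / 2 ^ (K + 1) := by
          refine Finset.sum_le_sum fun p _ => ?_
          rw [le_div_iff₀ (by positivity), mul_comm]
          exact hG' p
      _ = _ := by
          rw [Finset.sum_const, nsmul_eq_mul, Finset.card_univ]
          simp only [I3, Fintype.card_prod, Fintype.card_fin, card_cube]
          push_cast
          field_simp
  have b3 := b34 G3 fun p => card_single_defect_le _ _ _ _ (G3 p)
    fun h hh => (Finset.mem_filter.1 hh).2
  have b4 := b34 G4 fun p => by
    have h1 : (G4 p).card = ((G4 p).image fun h j x => (h j x).swap).card := by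
      rw [Finset.card_image_of_injective]
      intro h h' e
      funext j x
      exact Prod.swap_injective (congrFun (congrFun e j) x)
    rw [h1]
    apply card_single_defect_le
    intro h hh
    obtain ⟨g, hg, rfl⟩ := Finset.mem_image.1 hh
    exact (Finset.mem_filter.1 hg).2
  calc ((unphased J (K + 1) L).card : ℝ) ≤ ((∑ i, (G i).card : ℕ) : ℝ) := by exact_mod_cast hcov
    _ = ∑ i, ((G1 i).card : ℝ) + (∑ i, ((G2 i).card : ℝ) + (∑ i, ((G3 i).card : ℝ) +
          ∑ i, ((G4 i).card : ℝ))) := by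
        push_cast
        simp only [Fintype.sum_sum_type, G, Sum.elim_inl, Sum.elim_inr]
    _ ≤ _ := by nlinarith

/-- Almost all pairs of height functions on `K_{J,J} □ Q_k` have a constant side. -/
lemma card_unphased_le [Nonempty J] (k : ℕ) (hk : k ≤ L) (hm : Fintype.card J ≤ L)
    (hsmall : 24 * (L : ℝ) ^ 5 * (3 / 4) ^ Fintype.card J ≤ 1) :
    ((unphased J k L).card : ℝ) ≤
      12 * L ^ 4 * (3 / 4) ^ Fintype.card J * 2 ^ (Fintype.card J * 2 ^ k) := by
  set m := Fintype.card J with hmdef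
  set q : ℝ := (3 / 4) ^ m with hq
  have hq0 : 0 < q := by positivity
  induction k with
  | zero => rw [card_unphased_zero, Nat.cast_zero]; positivity
  | succ k ih =>
    have ih := ih (by omega)
    set T : ℝ := 2 ^ (m * 2 ^ k) with hT
    have hTT : (2 : ℝ) ^ (m * 2 ^ (k + 1)) = T ^ 2 := by
      rw [hT, ← pow_mul]; congr 1; ring
    have hstep := card_unphased_succ (J := J) (L := L) k
    rw [← hmdef, hTT, ← hq] at hstep
    rw [hTT]
    have hkL : (k : ℝ) + 1 ≤ L := by exact_mod_cast hk
    have hL1 : (1 : ℝ) ≤ L := by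
      have : (0 : ℝ) ≤ k := Nat.cast_nonneg k
      linarith
    have hmL : (m : ℝ) ≤ L := by exact_mod_cast hm
    have h1 : ((k : ℝ) + 1) * ((unphased J k L).card : ℝ) ^ 2 ≤ L * (12 * L ^ 4 * q * T) ^ 2 := by
      gcongr
    have h2 : (4 * ((k : ℝ) + 1) ^ 2 * L ^ 2 + 2 * L ^ 2 * m) ≤ 6 * L ^ 4 := by
      have e1 : 4 * ((k : ℝ) + 1) ^ 2 * L ^ 2 ≤ 4 * (L : ℝ) ^ 2 * L ^ 2 := by gcongr
      have e2 : 2 * (L : ℝ) ^ 2 * m ≤ 2 * (L : ℝ) ^ 2 * L ^ 2 := by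
        gcongr
        nlinarith
      nlinarith
    have h3 : (4 * ((k : ℝ) + 1) ^ 2 * L ^ 2 + 2 * L ^ 2 * m) * (q * T ^ 2) ≤
        6 * L ^ 4 * (q * T ^ 2) := by gcongr
    have h4 : L * (12 * L ^ 4 * q * T) ^ 2 ≤ 6 * L ^ 4 * (q * T ^ 2) := by
      have : L * (12 * L ^ 4 * q * T) ^ 2 = (24 * (L : ℝ) ^ 5 * q) * (6 * L ^ 4 * (q * T ^ 2)) := by
        ring
      rw [this]
      exact mul_le_of_le_one_left (by positivity) hsmall
    calc _ ≤ _ := hstep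
      _ ≤ 6 * L ^ 4 * (q * T ^ 2) + 6 * L ^ 4 * (q * T ^ 2) := by linarith
      _ = _ := by ring

end Unphased
section Parity

variable {ι : Type*} [Fintype ι] [DecidableEq ι]

/-- The parity of a point of the cube. -/
def par (x : Cube ι) : ZMod 2 := ∑ i, x i

lemma par_add (x y : Cube ι) : par (x + y) = par x + par y := by
  simp [par, Finset.sum_add_distrib]

lemma par_unit (i : ι) : par (unit i) = 1 := by
  simp [par]

lemma par_add_unit (x : Cube ι) (i : ι) : par (x + unit i) = par x + 1 := by
  rw [par_add, par_unit]

/-- The points of the cube of a given parity. -/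
abbrev Half (ι : Type*) [Fintype ι] (p : ZMod 2) := {x : Cube ι // par x = p}

def flip (p : ZMod 2) (i : ι) (x : Half ι (p + 1)) : Half ι p :=
  ⟨x.1 + unit i, by rw [par_add_unit, x.2, add_assoc, zmod_two_add_self, add_zero]⟩

def flipEquiv (p : ZMod 2) (i : ι) : Half ι p ≃ Half ι (p + 1) where
  toFun x := ⟨x.1 + unit i, by rw [par_add_unit, x.2]⟩
  invFun := flip p i
  left_inv x := Subtype.ext (add_add_cancel_self _ _)
  right_inv x := Subtype.ext (add_add_cancel_self _ _)

lemma two_mul_card_half [Nonempty ι] (p : ZMod 2) :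
    2 * Fintype.card (Half ι p) = 2 ^ Fintype.card ι := by
  obtain ⟨i⟩ := ‹Nonempty ι›
  have h1 : Fintype.card (Half ι (p + 1)) = Fintype.card (Half ι p) :=
    (Fintype.card_congr (flipEquiv p i)).symm
  have h2 : Fintype.card (Cube ι) = ∑ q : ZMod 2, Fintype.card (Half ι q) := by
    rw [← Fintype.card_sigma]
    exact Fintype.card_congr (Equiv.sigmaFiberEquiv par).symm
  rw [card_cube] at h2
  rw [h2]
  have : ∀ f : ZMod 2 → ℕ, ∑ q, f q = f p + f (p + 1) := by
    intro f
    have e : ∑ q, f q = f 0 + f 1 := Fin.sum_univ_two f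
    rw [e]
    rcases zmod_two_eq_or p 0 with rfl | rfl
    · rfl
    · exact add_comm _ _
  rw [this, h1, two_mul]

lemma card_half [Nonempty ι] (p : ZMod 2) :
    Fintype.card (Half ι p) = 2 ^ (Fintype.card ι - 1) := by
  have h := two_mul_card_half (ι := ι) p
  have : 1 ≤ Fintype.card ι := Fintype.card_pos
  obtain ⟨n, hn⟩ := Nat.exists_eq_add_of_le' this
  rw [hn, pow_succ] at h
  rw [hn, Nat.add_sub_cancel]
  omega

end Parity

section Hamming

variable {r : ℕ}

/-- The syndrome of a word with coordinates indexed by `𝔽₂ ^ r`. -/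
def syndrome (x : Cube (Cube (Fin r))) : Cube (Fin r) := ∑ t, x t • t

lemma syndrome_add_unit (x : Cube (Cube (Fin r))) (t : Cube (Fin r)) :
    syndrome (x + unit t) = syndrome x + t := by
  simp [syndrome, add_smul, Finset.sum_add_distrib, Pi.single_apply, ite_smul]

/-- The odd words of a given syndrome. -/
abbrev Code (r : ℕ) (γ : Cube (Fin r)) := {v : Half (Cube (Fin r)) (0 + 1) // syndrome v.1 = γ}

/-- Balls around the odd words of a given syndrome partition the even words. -/
def codeEquiv (γ : Cube (Fin r)) : Code r γ × Cube (Fin r) ≃ Half (Cube (Fin r)) 0 where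
  toFun p := flip 0 p.2 p.1.1
  invFun u := (⟨⟨u.1 + unit (syndrome u.1 + γ), by rw [par_add_unit, u.2]⟩, by
    rw [syndrome_add_unit, ← add_assoc, cube_add_self, zero_add]⟩, syndrome u.1 + γ)
  left_inv := by
    rintro ⟨⟨v, rfl⟩, t⟩
    have h : syndrome (flip 0 t v).1 + syndrome v.1 = t := by
      rw [flip, syndrome_add_unit, add_comm (syndrome v.1), add_add_cancel_self]
    refine Prod.ext (Subtype.ext (Subtype.ext ?_)) h
    simp only [h]
    exact add_add_cancel_self _ _
  right_inv u := Subtype.ext (add_add_cancel_self _ _)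

lemma card_code (hr : 0 < r) (γ : Cube (Fin r)) :
    Fintype.card (Code r γ) = 2 ^ (2 ^ r - 1 - r) := by
  have h := Fintype.card_congr (codeEquiv γ)
  rw [Fintype.card_prod, card_cube, Fintype.card_fin, card_half, card_cube, Fintype.card_fin] at h
  have h3 : r < 2 ^ r := Nat.lt_two_pow_self
  have h2 : 2 ^ (2 ^ r - 1) = 2 ^ (2 ^ r - 1 - r) * 2 ^ r := by
    rw [← pow_add]; congr 1; omega
  rw [h2] at h
  exact Nat.eq_of_mul_eq_mul_right (by positivity) h

lemma prod_le_avg_pow {ι : Type*} [Fintype ι] [Nonempty ι] (F : ι → ℝ) (hF : ∀ i, 0 ≤ F i) :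
    ∏ i, F i ≤ (∑ i, F i ^ Fintype.card ι) / Fintype.card ι := by
  have hm : (Fintype.card ι : ℝ) ≠ 0 := by
    exact_mod_cast Fintype.card_ne_zero
  have := Real.geom_mean_le_arith_mean_weighted Finset.univ
    (fun _ : ι => ((Fintype.card ι : ℝ))⁻¹) (fun i => F i ^ Fintype.card ι)
    (fun _ _ => by positivity) (by simp [hm]) (fun i _ => pow_nonneg (hF i) _)
  rw [← Finset.mul_sum, inv_mul_eq_div] at this
  refine le_trans (le_of_eq (Finset.prod_congr rfl fun i _ => ?_)) this
  rw [Real.pow_rpow_inv_natCast (hF i) Fintype.card_ne_zero]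

lemma sum_const_div_card {κ : Type*} [Fintype κ] [Nonempty κ] {n : ℕ}
    (hn : Fintype.card κ = n) (A : ℝ) : (∑ _i : κ, A) / (n : ℝ) = A := by
  subst hn
  rw [Finset.sum_const, Finset.card_univ, nsmul_eq_mul]
  exact mul_div_cancel_left₀ _ (Nat.cast_ne_zero.2 Fintype.card_ne_zero)

/-- The Hölder inequality over the cosets of the Hamming code. -/
lemma sum_prod_ball_le (hr : 0 < r) {S : Type*} [Fintype S] [DecidableEq S]
    (w : (Cube (Fin r) → S) → ℝ) (hw : ∀ φ, 0 ≤ w φ) :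
    ∑ X : Half (Cube (Fin r)) 0 → S, ∏ v, w (fun t => X (flip 0 t v)) ≤
      (∑ φ, w φ ^ 2 ^ r) ^ 2 ^ (2 ^ r - 1 - r) := by
  obtain ⟨N, hN⟩ : ∃ N, N = 2 ^ (2 ^ r - 1 - r) := ⟨_, rfl⟩
  rw [← hN]
  have hcard : Fintype.card (Cube (Fin r)) = 2 ^ r := by rw [card_cube, Fintype.card_fin]
  have hsum : ∀ γ : Cube (Fin r), ∑ X : Half (Cube (Fin r)) 0 → S,
      (∏ v : Code r γ, w (fun t => X (flip 0 t v.1))) ^ 2 ^ r = (∑ φ, w φ ^ 2 ^ r) ^ N := by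
    intro γ
    calc _ = ∑ X : Half (Cube (Fin r)) 0 → S, ∏ v : Code r γ,
            (fun φ => w φ ^ 2 ^ r) (((Equiv.arrowCongr (codeEquiv γ).symm (Equiv.refl S)).trans
              (Equiv.curry _ _ _)) X v) := by
          refine Finset.sum_congr rfl fun X _ => ?_
          rw [← Finset.prod_pow]
          rfl
      _ = ∑ y : Code r γ → Cube (Fin r) → S, ∏ v, (fun φ => w φ ^ 2 ^ r) (y v) :=
          Equiv.sum_comp ((Equiv.arrowCongr (codeEquiv γ).symm (Equiv.refl S)).trans
              (Equiv.curry _ _ _)) fun y => ∏ v, (fun φ => w φ ^ 2 ^ r) (y v)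
      _ = ∏ _v : Code r γ, ∑ φ, w φ ^ 2 ^ r := by
          rw [Finset.prod_univ_sum, Fintype.piFinset_univ]
      _ = _ := by rw [Finset.prod_const, Finset.card_univ, card_code hr, hN]
  calc _ = ∑ X : Half (Cube (Fin r)) 0 → S, ∏ γ : Cube (Fin r),
          ∏ v : Code r γ, w (fun t => X (flip 0 t v.1)) := by
        refine Finset.sum_congr rfl fun X _ => ?_
        exact (Fintype.prod_fiberwise (fun v : Half (Cube (Fin r)) (0 + 1) => syndrome v.1)
          fun v => w (fun t => X (flip 0 t v))).symm
    _ ≤ ∑ X : Half (Cube (Fin r)) 0 → S, (∑ γ : Cube (Fin r),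
          (∏ v : Code r γ, w (fun t => X (flip 0 t v.1))) ^ 2 ^ r) / (2 ^ r : ℕ) := by
        refine Finset.sum_le_sum fun X _ => ?_
        have := prod_le_avg_pow (fun γ : Cube (Fin r) =>
          ∏ v : Code r γ, w (fun t => X (flip 0 t v.1)))
          (fun γ => Finset.prod_nonneg fun _ _ => hw _)
        rw [hcard] at this
        exact this
    _ = (∑ γ : Cube (Fin r), (∑ φ, w φ ^ 2 ^ r) ^ N) / (2 ^ r : ℕ) := by
        rw [← Finset.sum_div, Finset.sum_comm]
        exact congrArg (· / ((2 ^ r : ℕ) : ℝ)) (Finset.sum_congr rfl fun γ _ => hsum γ)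
    _ = _ := sum_const_div_card hcard _

end Hamming
section Ordered

variable {ι : Type*} [DecidableEq ι] {L : ℕ}

/-- Neighbouring points of the cube have near values. -/
def IsHom (g : Cube ι → Fin L) : Prop := ∀ x i, near (g x) (g (x + unit i))

variable [Fintype ι]

/-- `X` is constant on the points of parity `p`, and on no subcube of codimension `m` is it
constant on the points of the other parity. -/
def Ordered (m : ℕ) (p : ZMod 2) (X : Cube ι → Fin L) : Prop :=
  (∃ a, ∀ y, par y = p → X y = a) ∧ ∀ A : Finset ι, A.card = m → ∀ (w : Cube ι) (b : Fin L),
    ∃ y, (∀ i ∈ A, y i = w i) ∧ par y = p + 1 ∧ X y ≠ b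

lemma two_pow_le_card_subcube_half (A : Finset ι) (w : Cube ι) (q : ZMod 2)
    (hA : A.card < Fintype.card ι) :
    2 ^ (Fintype.card ι - A.card - 1) ≤
      (Finset.univ.filter fun y : Cube ι => (∀ i ∈ A, y i = w i) ∧ par y = q).card := by
  set S := Finset.univ.filter fun y : Cube ι => ∀ i ∈ A, y i = w i with hS
  have hScard : S.card = 2 ^ (Fintype.card ι - A.card) := by
    have : S = Fintype.piFinset fun i => if i ∈ A then {w i} else Finset.univ := by
      ext y
      simp only [hS, Finset.mem_filter, Finset.mem_univ, true_and, Fintype.mem_piFinset]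
      refine forall_congr' fun i => ?_
      by_cases hi : i ∈ A <;> simp [hi]
    rw [this, Fintype.card_piFinset]
    have h2 : ∀ i, (if i ∈ A then {w i} else (Finset.univ : Finset (ZMod 2))).card =
        if i ∈ A then 1 else 2 := by
      intro i; split_ifs <;> simp [ZMod.card]
    simp only [h2]
    rw [Finset.prod_ite, Finset.prod_const_one, one_mul, Finset.prod_const,
      Finset.filter_notMem_eq_sdiff, Finset.card_sdiff_of_subset (Finset.subset_univ _),
      Finset.card_univ]
  obtain ⟨i₀, hi₀⟩ : ∃ i, i ∉ A := by
    by_contra! H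
    have : A = Finset.univ := Finset.eq_univ_iff_forall.2 H
    rw [this, Finset.card_univ] at hA
    exact lt_irrefl _ hA
  have hsplit := Finset.card_filter_add_card_filter_not (s := S) (fun y => par y = q)
  have hle : (S.filter fun y => ¬ par y = q).card ≤ (S.filter fun y => par y = q).card := by
    apply Finset.card_le_card_of_injOn (fun y => y + unit i₀)
    · intro y hy
      have hy := Finset.mem_filter.1 hy
      have hyS := (Finset.mem_filter.1 hy.1).2
      refine Finset.mem_filter.2 ⟨Finset.mem_filter.2 ⟨Finset.mem_univ _, fun i hi => ?_⟩, ?_⟩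
      · have : i ≠ i₀ := fun h => hi₀ (h ▸ hi)
        simp [this, hyS i hi]
      · rw [par_add_unit, (zmod_two_ne_iff _ _).1 hy.2, add_assoc, zmod_two_add_self, add_zero]
    · intro y _ y' _ h
      exact add_right_cancel h
  have hfil : (S.filter fun y => par y = q) =
      Finset.univ.filter fun y : Cube ι => (∀ i ∈ A, y i = w i) ∧ par y = q := by
    rw [hS, Finset.filter_filter]
  rw [← hfil]
  have h2 : 2 ^ (Fintype.card ι - A.card) = 2 * 2 ^ (Fintype.card ι - A.card - 1) := by
    rw [← pow_succ']; congr 1; omega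
  omega

end Ordered

section Fibres

variable {J : Type*} [Fintype J] [DecidableEq J] {k L : ℕ}

/-- The left side is constant and part of the right side of row `j₀` is constant. -/
def FrozenLeft (j₀ : J) (a b : Fin L) (A : Finset (Fin k)) (w : Cube (Fin k)) (q : ZMod 2)
    (h : J → Cube (Fin k) → Fin L × Fin L) : Prop :=
  RowHom h ∧ (∀ j x, (h j x).1 = a) ∧
    ∀ y, ((∀ i ∈ A, y i = w i) ∧ par y = q) → (h j₀ y).2 = b

lemma card_frozenLeft_le (j₀ : J) (a b : Fin L) (A : Finset (Fin k)) (w : Cube (Fin k))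
    (q : ZMod 2) (hA : A.card < k) (F : Finset (J → Cube (Fin k) → Fin L × Fin L))
    (hF : ∀ h ∈ F, FrozenLeft j₀ a b A w q h) :
    F.card ≤ 2 ^ (Fintype.card J * 2 ^ k - 2 ^ (k - A.card - 1)) := by
  set S := Finset.univ.filter fun y : Cube (Fin k) => (∀ i ∈ A, y i = w i) ∧ par y = q with hS
  have hScard : 2 ^ (k - A.card - 1) ≤ S.card := by
    have := two_pow_le_card_subcube_half A w q (by rwa [Fintype.card_fin])
    rw [Fintype.card_fin] at this
    rw [hS]; convert this
  let opt : J × Cube (Fin k) → Finset (Fin L × Fin L) := fun x =>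
    if x ∈ S.map (Function.Embedding.sectR j₀ _) then {(a, b)}
    else {a} ×ˢ (Finset.univ.filter fun b => near a b)
  have hopt : ∀ x, (opt x).card ≤ if x ∈ S.map (Function.Embedding.sectR j₀ _) then 1 else 2 := by
    intro x
    by_cases hx : x ∈ S.map (Function.Embedding.sectR j₀ _)
    · rw [if_pos hx, show opt x = _ from if_pos hx, Finset.card_singleton]
    · rw [if_neg hx, show opt x = _ from if_neg hx, Finset.card_product, Finset.card_singleton,
        one_mul]
      exact card_near_le a
  calc F.card = (F.image fun h (x : J × Cube (Fin k)) => h x.1 x.2).card := by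
        rw [Finset.card_image_of_injective]
        intro h h' e
        funext j x
        exact congrFun e (j, x)
    _ ≤ ∏ x, (opt x).card := by
        apply card_le_prod_options
        intro f hf
        obtain ⟨h, hh, rfl⟩ := Finset.mem_image.1 hf
        obtain ⟨h1, h2, h3⟩ := hF h hh
        rintro ⟨j, y⟩
        by_cases hx : (j, y) ∈ S.map (Function.Embedding.sectR j₀ _)
        · rw [show opt (j, y) = _ from if_pos hx, Finset.mem_singleton]
          obtain ⟨y', hy', e⟩ := Finset.mem_map.1 hx
          simp only [Function.Embedding.sectR_apply, Prod.mk.injEq] at e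
          obtain ⟨rfl, rfl⟩ := e
          exact Prod.ext (h2 _ _) (h3 _ (Finset.mem_filter.1 hy').2)
        · rw [show opt (j, y) = _ from if_neg hx, Finset.mem_product, Finset.mem_singleton,
            Finset.mem_filter]
          refine ⟨h2 _ _, Finset.mem_univ _, ?_⟩
          have := h1.cross j j y
          rwa [h2] at this
    _ ≤ ∏ x, if x ∈ S.map (Function.Embedding.sectR j₀ _) then 1 else 2 :=
        Finset.prod_le_prod' fun x _ => hopt x
    _ = 2 ^ (Fintype.card J * 2 ^ k - S.card) := by
        rw [Finset.prod_ite, Finset.prod_const_one, one_mul, Finset.prod_const,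
          Finset.filter_notMem_eq_sdiff, Finset.card_sdiff_of_subset (Finset.subset_univ _),
          Finset.card_map, Finset.card_univ, Fintype.card_prod, card_cube, Fintype.card_fin]
    _ ≤ _ := Nat.pow_le_pow_right (by norm_num) (by omega)

/-- A family of disordered functions together with a family of functions near to them. -/
def DisorderedPair (m : ℕ) (P : (J → Cube (Fin k) → Fin L) × (J → Cube (Fin k) → Fin L)) : Prop :=
  (∀ t, IsHom (P.1 t) ∧ ∀ p, ¬ Ordered m p (P.1 t)) ∧ (∀ t, IsHom (P.2 t)) ∧
    ∀ t s y, near (P.1 t y) (P.2 s y)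

/-- Interlace two families of functions according to parity. -/
def interlace (P : (J → Cube (Fin k) → Fin L) × (J → Cube (Fin k) → Fin L)) :
    J → Cube (Fin k) → Fin L × Fin L :=
  fun j x => if par x = 0 then (P.1 j x, P.2 j x) else (P.2 j x, P.1 j x)

lemma interlace_injective : Function.Injective (interlace (J := J) (k := k) (L := L)) := by
  rintro ⟨X, Y⟩ ⟨X', Y'⟩ h
  have h' : ∀ j x, X j x = X' j x ∧ Y j x = Y' j x := by
    intro j x
    have := congrFun (congrFun h j) x
    unfold interlace at this
    split_ifs at this <;> simpa [and_comm] using this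
  exact Prod.ext (funext fun j => funext fun x => (h' j x).1)
    (funext fun j => funext fun x => (h' j x).2)

lemma DisorderedPair.rowHom {m : ℕ}
    {P : (J → Cube (Fin k) → Fin L) × (J → Cube (Fin k) → Fin L)} (hP : DisorderedPair m P) :
    RowHom (interlace P) where
  cross j j' x := by
    unfold interlace
    split_ifs
    · exact hP.2.2 j j' x
    · exact (hP.2.2 j' j x).symm
  step j x i := by
    have h := par_add_unit x i
    unfold interlace
    rcases zmod_two_eq_or (par x) 0 with h0 | h1
    · rw [h0, zero_add] at h
      rw [if_pos h0, if_neg (by rw [h]; decide)]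
      exact (hP.1 j).1 x i
    · rw [h1, add_assoc, zmod_two_add_self, add_zero] at h
      rw [if_neg (by rw [h1]; decide), if_pos h]
      exact hP.2.1 j x i

lemma DisorderedPair.classify {m : ℕ} (j₀ : J)
    {P : (J → Cube (Fin k) → Fin L) × (J → Cube (Fin k) → Fin L)} (hP : DisorderedPair m P) :
    Unphased (interlace P) ∨
    (∃ a b A w, A.card = m ∧ FrozenLeft j₀ a b A w 1 (interlace P)) ∨
    (∃ a b A w, A.card = m ∧ FrozenLeft j₀ a b A w 0 (fun j x => (interlace P j x).swap)) := by
  by_cases hl : LeftConst (interlace P)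
  · right; left
    obtain ⟨a, ha⟩ := hl
    have h1 := (hP.1 j₀).2 0
    unfold Ordered at h1
    rw [not_and] at h1
    have h2 := h1 ⟨a, fun y hy => by
      have := ha j₀ y
      rwa [interlace, if_pos hy] at this⟩
    push Not at h2
    obtain ⟨A, hA, w, b, H⟩ := h2
    refine ⟨a, b, A, w, hA, hP.rowHom, ha, fun y hy => ?_⟩
    rw [interlace, if_neg (by rw [hy.2]; decide)]
    exact H y hy.1 hy.2
  by_cases hr : RightConst (interlace P)
  · right; right
    obtain ⟨a, ha⟩ := hr
    have h1 := (hP.1 j₀).2 1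
    unfold Ordered at h1
    rw [not_and] at h1
    have h2 := h1 ⟨a, fun y hy => by
      have := ha j₀ y
      rwa [interlace, if_neg (by rw [hy]; decide)] at this⟩
    push Not at h2
    obtain ⟨A, hA, w, b, H⟩ := h2
    refine ⟨a, b, A, w, hA, hP.rowHom.swap, ha, fun y hy => ?_⟩
    show (interlace P j₀ y).swap.2 = b
    rw [interlace, if_pos hy.2]
    exact H y hy.1 hy.2
  · exact Or.inl ⟨hP.rowHom, hl, hr⟩

open scoped Classical in
lemma card_disorderedPair_le [Nonempty J] {m : ℕ} (hm : m < k)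
    (F : Finset ((J → Cube (Fin k) → Fin L) × (J → Cube (Fin k) → Fin L)))
    (hF : ∀ P ∈ F, DisorderedPair m P) :
    (F.card : ℝ) ≤ (unphased J k L).card +
      2 * (L ^ 2 * 4 ^ k * 2 ^ (Fintype.card J * 2 ^ k - 2 ^ (k - m - 1))) := by
  obtain ⟨j₀⟩ := ‹Nonempty J›
  let I := Fin L × Fin L × Finset (Fin k) × Cube (Fin k)
  let A := (J → Cube (Fin k) → Fin L) × (J → Cube (Fin k) → Fin L)
  let G0 : Unit → Finset A := fun _ => F.filter fun P => Unphased (interlace P)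
  let G1 : I → Finset A := fun p => F.filter fun P =>
    p.2.2.1.card = m ∧ FrozenLeft j₀ p.1 p.2.1 p.2.2.1 p.2.2.2 1 (interlace P)
  let G2 : I → Finset A := fun p => F.filter fun P =>
    p.2.2.1.card = m ∧ FrozenLeft j₀ p.1 p.2.1 p.2.2.1 p.2.2.2 0
      (fun j x => (interlace P j x).swap)
  let G : Unit ⊕ I ⊕ I → Finset A := Sum.elim G0 (Sum.elim G1 G2)
  have hcov : F.card ≤ ∑ i, (G i).card := by
    apply card_le_sum_of_cover
    intro P hP
    rcases (hF P hP).classify j₀ with h | ⟨a, b, S, w, h⟩ | ⟨a, b, S, w, h⟩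
    · exact ⟨Sum.inl (), Finset.mem_filter.2 ⟨hP, h⟩⟩
    · exact ⟨Sum.inr (Sum.inl (a, b, S, w)), Finset.mem_filter.2 ⟨hP, h⟩⟩
    · exact ⟨Sum.inr (Sum.inr (a, b, S, w)), Finset.mem_filter.2 ⟨hP, h⟩⟩
  set B := 2 ^ (Fintype.card J * 2 ^ k - 2 ^ (k - m - 1)) with hB
  have b0 : (G0 ()).card ≤ (unphased J k L).card := by
    rw [← Finset.card_image_of_injective _ interlace_injective]
    refine Finset.card_le_card fun h hh => ?_
    obtain ⟨P, hP, rfl⟩ := Finset.mem_image.1 hh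
    exact mem_unphased.2 (Finset.mem_filter.1 hP).2
  have b1 : ∀ p, (G1 p).card ≤ B := by
    intro p
    by_cases hp : p.2.2.1.card = m
    · rw [← Finset.card_image_of_injective _ interlace_injective, hB, ← hp]
      apply card_frozenLeft_le j₀ p.1 p.2.1 p.2.2.1 p.2.2.2 1 (by omega)
      intro h hh
      obtain ⟨P, hP, rfl⟩ := Finset.mem_image.1 hh
      exact (Finset.mem_filter.1 hP).2.2
    · have : G1 p = ∅ := Finset.filter_eq_empty_iff.2 fun h _ h' => hp h'.1
      rw [this, Finset.card_empty]; exact Nat.zero_le _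
  have b2 : ∀ p, (G2 p).card ≤ B := by
    intro p
    by_cases hp : p.2.2.1.card = m
    · have hinj : Function.Injective fun (P : A) j x => (interlace P j x).swap := by
        intro P P' e
        apply interlace_injective
        funext j x
        exact Prod.swap_injective (congrFun (congrFun e j) x)
      rw [← Finset.card_image_of_injective _ hinj, hB, ← hp]
      apply card_frozenLeft_le j₀ p.1 p.2.1 p.2.2.1 p.2.2.2 0 (by omega)
      intro h hh
      obtain ⟨P, hP, rfl⟩ := Finset.mem_image.1 hh
      exact (Finset.mem_filter.1 hP).2.2
    · have : G2 p = ∅ := Finset.filter_eq_empty_iff.2 fun h _ h' => hp h'.1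
      rw [this, Finset.card_empty]; exact Nat.zero_le _
  have hI : Fintype.card I = L ^ 2 * 4 ^ k := by
    simp only [I, Fintype.card_prod, Fintype.card_fin, Fintype.card_finset, card_cube]
    rw [show 4 = 2 * 2 by norm_num, mul_pow]; ring
  have hN : F.card ≤ (unphased J k L).card + 2 * (L ^ 2 * 4 ^ k * B) := by
    refine hcov.trans ?_
    simp only [Fintype.sum_sum_type, G, Sum.elim_inl, Sum.elim_inr]
    have s1 : ∑ p, (G1 p).card ≤ L ^ 2 * 4 ^ k * B := by
      rw [← hI, ← Finset.card_univ]
      exact Finset.sum_le_card_nsmul _ _ _ fun p _ => b1 p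
    have s2 : ∑ p, (G2 p).card ≤ L ^ 2 * 4 ^ k * B := by
      rw [← hI, ← Finset.card_univ]
      exact Finset.sum_le_card_nsmul _ _ _ fun p _ => b2 p
    simp only [Finset.univ_unique, Finset.sum_singleton]
    have := b0
    change (G0 ()).card + _ ≤ _
    omega
  have := (Nat.cast_le (α := ℝ)).2 hN
  simp only [hB] at this
  push_cast at this
  exact this

end Fibres
variable {k L r : ℕ}

open scoped Classical in
/-- The functions which can surround a disordered family `φ`. -/
noncomputable def surrounding {J : Type*} [Fintype J] (m : ℕ)
    (φ : J → Cube (Fin k) → Fin L) : Finset (Cube (Fin k) → Fin L) :=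
  Finset.univ.filter fun Y => (∀ t, IsHom (φ t) ∧ ∀ p, ¬ Ordered m p (φ t)) ∧ IsHom Y ∧
    ∀ t y, near (φ t y) (Y y)

open scoped Classical in
/-- All disordered pairs. -/
noncomputable def disorderedPairs (J : Type*) [Fintype J] (m k L : ℕ) :
    Finset ((J → Cube (Fin k) → Fin L) × (J → Cube (Fin k) → Fin L)) :=
  Finset.univ.filter (DisorderedPair m)

lemma mem_surrounding {J : Type*} [Fintype J] {m : ℕ} {φ : J → Cube (Fin k) → Fin L}
    {Y : Cube (Fin k) → Fin L} : Y ∈ surrounding m φ ↔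
      (∀ t, IsHom (φ t) ∧ ∀ p, ¬ Ordered m p (φ t)) ∧ IsHom Y ∧ ∀ t y, near (φ t y) (Y y) := by
  simp only [surrounding, Finset.mem_filter, Finset.mem_univ, true_and]

lemma mem_disorderedPairs {J : Type*} [Fintype J] {m : ℕ}
    {P : (J → Cube (Fin k) → Fin L) × (J → Cube (Fin k) → Fin L)} :
    P ∈ disorderedPairs J m k L ↔ DisorderedPair m P := by
  simp only [disorderedPairs, Finset.mem_filter, Finset.mem_univ, true_and]

lemma sum_card_surrounding_pow_le {J : Type*} [Fintype J] [DecidableEq J] [Nonempty J] (m : ℕ) :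
    ∑ φ : J → Cube (Fin k) → Fin L, (surrounding m φ).card ^ Fintype.card J ≤
      (disorderedPairs J m k L).card := by
  classical
  have h1 : ∀ φ : J → Cube (Fin k) → Fin L, (surrounding m φ).card ^ Fintype.card J =
      (Fintype.piFinset fun _ : J => surrounding m φ).card := by
    intro φ; rw [Fintype.card_piFinset, Finset.prod_const, Finset.card_univ]
  rw [Finset.sum_congr rfl fun φ _ => h1 φ, ← Finset.card_sigma]
  apply Finset.card_le_card_of_injOn (fun P => (P.1, P.2))
  · rintro ⟨φ, Y⟩ hP
    have hY := Fintype.mem_piFinset.1 (Finset.mem_sigma.1 hP).2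
    have hY' := fun t => mem_surrounding.1 (hY t)
    obtain ⟨t₀⟩ := ‹Nonempty J›
    exact mem_disorderedPairs.2 ⟨(hY' t₀).1, fun t => (hY' t).2.1,
      fun t s y => (hY' s).2.2 t y⟩
  · rintro ⟨φ, Y⟩ _ ⟨φ', Y'⟩ _ e
    obtain ⟨rfl, rfl⟩ := Prod.mk.inj (show (φ, Y) = (φ', Y') from e)
    rfl

lemma card_disordered_family_le (hr : 0 < r) {m : ℕ}
    (F : Finset (Cube (Cube (Fin r)) → Cube (Fin k) → Fin L))
    (hF : ∀ g ∈ F, (∀ u, IsHom (g u)) ∧ (∀ u t y, near (g u y) (g (u + unit t) y)) ∧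
      ∀ u, par u = 0 → ∀ p, ¬ Ordered m p (g u)) :
    (F.card : ℝ) ≤ ((disorderedPairs (Cube (Fin r)) m k L).card : ℝ) ^ 2 ^ (2 ^ r - 1 - r) := by
  classical
  set B : (Half (Cube (Fin r)) 0 → Cube (Fin k) → Fin L) →
    Finset (Half (Cube (Fin r)) (0 + 1) → Cube (Fin k) → Fin L) := fun X =>
      Fintype.piFinset fun v => surrounding m fun t => X (flip 0 t v) with hB
  have h1 : F.card ≤ ∑ X, (B X).card := by
    rw [← Finset.card_sigma]
    apply Finset.card_le_card_of_injOn
      (fun g => (⟨fun x => g x.1, fun v => g v.1⟩ :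
        Σ _ : Half (Cube (Fin r)) 0 → Cube (Fin k) → Fin L,
          (Half (Cube (Fin r)) (0 + 1) → Cube (Fin k) → Fin L)))
    · intro g hg
      obtain ⟨a1, a2, a3⟩ := hF g hg
      refine Finset.mem_sigma.2 ⟨Finset.mem_univ _, Fintype.mem_piFinset.2 fun v =>
        mem_surrounding.2 ⟨fun t => ⟨a1 _, a3 _ (flip 0 t v).2⟩, a1 _,
          fun t y => (a2 _ _ _).symm⟩⟩
    · intro g _ g' _ e
      simp only [Sigma.mk.injEq, heq_eq_eq] at e
      funext u
      rcases zmod_two_eq_or (par u) 0 with h | h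
      · exact congrFun e.1 ⟨u, h⟩
      · exact congrFun e.2 ⟨u, h⟩
  have h2 : (F.card : ℝ) ≤ ∑ X : Half (Cube (Fin r)) 0 → Cube (Fin k) → Fin L,
      ∏ v, ((surrounding m fun t => X (flip 0 t v)).card : ℝ) := by
    refine ((Nat.cast_le (α := ℝ)).2 h1).trans (le_of_eq ?_)
    rw [Nat.cast_sum]
    refine Finset.sum_congr rfl fun X _ => ?_
    rw [hB, Fintype.card_piFinset, Nat.cast_prod]
  refine h2.trans ((sum_prod_ball_le hr (fun φ => ((surrounding m φ).card : ℝ))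
    fun φ => Nat.cast_nonneg _).trans ?_)
  refine pow_le_pow_left₀ (Finset.sum_nonneg fun φ _ => by positivity) ?_ _
  have := sum_card_surrounding_pow_le (k := k) (L := L) (J := Cube (Fin r)) m
  rw [card_cube, Fintype.card_fin] at this
  exact_mod_cast this
variable {ι : Type*} [Fintype ι] [DecidableEq ι] {k L r m : ℕ}

/-- On the fibre over `z` of the coordinates in `T`, the function `g` is ordered. -/
def OrderedAt (g : Cube ι → Fin L) (m : ℕ) (T : Finset ι) (z : Cube ι) (p : ZMod 2) : Prop :=
  (∃ a, ∀ x, (∀ i ∈ T, x i = z i) → par x = p → g x = a) ∧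
    ∀ A : Finset ι, Disjoint A T → A.card = m → ∀ (w : Cube ι) (b : Fin L),
      ∃ x, (∀ i ∈ T, x i = z i) ∧ (∀ i ∈ A, x i = w i) ∧ par x = p + 1 ∧ g x ≠ b

/-- The point of a product of two cubes with given components. -/
def glue {Γ κ : Type*} (e : Γ ⊕ κ ≃ ι) (u : Cube Γ) (y : Cube κ) : Cube ι :=
  fun i => Sum.elim u y (e.symm i)

section Glue

variable {Γ κ : Type*} [Fintype Γ] [DecidableEq Γ] [Fintype κ] [DecidableEq κ] (e : Γ ⊕ κ ≃ ι)

lemma glue_apply_inl (u : Cube Γ) (y : Cube κ) (t : Γ) : glue e u y (e (Sum.inl t)) = u t := by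
  simp [glue]

lemma glue_apply_inr (u : Cube Γ) (y : Cube κ) (j : κ) : glue e u y (e (Sum.inr j)) = y j := by
  simp [glue]

lemma eq_glue {u : Cube Γ} {y : Cube κ} {x : Cube ι} (h1 : ∀ t, x (e (Sum.inl t)) = u t)
    (h2 : ∀ j, x (e (Sum.inr j)) = y j) : x = glue e u y := by
  funext i
  obtain ⟨s | s, rfl⟩ := e.surjective i
  · rw [h1, glue_apply_inl]
  · rw [h2, glue_apply_inr]

lemma par_glue (u : Cube Γ) (y : Cube κ) : par (glue e u y) = par u + par y := by
  unfold par
  rw [← Equiv.sum_comp e, Fintype.sum_sum_type]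
  simp only [glue_apply_inl, glue_apply_inr]

lemma glue_add_unit_left (u : Cube Γ) (y : Cube κ) (t : Γ) :
    glue e (u + unit t) y = glue e u y + unit (e (Sum.inl t)) := by
  symm
  apply eq_glue
  · intro t'
    simp [glue_apply_inl, unit, Pi.single_apply]
  · intro j
    simp [glue_apply_inr, unit]

lemma glue_add_unit_right (u : Cube Γ) (y : Cube κ) (j : κ) :
    glue e u (y + unit j) = glue e u y + unit (e (Sum.inr j)) := by
  symm
  apply eq_glue
  · intro t'
    simp [glue_apply_inl, unit]
  · intro j
    simp [glue_apply_inr, unit, Pi.single_apply]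

lemma Ordered.orderedAt {T : Finset ι} (hT : ∀ i, i ∈ T ↔ ∃ t, e (Sum.inl t) = i)
    {g : Cube ι → Fin L} {u : Cube Γ} (hu : par u = 0) {p : ZMod 2}
    (h : Ordered m p fun y => g (glue e u y)) : OrderedAt g m T (glue e u 0) p := by
  have hfib : ∀ x, (∀ i ∈ T, x i = glue e u 0 i) → ∃ y, x = glue e u y := by
    intro x hx
    refine ⟨fun j => x (e (Sum.inr j)), eq_glue e (fun t => ?_) fun j => rfl⟩
    rw [hx _ ((hT _).2 ⟨t, rfl⟩), glue_apply_inl]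
  obtain ⟨⟨a, ha⟩, h2⟩ := h
  refine ⟨⟨a, fun x hx hp => ?_⟩, fun A hAT hA w b => ?_⟩
  · obtain ⟨y, rfl⟩ := hfib x hx
    exact ha y (by rwa [par_glue, hu, zero_add] at hp)
  · have hAr : ∀ i ∈ A, ∃ j, e (Sum.inr j) = i := by
      intro i hi
      obtain ⟨t | j, rfl⟩ := e.surjective i
      · exact absurd ((hT _).2 ⟨t, rfl⟩) (Finset.disjoint_left.1 hAT hi)
      · exact ⟨j, rfl⟩
    have hinj : Function.Injective fun j => e (Sum.inr j) :=
      e.injective.comp Sum.inr_injective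
    obtain ⟨y, y1, y2, y3⟩ := h2 (A.preimage _ hinj.injOn) (by
      rw [← hA, ← Finset.card_image_of_injective _ hinj, Finset.image_preimage_of_bij]
      exact ⟨fun _ h => h, hinj.injOn, fun i hi => by
        obtain ⟨j, rfl⟩ := hAr i hi
        exact ⟨j, hi, rfl⟩⟩) (fun j => w (e (Sum.inr j))) b
    refine ⟨glue e u y, fun i hi => ?_, fun i hi => ?_, ?_, y3⟩
    · obtain ⟨t, rfl⟩ := (hT i).1 hi
      rw [glue_apply_inl, glue_apply_inl]
    · obtain ⟨j, rfl⟩ := hAr i hi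
      rw [glue_apply_inr]
      exact y1 j (Finset.mem_preimage.2 hi)
    · rw [par_glue, hu, zero_add, y2]

end Glue

lemma card_failing_le (hr : 0 < r) {T : Finset ι} (hT : T.card = 2 ^ r)
    (hd : Fintype.card ι = 2 ^ r + k) (F : Finset (Cube ι → Fin L))
    (hF : ∀ g ∈ F, IsHom g ∧ ∀ z p, ¬ OrderedAt g m T z p) :
    (F.card : ℝ) ≤ ((disorderedPairs (Cube (Fin r)) m k L).card : ℝ) ^ 2 ^ (2 ^ r - 1 - r) := by
  classical
  have e1 : Cube (Fin r) ≃ {i // i ∈ T} := Fintype.equivOfCardEq (by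
    rw [card_cube, Fintype.card_fin, Fintype.card_coe, hT])
  have e2 : Fin k ≃ {i // i ∉ T} := Fintype.equivOfCardEq (by
    rw [Fintype.card_fin, Fintype.card_subtype_compl, Fintype.card_coe, hT, hd]; omega)
  set e : Cube (Fin r) ⊕ Fin k ≃ ι := (Equiv.sumCongr e1 e2).trans (Equiv.sumCompl (· ∈ T)) with he
  have hTe : ∀ i, i ∈ T ↔ ∃ t, e (Sum.inl t) = i := by
    intro i
    constructor
    · intro hi
      exact ⟨e1.symm ⟨i, hi⟩, by simp [he]⟩
    · rintro ⟨t, rfl⟩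
      simp [he]
  have hinj : Function.Injective fun (g : Cube ι → Fin L) u y => g (glue e u y) := by
    intro g g' h
    funext x
    have := congrFun (congrFun h fun t => x (e (Sum.inl t))) fun j => x (e (Sum.inr j))
    simpa only [← eq_glue e (fun _ => rfl) fun _ => rfl] using this
  rw [← Finset.card_image_of_injective _ hinj]
  apply card_disordered_family_le hr
  intro g' hg'
  obtain ⟨g, hg, rfl⟩ := Finset.mem_image.1 hg'
  obtain ⟨h1, h2⟩ := hF g hg
  refine ⟨fun u y i => ?_, fun u t y => ?_, fun u hu p hp => h2 _ _ (hp.orderedAt e hTe hu)⟩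
  · show near (g _) (g _)
    rw [glue_add_unit_right]; exact h1 _ _
  · show near (g _) (g _)
    rw [glue_add_unit_left]; exact h1 _ _

lemma card_disorderedPairs_le (hL : 2 ≤ L) (hk : k ≤ L) (hm : 2 ^ r ≤ L) (hmk : 2 ^ r < k)
    (h1 : 24 * (L : ℝ) ^ 5 * (3 / 4) ^ 2 ^ r ≤ 1)
    (h2 : 8 * (L : ℝ) ^ 2 * 4 ^ k ≤ 2 ^ 2 ^ (k - 2 ^ r - 1)) :
    ((disorderedPairs (Cube (Fin r)) (2 ^ r) k L).card : ℝ) ≤ 2 ^ (2 ^ r * 2 ^ k) / 2 := by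
  classical
  have hc : Fintype.card (Cube (Fin r)) = 2 ^ r := by rw [card_cube, Fintype.card_fin]
  have a1 := card_disorderedPair_le (J := Cube (Fin r)) (L := L) hmk
    (disorderedPairs (Cube (Fin r)) (2 ^ r) k L) fun P hP => mem_disorderedPairs.1 hP
  have a2 := card_unphased_le (J := Cube (Fin r)) (L := L) k hk (by rwa [hc]) (by rwa [hc])
  rw [hc] at a1 a2
  have hL' : (2 : ℝ) ≤ L := by exact_mod_cast hL
  have b1 : 12 * (L : ℝ) ^ 4 * (3 / 4) ^ 2 ^ r ≤ 1 / 4 := by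
    have : 0 ≤ 12 * (L : ℝ) ^ 4 * (3 / 4) ^ 2 ^ r := by positivity
    have e : 24 * (L : ℝ) ^ 5 * (3 / 4) ^ 2 ^ r = (2 * L) * (12 * (L : ℝ) ^ 4 * (3 / 4) ^ 2 ^ r) := by
      ring
    nlinarith
  have hle : 2 ^ (k - 2 ^ r - 1) ≤ 2 ^ r * 2 ^ k := by
    rw [← pow_add]
    exact Nat.pow_le_pow_right (by norm_num) (by omega)
  generalize 2 ^ (k - 2 ^ r - 1) = E at *
  generalize 2 ^ r * 2 ^ k = N at *
  have hN : (2 : ℝ) ^ N = 2 ^ E * 2 ^ (N - E) := by rw [← pow_add]; congr 1; omega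
  have b2 : 2 * ((L : ℝ) ^ 2 * 4 ^ k * 2 ^ (N - E)) ≤ 2 ^ N / 4 := by
    rw [hN]
    have := mul_le_mul_of_nonneg_right h2 (show (0 : ℝ) ≤ 2 ^ (N - E) by positivity)
    linarith
  have b3 := mul_le_mul_of_nonneg_right b1 (show (0 : ℝ) ≤ 2 ^ N by positivity)
  linarith

lemma card_failing_le_two_pow (hr : 0 < r) (hrr : r + 1 ≤ 2 ^ r) {T : Finset ι} (hT : T.card = 2 ^ r)
    (hd : Fintype.card ι = 2 ^ r + k)
    (hL : 2 ≤ L) (hk : k ≤ L) (hm : 2 ^ r ≤ L) (hmk : 2 ^ r < k)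
    (h1 : 24 * (L : ℝ) ^ 5 * (3 / 4) ^ 2 ^ r ≤ 1)
    (h2 : 8 * (L : ℝ) ^ 2 * 4 ^ k ≤ 2 ^ 2 ^ (k - 2 ^ r - 1)) (F : Finset (Cube ι → Fin L))
    (hF : ∀ g ∈ F, IsHom g ∧ ∀ z p, ¬ OrderedAt g (2 ^ r) T z p) :
    (F.card : ℝ) ≤ 2 ^ 2 ^ (Fintype.card ι - 1) / 2 ^ 2 ^ (2 ^ r - 1 - r) := by
  refine (card_failing_le hr hT hd F hF).trans ((pow_le_pow_left₀ (Nat.cast_nonneg _)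
    (card_disorderedPairs_le hL hk hm hmk h1 h2) _).trans (le_of_eq ?_))
  rw [div_pow, ← pow_mul, hd]
  have : 2 ^ r * 2 ^ k * 2 ^ (2 ^ r - 1 - r) = 2 ^ (2 ^ r + k - 1) := by
    rw [← pow_add, ← pow_add]
    congr 1
    omega
  rw [this]
variable {ι : Type*} [Fintype ι] [DecidableEq ι] {L m : ℕ} {g : Cube ι → Fin L}

lemma OrderedAt.coherent {T₁ T₂ : Finset ι} (hT : Disjoint T₁ T₂) (h₁ : T₁.card = m)
    (h₂ : T₂.card = m) (hd : 2 * m < Fintype.card ι) {z₁ z₂ : Cube ι} {p₁ p₂ : ZMod 2}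
    (o₁ : OrderedAt g m T₁ z₁ p₁) (o₂ : OrderedAt g m T₂ z₂ p₂) :
    p₁ = p₂ ∧ ∀ a₁ a₂, (∀ x, (∀ i ∈ T₁, x i = z₁ i) → par x = p₁ → g x = a₁) →
      (∀ x, (∀ i ∈ T₂, x i = z₂ i) → par x = p₂ → g x = a₂) → a₁ = a₂ := by
  have hp : p₁ = p₂ := by
    by_contra hne
    obtain ⟨⟨a, ha⟩, -⟩ := o₂
    obtain ⟨x, x1, x2, x3, x4⟩ := o₁.2 T₂ hT.symm h₂ z₂ a
    exact x4 (ha x x2 (by rw [x3, (zmod_two_ne_iff _ _).1 (Ne.symm hne)]))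
  refine ⟨hp, fun a₁ a₂ ha₁ ha₂ => ?_⟩
  subst hp
  obtain ⟨x, x1, x2, x3, -⟩ := o₁.2 T₂ hT.symm h₂ z₂ a₁
  obtain ⟨i₀, hi₀⟩ : ∃ i, i ∉ T₁ ∪ T₂ := by
    by_contra! H
    have h := Finset.card_union_le T₁ T₂
    rw [Finset.eq_univ_iff_forall.2 H, Finset.card_univ] at h
    omega
  rw [Finset.mem_union, not_or] at hi₀
  have hx : par (x + unit i₀) = p₁ := by
    rw [par_add_unit, x3, add_assoc, zmod_two_add_self, add_zero]
  rw [← ha₁ (x + unit i₀) (fun i hi => ?_) hx, ← ha₂ (x + unit i₀) (fun i hi => ?_) hx]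
  · have : i ≠ i₀ := fun h => hi₀.2 (h ▸ hi)
    simp [unit, this, x2 i hi]
  · have : i ≠ i₀ := fun h => hi₀.1 (h ▸ hi)
    simp [unit, this, x1 i hi]

lemma exists_ground_state (hm : 0 < m) (hd : 3 * m ≤ Fintype.card ι)
    (hg : ∀ T : Finset ι, T.card = m → ∃ z p, OrderedAt g m T z p) :
    ∃ p a, ∀ T : Finset ι, T.card = m → ∃ z : Cube ι,
      ∀ x, (∀ i ∈ T, x i = z i) → par x = p → g x = a := by
  obtain ⟨T₀, -, hT₀⟩ := Finset.exists_subset_card_eq (s := (Finset.univ : Finset ι)) (n := m)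
    (by rw [Finset.card_univ]; omega)
  obtain ⟨z₀, p, o₀⟩ := hg T₀ hT₀
  obtain ⟨a, ha⟩ := o₀.1
  refine ⟨p, a, fun T hT => ?_⟩
  obtain ⟨z, p', o⟩ := hg T hT
  obtain ⟨a', ha'⟩ := o.1
  obtain ⟨T', hT's, hT'⟩ := Finset.exists_subset_card_eq (s := (T₀ ∪ T)ᶜ) (n := m) (by
    have := Finset.card_union_le T₀ T
    rw [Finset.card_compl]; omega)
  obtain ⟨z'', p'', o''⟩ := hg T' hT'
  obtain ⟨a'', ha''⟩ := o''.1
  have hdisj : Disjoint T' (T₀ ∪ T) :=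
    Finset.disjoint_left.2 fun i hi => Finset.mem_compl.1 (hT's hi)
  rw [Finset.disjoint_union_right] at hdisj
  have c1 := o''.coherent hdisj.1 hT' hT₀ (by omega) o₀
  have c2 := o''.coherent hdisj.2 hT' hT (by omega) o
  have e1 := c1.2 _ _ ha'' ha
  have e2 := c2.2 _ _ ha'' ha'
  have e3 := c1.1
  have e4 := c2.1
  subst e3 e4 e1 e2
  exact ⟨z, ha'⟩

open scoped Classical in
lemma card_defects_le (hm : 0 < m) (hd : 2 ≤ Fintype.card ι) {p : ZMod 2} {a : Fin L}
    (h : ∀ T : Finset ι, T.card = m → ∃ z : Cube ι,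
      ∀ x, (∀ i ∈ T, x i = z i) → par x = p → g x = a) (S : Finset (Cube ι))
    (hS : ∀ x ∈ S, par x = p ∧ g x ≠ a) :
    S.card ≤ Fintype.card ι ^ m := by
  let supp : Cube ι → Finset ι := fun x => Finset.univ.filter fun i => x i = 1
  have hsupp : ∀ x i, i ∈ supp x ↔ x i = 1 := by
    intro x i; simp only [supp, Finset.mem_filter, Finset.mem_univ, true_and]
  have hinj : Function.Injective supp := by
    intro x y e
    funext i
    have := (hsupp x i).symm.trans ((by rw [e] : i ∈ supp x ↔ i ∈ supp y).trans (hsupp y i))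
    generalize x i = b at *
    generalize y i = c at *
    revert this b c
    decide
  have key : ∀ T ∈ (S.image supp).shatterer, T.card < m := by
    intro T hT
    by_contra! hlt
    obtain ⟨T', hT's, hT'⟩ := Finset.exists_subset_card_eq hlt
    have hsh : (S.image supp).Shatters T' := (Finset.mem_shatterer.1 hT).mono_right hT's
    obtain ⟨z, hz⟩ := h T' hT'
    obtain ⟨u, hu, e⟩ := hsh (Finset.filter_subset (fun i => z i = 1) T')
    obtain ⟨x, hx, rfl⟩ := Finset.mem_image.1 hu
    obtain ⟨x1, x2⟩ := hS x hx
    refine x2 (hz x (fun i hi => ?_) x1)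
    have h1 : i ∈ T' ∩ supp x ↔ i ∈ T'.filter fun i => z i = 1 := by rw [e]
    rw [Finset.mem_inter, hsupp, Finset.mem_filter, and_iff_right hi, and_iff_right hi] at h1
    generalize x i = b at *
    generalize z i = c at *
    revert h1 b c
    decide
  have hv : (S.image supp).vcDim < m := by
    unfold Finset.vcDim
    exact (Finset.sup_lt_iff hm).2 key
  calc S.card = (S.image supp).card := (Finset.card_image_of_injective _ hinj).symm
    _ ≤ (S.image supp).shatterer.card := Finset.card_le_card_shatterer _
    _ ≤ ∑ i ∈ Finset.Iic (S.image supp).vcDim, (Fintype.card ι).choose i :=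
        Finset.card_shatterer_le_sum_vcDim
    _ ≤ ∑ i ∈ Finset.Iic (S.image supp).vcDim, Fintype.card ι ^ i :=
        Finset.sum_le_sum fun i _ => Nat.choose_le_pow _ _
    _ ≤ _ := (Nat.geomSum_lt hd fun i hi => (Finset.mem_Iic.1 hi).trans_lt hv).le
section Nbhd

variable {ι : Type*} [Fintype ι] [DecidableEq ι]

/-- Points at distance two. -/
def Close (x y : Cube ι) : Prop := ∃ i j, i ≠ j ∧ y = x + unit i + unit j

instance (x y : Cube ι) : Decidable (Close x y) := by
  unfold Close; infer_instance

lemma Close.symm {x y : Cube ι} (h : Close x y) : Close y x := by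
  obtain ⟨i, j, hij, rfl⟩ := h
  exact ⟨j, i, hij.symm, by rw [add_add_cancel_self, add_add_cancel_self]⟩

/-- The neighbourhood of a set of points. -/
def nbhd (S : Finset (Cube ι)) : Finset (Cube ι) :=
  S.biUnion fun x => Finset.univ.image fun i => x + unit i

lemma mem_nbhd {S : Finset (Cube ι)} {y : Cube ι} : y ∈ nbhd S ↔ ∃ i, y + unit i ∈ S := by
  simp only [nbhd, Finset.mem_biUnion, Finset.mem_image, Finset.mem_univ, true_and]
  constructor
  · rintro ⟨x, hx, i, rfl⟩
    exact ⟨i, by rwa [add_add_cancel_self]⟩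
  · rintro ⟨i, hi⟩
    exact ⟨_, hi, i, add_add_cancel_self _ _⟩

lemma par_of_mem_nbhd {S : Finset (Cube ι)} {p : ZMod 2} (hS : ∀ x ∈ S, par x = p) {y : Cube ι}
    (hy : y ∈ nbhd S) : par y = p + 1 := by
  obtain ⟨i, hi⟩ := mem_nbhd.1 hy
  rw [← hS _ hi, par_add_unit, add_assoc, zmod_two_add_self, add_zero]

lemma card_par_eq [Nonempty ι] (p : ZMod 2) :
    (Finset.univ.filter fun x : Cube ι => par x = p).card = 2 ^ (Fintype.card ι - 1) := by
  rw [← card_half (ι := ι) p, ← Fintype.card_subtype]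

/-- The points all of whose neighbours lie in `S`. -/
def interior (S : Finset (Cube ι)) : Finset (Cube ι) :=
  Finset.univ.filter fun x => ∀ i, x + unit i ∈ S

/-- The number of choices for the value of a function at the point `s` of its defect set `S`. -/
def choices (L : ℕ) (S : Finset (Cube ι)) (s : Cube ι) : ℕ :=
  if ∃ t ∈ S, Close s t then L ^ 2 else 2

variable {L : ℕ}

lemma near_unique {a b u v : Fin L} (hab : a ≠ b) (h1 : near u a) (h2 : near u b) (h3 : near v a)
    (h4 : near v b) : u = v := by
  have : (a : ℕ) ≠ b := fun h => hab (Fin.ext h)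
  unfold near at *
  ext
  omega

lemma card_near_near_le (a : Fin L) :
    (Finset.univ.filter fun v => v ≠ a ∧ ∃ u, near v u ∧ near u a).card ≤ 2 := by
  apply card_le_two_of_val_mem _ (a + 2) (a - 2)
  intro v hv
  obtain ⟨-, h1, u, h2, h3⟩ := Finset.mem_filter.1 hv
  have : (v : ℕ) ≠ a := fun h => h1 (Fin.ext h)
  unfold near at *
  omega

lemma pow_card_interior_le {i₀ i₁ : ι} (hi : i₀ ≠ i₁) (hL : 0 < L) (S : Finset (Cube ι)) :
    L ^ (interior S).card ≤ ∏ s ∈ S, if ∃ t ∈ S, Close s t then L else 1 := by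
  rw [Finset.prod_ite, Finset.prod_const_one, mul_one, Finset.prod_const]
  apply Nat.pow_le_pow_right hL
  apply Finset.card_le_card_of_injOn fun x => x + unit i₀
  · intro x hx
    have hx' := (Finset.mem_filter.1 hx).2
    exact Finset.mem_filter.2 ⟨hx' i₀, _, hx' i₁, i₀, i₁, hi, by rw [add_add_cancel_self]⟩
  · intro x _ y _ h
    exact add_right_cancel h

lemma card_with_defects_le {i₀ i₁ : ι} (hi : i₀ ≠ i₁) {p : ZMod 2} {a : Fin L}
    (S : Finset (Cube ι)) (F : Finset (Cube ι → Fin L))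
    (hF : ∀ g ∈ F, IsHom g ∧ ∀ x, x ∈ S ↔ par x = p ∧ g x ≠ a) :
    F.card ≤ (∏ s ∈ S, choices L S s) * 2 ^ (2 ^ (Fintype.card ι - 1) - (nbhd S).card) := by
  have hL : 0 < L := a.pos
  rcases F.eq_empty_or_nonempty with rfl | ⟨g₀, hg₀⟩
  · simp
  have hSp : ∀ x ∈ S, par x = p := fun x hx => (((hF g₀ hg₀).2 x).1 hx).1
  have hNp : ∀ x ∈ nbhd S, par x = p + 1 := fun x => par_of_mem_nbhd hSp
  have hpp : ∀ q : ZMod 2, q ≠ q + 1 := by decide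
  let mask : (Cube ι → Fin L) → Cube ι → Fin L := fun g x =>
    if x ∈ nbhd S ∧ x ∉ interior S then a else g x
  have hmask1 : ∀ g x, (x ∈ nbhd S ∧ x ∉ interior S) → mask g x = a := fun g x h => if_pos h
  have hmask2 : ∀ g x, ¬ (x ∈ nbhd S ∧ x ∉ interior S) → mask g x = g x := fun g x h => if_neg h
  have hinj : Set.InjOn mask F := by
    intro g hg g' hg' e
    obtain ⟨g1, g2⟩ := hF g hg
    obtain ⟨g1', g2'⟩ := hF g' hg'
    have heq : ∀ x, ¬ (x ∈ nbhd S ∧ x ∉ interior S) → g x = g' x := fun x hx => by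
      rw [← hmask2 g x hx, ← hmask2 g' x hx, e]
    funext x
    by_cases hx : x ∈ nbhd S ∧ x ∉ interior S
    swap
    · exact heq x hx
    have hpx := hNp x hx.1
    obtain ⟨i, hiS⟩ := mem_nbhd.1 hx.1
    obtain ⟨j, hj⟩ : ∃ j, x + unit j ∉ S := by
      by_contra! H
      exact hx.2 (Finset.mem_filter.2 ⟨Finset.mem_univ _, H⟩)
    have hpar : ∀ l, par (x + unit l) = p := fun l => by
      rw [par_add_unit, hpx, add_assoc, zmod_two_add_self, add_zero]
    have hval : ∀ g : Cube ι → Fin L, (∀ x, x ∈ S ↔ par x = p ∧ g x ≠ a) → g (x + unit j) = a := by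
      intro g hg
      by_contra hne
      exact hj ((hg _).2 ⟨hpar j, hne⟩)
    have e1 : g (x + unit i) = g' (x + unit i) := heq _ fun h => by
      have := hNp _ h.1
      rw [hpar] at this
      exact hpp p this
    have n1 := g1 x i
    have n2 := g1 x j
    have n3 := g1' x i
    have n4 := g1' x j
    rw [hval g g2] at n2
    rw [hval g' g2'] at n4
    rw [← e1] at n3
    exact near_unique ((g2 _).1 hiS).2 n1 n2 n3 n4
  let opt : Cube ι → Finset (Fin L) := fun x =>
    if x ∈ interior S then Finset.univ
    else if x ∈ nbhd S then {a}
    else if par x = p + 1 then Finset.univ.filter fun v => near a v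
    else if x ∈ S then
      if ∃ t ∈ S, Close x t then Finset.univ
      else Finset.univ.filter fun v => v ≠ a ∧ ∃ u, near v u ∧ near u a
    else {a}
  have hopt : ∀ g ∈ F, ∀ x, mask g x ∈ opt x := by
    intro g hg x
    obtain ⟨g1, g2⟩ := hF g hg
    by_cases c1 : x ∈ interior S
    · rw [show opt x = _ from if_pos c1]
      exact Finset.mem_univ _
    by_cases c2 : x ∈ nbhd S
    · rw [show opt x = _ from (if_neg c1).trans (if_pos c2), hmask1 g x ⟨c2, c1⟩]
      exact Finset.mem_singleton_self a
    rw [hmask2 g x fun h => c2 h.1]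
    by_cases c3 : par x = p + 1
    · rw [show opt x = _ from (if_neg c1).trans ((if_neg c2).trans (if_pos c3))]
      refine Finset.mem_filter.2 ⟨Finset.mem_univ _, ?_⟩
      have : g (x + unit i₀) = a := by
        by_contra hne
        exact c2 (mem_nbhd.2 ⟨i₀, (g2 _).2 ⟨by
          rw [par_add_unit, c3, add_assoc, zmod_two_add_self, add_zero], hne⟩⟩)
      have h := g1 x i₀
      rw [this] at h
      exact h.symm
    have hpx : par x = p := by
      rcases zmod_two_eq_or (par x) p with h | h
      · exact h
      · exact absurd h c3
    by_cases c4 : x ∈ S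
    · by_cases c5 : ∃ t ∈ S, Close x t
      · rw [show opt x = _ from (if_neg c1).trans ((if_neg c2).trans ((if_neg c3).trans
          ((if_pos c4).trans (if_pos c5))))]
        exact Finset.mem_univ _
      · rw [show opt x = _ from (if_neg c1).trans ((if_neg c2).trans ((if_neg c3).trans
          ((if_pos c4).trans (if_neg c5))))]
        refine Finset.mem_filter.2 ⟨Finset.mem_univ _, ((g2 x).1 c4).2, g (x + unit i₀),
          g1 x i₀, ?_⟩
        have : g (x + unit i₀ + unit i₁) = a := by
          by_contra hne
          exact c5 ⟨_, (g2 _).2 ⟨by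
            rw [par_add_unit, par_add_unit, hpx, add_assoc, zmod_two_add_self, add_zero], hne⟩,
            i₀, i₁, hi, rfl⟩
        rw [← this]
        exact g1 _ _
    · rw [show opt x = _ from (if_neg c1).trans ((if_neg c2).trans ((if_neg c3).trans
        (if_neg c4)))]
      rw [Finset.mem_singleton]
      by_contra hne
      exact c4 ((g2 x).2 ⟨hpx, hne⟩)
  have hcard : ∀ x, (opt x).card ≤ (if x ∈ S then (if ∃ t ∈ S, Close x t then L else 2) else 1) *
      (if x ∈ interior S then L else 1) * (if par x = p + 1 ∧ x ∉ nbhd S then 2 else 1) := by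
    intro x
    have p1 : 1 ≤ if x ∈ S then (if ∃ t ∈ S, Close x t then L else 2) else 1 := by
      split_ifs <;> omega
    have p2 : 1 ≤ if x ∈ interior S then L else 1 := by split_ifs <;> omega
    have p3 : 1 ≤ if par x = p + 1 ∧ x ∉ nbhd S then 2 else 1 := by split_ifs <;> omega
    by_cases c1 : x ∈ interior S
    · rw [show opt x = _ from if_pos c1, Finset.card_univ, Fintype.card_fin]
      rw [if_pos c1] at p2 ⊢
      calc L = 1 * L * 1 := by ring
        _ ≤ _ := Nat.mul_le_mul (Nat.mul_le_mul p1 le_rfl) p3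
    by_cases c2 : x ∈ nbhd S
    · rw [show opt x = _ from (if_neg c1).trans (if_pos c2), Finset.card_singleton]
      exact Nat.mul_le_mul (Nat.mul_le_mul p1 p2) p3
    by_cases c3 : par x = p + 1
    · rw [show opt x = _ from (if_neg c1).trans ((if_neg c2).trans (if_pos c3)),
        if_pos (show par x = p + 1 ∧ x ∉ nbhd S from ⟨c3, c2⟩)]
      exact (card_near_le a).trans (le_mul_of_one_le_left (Nat.zero_le 2) (Nat.mul_le_mul p1 p2))
    have q : ∀ n, n = n * 1 * 1 := fun n => by ring
    by_cases c4 : x ∈ S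
    · rw [if_pos c4] at p1 ⊢
      refine le_trans ?_ (Nat.mul_le_mul (Nat.mul_le_mul le_rfl p2) p3)
      rw [← q]
      by_cases c5 : ∃ t ∈ S, Close x t
      · rw [show opt x = _ from (if_neg c1).trans ((if_neg c2).trans ((if_neg c3).trans
          ((if_pos c4).trans (if_pos c5)))), if_pos c5, Finset.card_univ, Fintype.card_fin]
      · rw [show opt x = _ from (if_neg c1).trans ((if_neg c2).trans ((if_neg c3).trans
          ((if_pos c4).trans (if_neg c5)))), if_neg c5]
        exact card_near_near_le a
    · rw [show opt x = _ from (if_neg c1).trans ((if_neg c2).trans ((if_neg c3).trans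
        (if_neg c4))), Finset.card_singleton]
      exact Nat.mul_le_mul (Nat.mul_le_mul p1 p2) p3
  have : Nonempty ι := ⟨i₀⟩
  calc F.card = (F.image mask).card := (Finset.card_image_of_injOn hinj).symm
    _ ≤ ∏ x, (opt x).card := by
        apply card_le_prod_options
        intro f hf x
        obtain ⟨g, hg, rfl⟩ := Finset.mem_image.1 hf
        exact hopt g hg x
    _ ≤ ∏ x, _ := Finset.prod_le_prod' fun x _ => hcard x
    _ = (∏ s ∈ S, if ∃ t ∈ S, Close s t then L else 2) * L ^ (interior S).card *
          2 ^ (2 ^ (Fintype.card ι - 1) - (nbhd S).card) := by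
        rw [Finset.prod_mul_distrib, Finset.prod_mul_distrib]
        congr 1
        · congr 1
          · rw [Finset.prod_ite_mem, Finset.univ_inter]
          · rw [Finset.prod_ite_mem, Finset.univ_inter, Finset.prod_const]
        · rw [Finset.prod_ite, Finset.prod_const_one, mul_one, Finset.prod_const,
            ← card_par_eq (ι := ι) (p + 1), ← Finset.card_sdiff_of_subset]
          · congr 2
            ext x
            simp
          · exact fun x hx => Finset.mem_filter.2 ⟨Finset.mem_univ _, hNp x hx⟩
    _ ≤ _ := by
        refine Nat.mul_le_mul_right _ ?_
        refine (Nat.mul_le_mul_left _ (pow_card_interior_le hi hL S)).trans (le_of_eq ?_)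
        rw [← Finset.prod_mul_distrib]
        refine Finset.prod_congr rfl fun s _ => ?_
        unfold choices
        split_ifs <;> ring

end Nbhd
variable {ι : Type*} [Fintype ι] [DecidableEq ι] {L : ℕ}

/-- A bound for the proportion of functions with defect set `S`. -/
noncomputable def weight (L : ℕ) (S : Finset (Cube ι)) : ℝ :=
  (∏ s ∈ S, (choices L S s : ℝ)) / 2 ^ (nbhd S).card

lemma weight_nonneg (S : Finset (Cube ι)) : 0 ≤ weight L S := by unfold weight; positivity

lemma weight_empty : weight L (∅ : Finset (Cube ι)) = 1 := by simp [weight, nbhd]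

lemma choices_union_of_far {A B : Finset (Cube ι)} {s : Cube ι} (h : ∀ y ∈ B, ¬ Close s y) :
    choices L (A ∪ B) s = choices L A s := by
  unfold choices
  congr 1
  apply propext
  constructor
  · rintro ⟨t, ht, hst⟩
    rcases Finset.mem_union.1 ht with ht | ht
    · exact ⟨t, ht, hst⟩
    · exact absurd hst (h t ht)
  · rintro ⟨t, ht, hst⟩
    exact ⟨t, Finset.mem_union_left _ ht, hst⟩

lemma weight_union {A B : Finset (Cube ι)} (hAB : Disjoint A B)
    (h : ∀ x ∈ A, ∀ y ∈ B, ¬ Close x y) : weight L (A ∪ B) = weight L A * weight L B := by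
  have hN : nbhd (A ∪ B) = nbhd A ∪ nbhd B := Finset.union_biUnion
  have hd : Disjoint (nbhd A) (nbhd B) := by
    refine Finset.disjoint_left.2 fun y hA hB => ?_
    obtain ⟨i, hi⟩ := mem_nbhd.1 hA
    obtain ⟨j, hj⟩ := mem_nbhd.1 hB
    by_cases hij : i = j
    · subst hij
      exact Finset.disjoint_left.1 hAB hi hj
    · exact h _ hi _ hj ⟨i, j, hij, by rw [add_add_cancel_self]⟩
  unfold weight
  rw [hN, Finset.card_union_of_disjoint hd, Finset.prod_union hAB, pow_add, mul_div_mul_comm]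
  congr 2
  · exact Finset.prod_congr rfl fun s hs => by rw [choices_union_of_far (h s hs)]
  · refine Finset.prod_congr rfl fun s hs => ?_
    rw [Finset.union_comm, choices_union_of_far fun y hy hsy => h y hy s hs hsy.symm]

/-- A set is linked if it is connected with respect to `Close`. -/
def Linked (S : Finset (Cube ι)) : Prop :=
  ∀ A ⊆ S, A.Nonempty → A ≠ S → ∃ x ∈ A, ∃ y ∈ S \ A, Close x y

lemma exists_linked_decomposition (S : Finset (Cube ι)) : ∃ 𝒟 : Finset (Finset (Cube ι)),
    (∀ C ∈ 𝒟, C.Nonempty ∧ Linked C ∧ C ⊆ S) ∧ 𝒟.biUnion id = S ∧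
      weight L S = ∏ C ∈ 𝒟, weight L C := by
  induction S using Finset.strongInduction with
  | H S ih =>
    rcases S.eq_empty_or_nonempty with rfl | hne
    · exact ⟨∅, by simp, by simp, by simp [weight_empty]⟩
    by_cases hl : Linked S
    · exact ⟨{S}, by simp [hne, hl], by simp, by simp⟩
    unfold Linked at hl
    push Not at hl
    obtain ⟨A, hAS, hA, hne', hfar⟩ := hl
    have hAss : A ⊂ S := lt_of_le_of_ne hAS hne'
    have hBss : S \ A ⊂ S := Finset.sdiff_ssubset hAS hA
    obtain ⟨𝒜, a1, a2, a3⟩ := ih A hAss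
    obtain ⟨ℬ, b1, b2, b3⟩ := ih (S \ A) hBss
    refine ⟨𝒜 ∪ ℬ, ?_, ?_, ?_⟩
    · intro C hC
      rcases Finset.mem_union.1 hC with hC | hC
      · exact ⟨(a1 C hC).1, (a1 C hC).2.1, (a1 C hC).2.2.trans hAS⟩
      · exact ⟨(b1 C hC).1, (b1 C hC).2.1, (b1 C hC).2.2.trans hBss.subset⟩
    · rw [Finset.union_biUnion, a2, b2, Finset.union_sdiff_of_subset hAS]
    · have hdis : Disjoint 𝒜 ℬ := by
        refine Finset.disjoint_left.2 fun C hCA hCB => ?_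
        obtain ⟨x, hx⟩ := (a1 C hCA).1
        exact (Finset.mem_sdiff.1 ((b1 C hCB).2.2 hx)).2 ((a1 C hCA).2.2 hx)
      rw [Finset.prod_union hdis, ← a3, ← b3, ← weight_union Finset.disjoint_sdiff hfar,
        Finset.union_sdiff_of_subset hAS]

lemma sum_weight_le_exp (𝒮 𝒞 : Finset (Finset (Cube ι)))
    (h : ∀ S ∈ 𝒮, ∀ C ⊆ S, C.Nonempty → Linked C → C ∈ 𝒞) :
    ∑ S ∈ 𝒮, weight L S ≤ Real.exp (∑ C ∈ 𝒞, weight L C) := by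
  choose 𝒟 d1 d2 d3 using exists_linked_decomposition (ι := ι) (L := L)
  have hinj : Set.InjOn 𝒟 𝒮 := fun S _ S' _ e => by rw [← d2 S, ← d2 S', e]
  calc ∑ S ∈ 𝒮, weight L S = ∑ S ∈ 𝒮, ∏ C ∈ 𝒟 S, weight L C :=
        Finset.sum_congr rfl fun S _ => d3 S
    _ = ∑ D ∈ 𝒮.image 𝒟, ∏ C ∈ D, weight L C := by
        rw [Finset.sum_image hinj]
    _ ≤ ∑ D ∈ 𝒞.powerset, ∏ C ∈ D, weight L C := by
        apply Finset.sum_le_sum_of_subset_of_nonneg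
        · intro D hD
          obtain ⟨S, hS, rfl⟩ := Finset.mem_image.1 hD
          exact Finset.mem_powerset.2 fun C hC => h S hS C (d1 S C hC).2.2 (d1 S C hC).1
            (d1 S C hC).2.1
        · exact fun D _ _ => Finset.prod_nonneg fun C _ => weight_nonneg C
    _ = ∏ C ∈ 𝒞, (1 + weight L C) := by rw [Finset.prod_one_add]
    _ ≤ ∏ C ∈ 𝒞, Real.exp (weight L C) := by
        refine Finset.prod_le_prod (fun C _ => ?_) fun C _ => ?_
        · have := weight_nonneg (L := L) C
          linarith
        · rw [add_comm]; exact Real.add_one_le_exp _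
    _ = _ := (Real.exp_sum _ _).symm
variable {ι : Type*} [Fintype ι] [DecidableEq ι] {L : ℕ}

/-- Sets obtained from `{v}` by adding a point at distance at most two `n` times. -/
def grow (v : Cube ι) : ℕ → Finset (Finset (Cube ι))
  | 0 => {{v}}
  | n + 1 => (grow v n).biUnion fun A => (A ×ˢ (Finset.univ : Finset (ι × ι))).image fun q =>
      insert (q.1 + unit q.2.1 + unit q.2.2) A

lemma card_of_mem_grow {v : Cube ι} {n : ℕ} : ∀ A ∈ grow v n, A.card ≤ n + 1 := by
  induction n with
  | zero => intro A hA; rw [grow, Finset.mem_singleton] at hA; simp [hA]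
  | succ n ih =>
    intro A hA
    rw [grow, Finset.mem_biUnion] at hA
    obtain ⟨A', hA', h⟩ := hA
    obtain ⟨q, -, rfl⟩ := Finset.mem_image.1 h
    have := ih A' hA'
    exact (Finset.card_insert_le _ _).trans (by omega)

lemma card_grow_le (v : Cube ι) {K : ℕ} : ∀ n ≤ K, (grow v n).card ≤ (K * Fintype.card ι ^ 2) ^ n
  | 0, _ => by simp [grow]
  | n + 1, h => by
    rw [grow, pow_succ]
    refine Finset.card_biUnion_le.trans ((Finset.sum_le_card_nsmul _ _ (K * Fintype.card ι ^ 2)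
      fun A hA => ?_).trans ?_)
    · refine Finset.card_image_le.trans ?_
      rw [Finset.card_product, Finset.card_univ, Fintype.card_prod, sq]
      exact Nat.mul_le_mul_right _ ((card_of_mem_grow A hA).trans h)
    · rw [smul_eq_mul]
      exact Nat.mul_le_mul_right _ (card_grow_le v n (by omega))

lemma Linked.exists_mem_grow {C : Finset (Cube ι)} (hC : Linked C) {v : Cube ι} (hv : v ∈ C) :
    ∀ n < C.card, ∃ A ∈ grow v n, A ⊆ C ∧ A.card = n + 1
  | 0, _ => ⟨{v}, by simp [grow], by simpa using hv, by simp⟩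
  | n + 1, h => by
    obtain ⟨A, hA, hAC, hcard⟩ := hC.exists_mem_grow hv n (by omega)
    obtain ⟨x, hx, y, hy, i, j, -, rfl⟩ := hC A hAC (Finset.card_pos.1 (by omega))
      (fun e => by rw [e] at hcard; omega)
    rw [Finset.mem_sdiff] at hy
    refine ⟨insert (x + unit i + unit j) A, ?_, Finset.insert_subset hy.1 hAC, ?_⟩
    · rw [grow, Finset.mem_biUnion]
      exact ⟨A, hA, Finset.mem_image.2 ⟨(x, i, j), Finset.mem_product.2
        ⟨hx, Finset.mem_univ _⟩, rfl⟩⟩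
    · rw [Finset.card_insert_of_notMem hy.2, hcard]

lemma card_linked_le [Nonempty ι] (p : ZMod 2) {K j : ℕ} (hj : j ≤ K)
    (𝒞 : Finset (Finset (Cube ι)))
    (h𝒞 : ∀ C ∈ 𝒞, Linked C ∧ C.card = j + 1 ∧ ∀ x ∈ C, par x = p) :
    𝒞.card ≤ 2 ^ (Fintype.card ι - 1) * (K * Fintype.card ι ^ 2) ^ j := by
  have hsub : 𝒞 ⊆ (Finset.univ.filter fun x : Cube ι => par x = p).biUnion fun v => grow v j := by
    intro C hC
    obtain ⟨h1, h2, h3⟩ := h𝒞 C hC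
    obtain ⟨v, hv⟩ := Finset.card_pos.1 (show 0 < C.card by omega)
    obtain ⟨A, hA, hAC, hcard⟩ := h1.exists_mem_grow hv j (by omega)
    have : A = C := Finset.eq_of_subset_of_card_le hAC (by omega)
    subst this
    exact Finset.mem_biUnion.2 ⟨v, Finset.mem_filter.2 ⟨Finset.mem_univ _, h3 v hv⟩, hA⟩
  refine (Finset.card_le_card hsub).trans (Finset.card_biUnion_le.trans
    ((Finset.sum_le_card_nsmul _ _ _ fun v _ => card_grow_le v j hj).trans (le_of_eq ?_)))
  rw [card_par_eq, smul_eq_mul]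

/-- The number of ordered pairs of adjacent points of `W` in the directions in `D`. -/
def innerEdges (D : Finset ι) (W : Finset (Cube ι)) : ℕ :=
  ∑ i ∈ D, (W.filter fun x => x + unit i ∈ W).card

lemma log_arith {a b : ℕ} (hab : a ≤ b) :
    2 * a * Nat.log 2 a + 2 * b * Nat.log 2 b + 2 * a ≤ 2 * (a + b) * Nat.log 2 (a + b) := by
  rcases Nat.eq_zero_or_pos a with rfl | ha
  · simp
  have h1 : Nat.log 2 a + 1 ≤ Nat.log 2 (a + b) := by
    rw [← Nat.log_mul_base (by norm_num) ha.ne']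
    exact Nat.log_mono_right (by omega)
  have h2 : Nat.log 2 b ≤ Nat.log 2 (a + b) := Nat.log_mono_right (by omega)
  generalize Nat.log 2 (a + b) = l at *
  have e1 := Nat.mul_le_mul_left (2 * a) h1
  have e2 := Nat.mul_le_mul_left (2 * b) h2
  rw [mul_add] at e1
  have : 2 * (a + b) * l = 2 * a * l + 2 * b * l := by ring
  omega

lemma innerEdges_le (D : Finset ι) : ∀ W : Finset (Cube ι),
    innerEdges D W ≤ 2 * W.card * Nat.log 2 W.card := by
  induction D using Finset.induction_on with
  | empty => intro W; simp [innerEdges]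
  | insert i D hi ih =>
    intro W
    set W0 := W.filter fun x => x i = 0 with hW0
    set W1 := W.filter fun x => ¬ x i = 0 with hW1
    have hcard : W0.card + W1.card = W.card :=
      Finset.card_filter_add_card_filter_not fun x : Cube ι => x i = 0
    have hsplit : ∀ j ∈ D, (W.filter fun x => x + unit j ∈ W).card =
        (W0.filter fun x => x + unit j ∈ W0).card + (W1.filter fun x => x + unit j ∈ W1).card := by
      intro j hj
      have hji : i ≠ j := fun h => hi (h ▸ hj)
      have hx : ∀ x : Cube ι, (x + unit j) i = x i := fun x => by simp [unit, hji]
      rw [← Finset.card_filter_add_card_filter_not (s := W.filter fun x => x + unit j ∈ W)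
        fun x : Cube ι => x i = 0]
      congr 2
      · ext x
        simp only [hW0, Finset.mem_filter, hx]
        tauto
      · ext x
        simp only [hW1, Finset.mem_filter, hx]
        tauto
    have hflip : ∀ x : Cube ι, (x + unit i) i = x i + 1 := fun x => by simp [unit]
    have hflip0 : ∀ b : ZMod 2, b + 1 = 0 ↔ ¬ b = 0 := by decide
    have hA : ((W.filter fun x => x + unit i ∈ W).filter fun x => x i = 0).card ≤ W1.card := by
      apply Finset.card_le_card_of_injOn fun x => x + unit i
      · intro x hx
        have h1 := Finset.mem_filter.1 hx
        have h2 := Finset.mem_filter.1 h1.1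
        refine Finset.mem_filter.2 ⟨h2.2, ?_⟩
        beta_reduce; rw [hflip, hflip0, not_not]; exact h1.2
      · exact fun x _ y _ h => add_right_cancel h
    have hA' : ((W.filter fun x => x + unit i ∈ W).filter fun x => x i = 0).card ≤ W0.card :=
      Finset.card_le_card (Finset.filter_subset_filter _ (Finset.filter_subset _ _))
    have hB : ((W.filter fun x => x + unit i ∈ W).filter fun x => ¬ x i = 0).card ≤ W0.card := by
      apply Finset.card_le_card_of_injOn fun x => x + unit i
      · intro x hx
        have h1 := Finset.mem_filter.1 hx
        have h2 := Finset.mem_filter.1 h1.1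
        refine Finset.mem_filter.2 ⟨h2.2, ?_⟩
        beta_reduce; rw [hflip, hflip0]; exact h1.2
      · exact fun x _ y _ h => add_right_cancel h
    have hB' : ((W.filter fun x => x + unit i ∈ W).filter fun x => ¬ x i = 0).card ≤ W1.card :=
      Finset.card_le_card (Finset.filter_subset_filter _ (Finset.filter_subset _ _))
    have hAB := Finset.card_filter_add_card_filter_not (s := W.filter fun x => x + unit i ∈ W)
      fun x : Cube ι => x i = 0
    have h0 := ih W0
    have h1 := ih W1
    have hsum : innerEdges (insert i D) W =
        (W.filter fun x => x + unit i ∈ W).card + (innerEdges D W0 + innerEdges D W1) := by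
      unfold innerEdges
      rw [Finset.sum_insert hi, Finset.sum_congr rfl hsplit, Finset.sum_add_distrib]
    rw [hsum, ← hcard]
    rcases le_total W0.card W1.card with hle | hle
    · have := log_arith hle
      omega
    · have := log_arith hle
      rw [add_comm W1.card] at this
      omega

lemma card_mul_le_of_log_le {S : Finset (Cube ι)} {p : ZMod 2} (hS : ∀ x ∈ S, par x = p) {l : ℕ}
    (hl : Nat.log 2 (S.card + (nbhd S).card) ≤ l) :
    Fintype.card ι * S.card ≤ 2 * (S.card + (nbhd S).card) * l := by
  have hpp : ∀ q : ZMod 2, q ≠ q + 1 := by decide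
  have hdis : Disjoint S (nbhd S) := Finset.disjoint_left.2 fun x h1 h2 => by
    have := par_of_mem_nbhd hS h2
    rw [hS x h1] at this
    exact hpp p this
  rw [← Finset.card_union_of_disjoint hdis] at hl ⊢
  refine le_trans ?_ ((innerEdges_le Finset.univ (S ∪ nbhd S)).trans (Nat.mul_le_mul_left _ hl))
  rw [← smul_eq_mul, ← Finset.card_univ]
  refine Finset.card_nsmul_le_sum _ _ _ fun i _ => Finset.card_le_card fun x hx => ?_
  exact Finset.mem_filter.2 ⟨Finset.mem_union_left _ hx, Finset.mem_union_right _
    (mem_nbhd.2 ⟨i, by rwa [add_add_cancel_self]⟩)⟩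

lemma card_nbhd_le (S : Finset (Cube ι)) : (nbhd S).card ≤ S.card * Fintype.card ι :=
  Finset.card_biUnion_le.trans (Finset.sum_le_card_nsmul _ _ _ fun _ _ =>
    Finset.card_image_le)

lemma card_image_add_unit (x : Cube ι) :
    (Finset.univ.image fun i => x + unit i).card = Fintype.card ι := by
  rw [Finset.card_image_of_injective, Finset.card_univ]
  intro i j h
  have h1 : unit i = unit j := add_left_cancel h
  by_contra hne
  have h2 := congrFun h1 i
  simp [unit, hne] at h2

lemma card_nbhd_singleton (x : Cube ι) : (nbhd {x}).card = Fintype.card ι := by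
  rw [nbhd, Finset.singleton_biUnion, card_image_add_unit]

lemma le_card_nbhd_of_pair {S : Finset (Cube ι)} {x y : Cube ι} (hx : x ∈ S) (hy : y ∈ S)
    (hxy : x ≠ y) : 2 * Fintype.card ι ≤ (nbhd S).card + 2 := by
  set X := Finset.univ.image fun i => x + unit i with hX
  set Y := Finset.univ.image fun i => y + unit i with hY
  have hsub : X ∪ Y ⊆ nbhd S := Finset.union_subset
    (Finset.subset_biUnion_of_mem (fun x => Finset.univ.image fun i => x + unit i) hx)
    (Finset.subset_biUnion_of_mem (fun x => Finset.univ.image fun i => x + unit i) hy)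
  obtain ⟨c, hc⟩ := Function.ne_iff.1 hxy
  have hint : X ∩ Y ⊆ {x + unit c, y + unit c} := by
    intro z hz
    obtain ⟨h1, h2⟩ := Finset.mem_inter.1 hz
    obtain ⟨i, -, rfl⟩ := Finset.mem_image.1 h1
    obtain ⟨j, -, h⟩ := Finset.mem_image.1 h2
    rw [Finset.mem_insert, Finset.mem_singleton]
    by_cases hi : i = c
    · left; rw [hi]
    by_cases hj : j = c
    · right; rw [← h, hj]
    have := congrFun h c
    simp [unit, Ne.symm hi, Ne.symm hj] at this
    exact absurd this.symm hc
  have h1 := Finset.card_union_add_card_inter X Y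
  rw [card_image_add_unit, card_image_add_unit] at h1
  have h2 := Finset.card_le_card hsub
  have h3 := (Finset.card_le_card hint).trans Finset.card_le_two
  omega

lemma le_card_nbhd {S : Finset (Cube ι)} {p : ZMod 2} (hS : ∀ x ∈ S, par x = p) {K l q : ℕ}
    (h2 : 2 ≤ S.card) (hK : S.card ≤ K) (hl : (Fintype.card ι + 1) * K < 2 ^ (l + 1))
    (hq : 2 * l * (4 * q + 1) ≤ Fintype.card ι) (hl0 : 0 < l) :
    (3 * Fintype.card ι - 3) / 2 + q * S.card ≤ (nbhd S).card := by
  have a1 : Nat.log 2 (S.card + (nbhd S).card) ≤ l := by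
    refine Nat.lt_succ_iff.1 (Nat.log_lt_of_lt_pow (by omega) (lt_of_le_of_lt ?_ hl))
    have := card_nbhd_le S
    have h3 := Nat.mul_le_mul_left (Fintype.card ι + 1) hK
    have : (Fintype.card ι + 1) * S.card = S.card * Fintype.card ι + S.card := by ring
    omega
  have a2 := card_mul_le_of_log_le hS a1
  have a3 : 2 * l * ((4 * q + 1) * S.card) ≤ 2 * l * (S.card + (nbhd S).card) := by
    calc 2 * l * ((4 * q + 1) * S.card) = 2 * l * (4 * q + 1) * S.card := by ring
      _ ≤ Fintype.card ι * S.card := Nat.mul_le_mul_right _ hq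
      _ ≤ _ := a2
      _ = _ := by ring
  have a4 := Nat.le_of_mul_le_mul_left a3 (by omega)
  have a5 : (4 * q + 1) * S.card = 4 * (q * S.card) + S.card := by ring
  obtain ⟨x, hx, y, hy, hxy⟩ := Finset.one_lt_card.1 (show 1 < S.card by omega)
  have a6 := le_card_nbhd_of_pair hx hy hxy
  omega
variable {ι : Type*} [Fintype ι] [DecidableEq ι] {L : ℕ}

lemma weight_of_card_eq_one {C : Finset (Cube ι)} (hC : C.card = 1) :
    weight L C = 2 / 2 ^ Fintype.card ι := by
  obtain ⟨v, rfl⟩ := Finset.card_eq_one.1 hC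
  have : ¬ ∃ t ∈ ({v} : Finset (Cube ι)), Close v t := by
    rintro ⟨t, ht, i, j, hij, h⟩
    rw [Finset.mem_singleton] at ht
    subst ht
    rw [add_assoc, left_eq_add] at h
    have := congrFun h i
    simp [unit, hij] at this
  rw [weight, Finset.prod_singleton, card_nbhd_singleton, choices, if_neg this, Nat.cast_ofNat]

lemma weight_le_pow (hL : 2 ≤ L) {C : Finset (Cube ι)} {n : ℕ} (hn : n ≤ (nbhd C).card) :
    weight L C ≤ ((L : ℝ) ^ 2) ^ C.card / 2 ^ n := by
  unfold weight
  refine div_le_div₀ (by positivity) ?_ (by positivity)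
    (pow_le_pow_right₀ (by norm_num) hn)
  rw [← Finset.prod_const]
  refine Finset.prod_le_prod (fun s _ => Nat.cast_nonneg _) fun s _ => ?_
  unfold choices
  have : (2 : ℝ) ≤ L := by exact_mod_cast hL
  split_ifs
  · push_cast; exact le_rfl
  · push_cast; nlinarith

lemma sum_weight_linked_le [Nonempty ι] (hL : 2 ≤ L) {p : ZMod 2} {K l q : ℕ}
    (hl : (Fintype.card ι + 1) * K < 2 ^ (l + 1)) (hl0 : 0 < l)
    (hq : 2 * l * (4 * q + 1) ≤ Fintype.card ι)
    (hβ : 2 * (K * Fintype.card ι ^ 2 * L ^ 2) ≤ 2 ^ q) (𝒞 : Finset (Finset (Cube ι)))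
    (h𝒞 : ∀ C ∈ 𝒞, C.Nonempty ∧ Linked C ∧ C.card ≤ K ∧ ∀ x ∈ C, par x = p) :
    ∑ C ∈ 𝒞, weight L C ≤
      1 + 2 ^ (Fintype.card ι - 1) / 2 ^ ((3 * Fintype.card ι - 3) / 2) := by
  obtain ⟨d, hd⟩ : ∃ d, d = Fintype.card ι := ⟨_, rfl⟩
  have hd0 : 0 < d := hd ▸ Fintype.card_pos
  have hcard : ∀ j ≤ K, (𝒞.filter fun C => C.card - 1 = j).card ≤ 2 ^ (d - 1) * (K * d ^ 2) ^ j := by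
    intro j hj
    rw [hd]
    refine card_linked_le p hj _ fun C hC => ?_
    obtain ⟨h1, h2⟩ := Finset.mem_filter.1 hC
    obtain ⟨a1, a2, a3, a4⟩ := h𝒞 C h1
    have := a1.card_pos
    exact ⟨a2, by omega, a4⟩
  rw [← hd] at hl hq hβ ⊢
  set n := (3 * d - 3) / 2 with hn
  set A : ℝ := 2 ^ (d - 1) / 2 ^ n with hA
  have hA0 : 0 ≤ A := by positivity
  have hterm : ∀ j ∈ Finset.range K, ∑ C ∈ 𝒞.filter (fun C => C.card - 1 = j), weight L C ≤
      (if j = 0 then 1 else 0) + A / 2 * (1 / 2) ^ j := by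
    intro j hj
    have hjK : j < K := Finset.mem_range.1 hj
    have hc := hcard j hjK.le
    by_cases h0 : j = 0
    · subst h0
      have hw : ∀ C ∈ 𝒞.filter (fun C => C.card - 1 = 0), weight L C = 2 / 2 ^ d := by
        intro C hC
        obtain ⟨h1, h2⟩ := Finset.mem_filter.1 hC
        have := (h𝒞 C h1).1.card_pos
        rw [hd]
        exact weight_of_card_eq_one (by omega)
      rw [Finset.sum_congr rfl hw, Finset.sum_const, nsmul_eq_mul, if_pos rfl]
      rw [pow_zero, mul_one] at hc
      have hc' : ((𝒞.filter (fun C => C.card - 1 = 0)).card : ℝ) ≤ 2 ^ (d - 1) := by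
        exact_mod_cast hc
      have h2 : (2 : ℝ) ^ d = 2 ^ (d - 1) * 2 := by
        rw [← pow_succ]; congr 1; omega
      have h3 : (2 : ℝ) ^ (d - 1) * (2 / 2 ^ d) = 1 := by
        rw [h2]; field_simp
      have h4 := mul_le_mul_of_nonneg_right hc' (show (0 : ℝ) ≤ 2 / 2 ^ d by positivity)
      rw [h3] at h4
      have : 0 ≤ A / 2 * (1 / 2) ^ 0 := by positivity
      linarith
    · rw [if_neg h0, zero_add]
      have hw : ∀ C ∈ 𝒞.filter (fun C => C.card - 1 = j),
          weight L C ≤ ((L : ℝ) ^ 2) ^ (j + 1) / 2 ^ (n + q * (j + 1)) := by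
        intro C hC
        obtain ⟨h1, h2⟩ := Finset.mem_filter.1 hC
        obtain ⟨a1, a2, a3, a4⟩ := h𝒞 C h1
        have hcj : C.card = j + 1 := by have := a1.card_pos; omega
        have hexp := le_card_nbhd a4 (by omega) a3 (hd ▸ hl) (hd ▸ hq) hl0
        rw [hcj, ← hd] at hexp
        rw [← hcj] at hexp ⊢
        exact weight_le_pow hL hexp
      refine (Finset.sum_le_card_nsmul _ _ _ hw).trans ?_
      rw [nsmul_eq_mul]
      have hc' : ((𝒞.filter (fun C => C.card - 1 = j)).card : ℝ) ≤
          2 ^ (d - 1) * ((K : ℝ) * d ^ 2) ^ (j + 1) := by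
        have h1 : 1 ≤ K * d ^ 2 := Nat.mul_pos (by omega) (pow_pos hd0 2)
        have h2 := hc.trans (Nat.mul_le_mul_left _ (Nat.pow_le_pow_right h1 (Nat.le_succ j)))
        exact_mod_cast h2
      refine (mul_le_mul_of_nonneg_right hc' (by positivity)).trans ?_
      have hβ' : (K : ℝ) * d ^ 2 * L ^ 2 / 2 ^ q ≤ 1 / 2 := by
        rw [div_le_div_iff₀ (by positivity) (by norm_num)]
        have : (2 : ℝ) * ((K : ℝ) * d ^ 2 * L ^ 2) ≤ 2 ^ q := by exact_mod_cast hβ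
        linarith
      have e1 : 2 ^ (d - 1) * ((K : ℝ) * d ^ 2) ^ (j + 1) *
          (((L : ℝ) ^ 2) ^ (j + 1) / 2 ^ (n + q * (j + 1))) =
          A * ((K : ℝ) * d ^ 2 * L ^ 2 / 2 ^ q) ^ (j + 1) := by
        rw [div_pow, mul_pow _ ((L : ℝ) ^ 2), pow_add _ n, pow_mul, hA]
        field_simp
      rw [e1, show A / 2 * (1 / 2) ^ j = A * ((1 / 2) ^ j / 2) by ring]
      refine mul_le_mul_of_nonneg_left ?_ hA0
      refine (pow_le_pow_left₀ (by positivity) hβ' _).trans (le_of_eq ?_)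
      rw [pow_succ]; ring
  have hsum : ∑ C ∈ 𝒞, weight L C =
      ∑ j ∈ Finset.range K, ∑ C ∈ 𝒞.filter (fun C => C.card - 1 = j), weight L C := by
    symm
    apply Finset.sum_fiberwise_of_maps_to
    intro C hC
    obtain ⟨a1, a2, a3, a4⟩ := h𝒞 C hC
    have := a1.card_pos
    exact Finset.mem_range.2 (by omega)
  rw [hsum]
  refine (Finset.sum_le_sum hterm).trans ?_
  rw [Finset.sum_add_distrib, ← Finset.mul_sum]
  have g1 : ∑ j ∈ Finset.range K, (if j = 0 then (1 : ℝ) else 0) ≤ 1 := by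
    rw [Finset.sum_ite_eq']
    split_ifs <;> norm_num
  have g2 := mul_le_mul_of_nonneg_left (sum_geometric_two_le K) (show 0 ≤ A / 2 by positivity)
  linarith

lemma card_few_defects_le {i₀ i₁ : ι} (hi : i₀ ≠ i₁) (hL : 2 ≤ L) {p : ZMod 2} {a : Fin L}
    {K l q : ℕ} (hl : (Fintype.card ι + 1) * K < 2 ^ (l + 1)) (hl0 : 0 < l)
    (hq : 2 * l * (4 * q + 1) ≤ Fintype.card ι)
    (hβ : 2 * (K * Fintype.card ι ^ 2 * L ^ 2) ≤ 2 ^ q) (F : Finset (Cube ι → Fin L))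
    (hF : ∀ g ∈ F, IsHom g ∧ (Finset.univ.filter fun x => par x = p ∧ g x ≠ a).card ≤ K) :
    (F.card : ℝ) ≤ 2 ^ 2 ^ (Fintype.card ι - 1) *
      Real.exp (1 + 2 ^ (Fintype.card ι - 1) / 2 ^ ((3 * Fintype.card ι - 3) / 2)) := by
  classical
  have : Nonempty ι := ⟨i₀⟩
  set 𝒮 := (Finset.univ : Finset (Finset (Cube ι))).filter fun S =>
    S.card ≤ K ∧ ∀ x ∈ S, par x = p with h𝒮
  set 𝒞 := (Finset.univ : Finset (Finset (Cube ι))).filter fun C =>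
    C.Nonempty ∧ Linked C ∧ C.card ≤ K ∧ ∀ x ∈ C, par x = p with h𝒞
  let defect : (Cube ι → Fin L) → Finset (Cube ι) := fun g =>
    Finset.univ.filter fun x => par x = p ∧ g x ≠ a
  have h1 : F.card = ∑ S ∈ 𝒮, (F.filter fun g => defect g = S).card := by
    apply Finset.card_eq_sum_card_fiberwise
    intro g hg
    exact Finset.mem_filter.2 ⟨Finset.mem_univ _, (hF g hg).2,
      fun x hx => (Finset.mem_filter.1 hx).2.1⟩
  have h2 : ∀ S ∈ 𝒮, ((F.filter fun g => defect g = S).card : ℝ) ≤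
      2 ^ 2 ^ (Fintype.card ι - 1) * weight L S := by
    intro S hS
    have hSp := (Finset.mem_filter.1 hS).2.2
    have a1 := card_with_defects_le hi (p := p) (a := a) S (F.filter fun g => defect g = S) (by
      intro g hg
      obtain ⟨b1, b2⟩ := Finset.mem_filter.1 hg
      refine ⟨(hF g b1).1, fun x => ?_⟩
      rw [← b2]
      simp only [defect, Finset.mem_filter, Finset.mem_univ, true_and])
    have hN : (nbhd S).card ≤ 2 ^ (Fintype.card ι - 1) := by
      rw [← card_par_eq (ι := ι) (p + 1)]
      exact Finset.card_le_card fun x hx => Finset.mem_filter.2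
        ⟨Finset.mem_univ _, par_of_mem_nbhd hSp hx⟩
    refine ((Nat.cast_le (α := ℝ)).2 a1).trans (le_of_eq ?_)
    generalize 2 ^ (Fintype.card ι - 1) = M at *
    have e : (2 : ℝ) ^ M = 2 ^ (M - (nbhd S).card) * 2 ^ (nbhd S).card := by
      rw [← pow_add]; congr 1; omega
    unfold weight
    rw [e]
    push_cast
    field_simp
  have h3 := sum_weight_le_exp (L := L) 𝒮 𝒞 (by
    intro S hS C hCS c1 c2
    obtain ⟨-, s1, s2⟩ := Finset.mem_filter.1 hS
    exact Finset.mem_filter.2 ⟨Finset.mem_univ _, c1, c2, (Finset.card_le_card hCS).trans s1,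
      fun x hx => s2 x (hCS hx)⟩)
  have h4 := sum_weight_linked_le hL hl hl0 hq hβ 𝒞 fun C hC => (Finset.mem_filter.1 hC).2
  calc (F.card : ℝ) = ∑ S ∈ 𝒮, ((F.filter fun g => defect g = S).card : ℝ) := by
        rw [h1, Nat.cast_sum]
    _ ≤ ∑ S ∈ 𝒮, 2 ^ 2 ^ (Fintype.card ι - 1) * weight L S := Finset.sum_le_sum h2
    _ = 2 ^ 2 ^ (Fintype.card ι - 1) * ∑ S ∈ 𝒮, weight L S := (Finset.mul_sum _ _ _).symm
    _ ≤ _ := mul_le_mul_of_nonneg_left (h3.trans (Real.exp_le_exp.2 h4)) (by positivity)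
variable {ι : Type*} [Fintype ι] [DecidableEq ι]

/-- The support of a point of the cube. -/
def supp (x : Cube ι) : Finset ι := Finset.univ.filter fun i => x i ≠ 0

/-- The indicator of a finset. -/
def ind (A : Finset ι) : Cube ι := fun i => if i ∈ A then 1 else 0

lemma mem_supp {x : Cube ι} {i : ι} : i ∈ supp x ↔ x i ≠ 0 := by simp [supp]

lemma supp_ind (A : Finset ι) : supp (ind A) = A := by
  ext i
  rw [mem_supp, ind]
  split_ifs with h <;> simp [h]

lemma ind_supp (x : Cube ι) : ind (supp x) = x := by
  funext i
  rw [ind]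
  rcases zmod_two_eq_or (x i) 0 with h | h
  · rw [if_neg (by rw [mem_supp, not_not]; exact h), h]
  · rw [if_pos (by rw [mem_supp, h]; decide), h, zero_add]

lemma ind_insert {A : Finset ι} {i : ι} (hi : i ∉ A) : ind (insert i A) = ind A + unit i := by
  funext j
  by_cases hj : j = i
  · subst hj; simp [ind, unit, hi]
  · simp [ind, unit, hj]

lemma card_rankFun (d : ℕ) : (RankFun d).ncard =
    (Finset.univ.filter fun g : Cube (Fin d) → Fin (4 * d + 1) =>
      (∀ x i, near (g x) (g (x + unit i))) ∧ (g 0 : ℕ) = 2 * d).card := by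
  have hle : ∀ f ∈ RankFun d, ∀ A, f A ≤ A.card := by
    intro f hf A
    induction A using Finset.induction_on with
    | empty => simp [hf.1]
    | insert i A hi ih =>
      rw [Finset.card_insert_of_notMem hi]
      have := (hf.2 A i).2
      omega
  have hA : ∀ A : Finset (Fin d), A.card ≤ d := fun A => by
    have := A.card_le_univ
    rwa [Fintype.card_fin] at this
  rw [← Set.ncard_coe_finset]
  refine Set.ncard_congr (fun f hf x => (⟨2 * f (supp x) + (2 * d - (supp x).card), by
    have h1 := hle f hf (supp x)
    have h2 := hA (supp x)
    omega⟩ : Fin (4 * d + 1))) ?_ ?_ ?_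
  · intro f hf
    refine Finset.mem_coe.2 (Finset.mem_filter.2 ⟨Finset.mem_univ _, fun x i => ?_, ?_⟩)
    · have hstep : ∀ (A : Finset (Fin d)) i, i ∉ A →
          2 * f A + (2 * d - A.card) + 1 = 2 * f (insert i A) + (2 * d - (insert i A).card) ∨
          2 * f (insert i A) + (2 * d - (insert i A).card) + 1 = 2 * f A + (2 * d - A.card) := by
        intro A i hi
        have h1 := hf.2 A i
        have h2 := hA (insert i A)
        rw [Finset.card_insert_of_notMem hi] at h2 ⊢
        omega
      unfold near
      dsimp only
      by_cases h : x i = 0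
      · have e : supp (x + unit i) = insert i (supp x) := by
          have hi : i ∉ supp x := by rw [mem_supp, not_not]; exact h
          rw [← supp_ind (insert i (supp x)), ind_insert hi, ind_supp]
        rw [e]
        exact hstep _ i (by rw [mem_supp, not_not]; exact h)
      · have hi : i ∉ supp (x + unit i) := by
          rw [mem_supp, not_not]
          have := (zmod_two_ne_iff _ _).1 h
          simp only [Pi.add_apply, unit, Pi.single_eq_same, this]
          decide
        have e : supp x = insert i (supp (x + unit i)) := by
          rw [← supp_ind (insert i (supp (x + unit i))), ind_insert hi, ind_supp,
            add_add_cancel_self]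
        rw [e]
        exact (hstep _ i hi).symm
    · have : supp (0 : Cube (Fin d)) = ∅ := by ext; simp [mem_supp]
      simp [this, hf.1]
  · intro f f' hf hf' e
    funext A
    have := congrArg Fin.val (congrFun e (ind A))
    simp only [supp_ind] at this
    omega
  · intro g hg
    obtain ⟨-, h1, h2⟩ := Finset.mem_filter.1 (Finset.mem_coe.1 hg)
    have h0 : ind (∅ : Finset (Fin d)) = 0 := by funext; simp [ind]
    have hex : ∀ A : Finset (Fin d), ∃ n, (g (ind A) : ℕ) + A.card = 2 * d + 2 * n := by
      intro A
      induction A using Finset.induction_on with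
      | empty => exact ⟨0, by simp [h0, h2]⟩
      | insert i A hi ih =>
        obtain ⟨n, hn⟩ := ih
        have := h1 (ind A) i
        rw [← ind_insert hi] at this
        unfold near at this
        rw [Finset.card_insert_of_notMem hi]
        rcases this with h | h
        · exact ⟨n + 1, by omega⟩
        · exact ⟨n, by omega⟩
    choose f hf using hex
    refine ⟨f, ⟨?_, fun A i => ?_⟩, ?_⟩
    · have := hf ∅
      rw [h0, h2, Finset.card_empty] at this
      omega
    · by_cases hi : i ∈ A
      · rw [Finset.insert_eq_of_mem hi]; omega
      · have a1 := h1 (ind A) i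
        rw [← ind_insert hi] at a1
        have a2 := hf A
        have a3 := hf (insert i A)
        rw [Finset.card_insert_of_notMem hi] at a3
        unfold near at a1
        omega
    · funext x
      apply Fin.ext
      have a1 := hf (supp x)
      have a2 := hA (supp x)
      rw [ind_supp] at a1
      show 2 * f (supp x) + (2 * d - (supp x).card) = (g x : ℕ)
      omega
section Range

variable {ι : Type*} [Fintype ι] [DecidableEq ι] {L : ℕ}

lemma IsHom.dist_le {g : Cube ι → Fin L} (hg : IsHom g) (x : Cube ι) :
    (g x : ℕ) ≤ g 0 + Fintype.card ι ∧ (g 0 : ℕ) ≤ g x + Fintype.card ι := by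
  have key : ∀ A : Finset ι, (g (ind A) : ℕ) ≤ g 0 + A.card ∧ (g 0 : ℕ) ≤ g (ind A) + A.card := by
    intro A
    induction A using Finset.induction_on with
    | empty =>
      have : ind (∅ : Finset ι) = 0 := by funext; simp [ind]
      simp [this]
    | insert i A hi ih =>
      have := hg (ind A) i
      rw [← ind_insert hi] at this
      unfold near at this
      rw [Finset.card_insert_of_notMem hi]
      omega
  have h1 := key (supp x)
  rw [ind_supp] at h1
  have := (supp x).card_le_univ
  omega

end Range

variable {d r l q : ℕ}

/-- The function `g` has ground state `a` on the points of parity `p`. -/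
def HasGround (m : ℕ) (p : ZMod 2) (g : Cube (Fin d) → Fin (4 * d + 1)) (a : Fin (4 * d + 1)) :
    Prop :=
  ∀ T : Finset (Fin d), T.card = m → ∃ z : Cube (Fin d),
      ∀ x, (∀ i ∈ T, x i = z i) → par x = p → g x = a

lemma HasGround.exists_eq {m : ℕ} {p : ZMod 2} {g : Cube (Fin d) → Fin (4 * d + 1)}
    {a : Fin (4 * d + 1)} (h : HasGround m p g a) (hm : m < d) : ∃ x, g x = a := by
  obtain ⟨T, -, hT⟩ := Finset.exists_subset_card_eq (s := (Finset.univ : Finset (Fin d))) (n := m)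
    (by rw [Finset.card_univ, Fintype.card_fin]; omega)
  obtain ⟨z, hz⟩ := h T hT
  obtain ⟨i₀, hi₀⟩ : ∃ i, i ∉ T := by
    by_contra! H
    rw [Finset.eq_univ_iff_forall.2 H, Finset.card_univ, Fintype.card_fin] at hT
    omega
  rcases zmod_two_eq_or (par z) p with hp | hp
  · exact ⟨z, hz z (fun _ _ => rfl) hp⟩
  · refine ⟨z + unit i₀, hz _ (fun i hi => ?_) ?_⟩
    · have : i ≠ i₀ := fun e => hi₀ (e ▸ hi)
      simp [unit, this]
    · rw [par_add_unit, hp, add_assoc, zmod_two_add_self, add_zero]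

lemma card_hasGround_le {m K : ℕ} (hm : 0 < m) (hmd : m < d) (hd : 2 ≤ d) (hK : d ^ m ≤ K)
    (hl : (d + 1) * K < 2 ^ (l + 1)) (hl0 : 0 < l) (hq : 2 * l * (4 * q + 1) ≤ d)
    (hβ : 2 * (K * d ^ 2 * (4 * d + 1) ^ 2) ≤ 2 ^ q) (p : ZMod 2)
    (F : Finset (Cube (Fin d) → Fin (4 * d + 1)))
    (hF : ∀ g ∈ F, IsHom g ∧ (g 0 : ℕ) = 2 * d ∧ ∃ a, HasGround m p g a) :
    (F.card : ℝ) ≤ 2 ^ 2 ^ (d - 1) * Real.exp (1 + 2 ^ (d - 1) / 2 ^ ((3 * d - 3) / 2)) := by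
  classical
  have hF' : ∀ g, ∃ a : Fin (4 * d + 1), g ∈ F → HasGround m p g a := by
    intro g
    by_cases hg : g ∈ F
    · obtain ⟨a, ha⟩ := (hF g hg).2.2
      exact ⟨a, fun _ => ha⟩
    · exact ⟨0, fun h => absurd h hg⟩
  choose a ha using hF'
  have hrange : ∀ g ∈ F, ∀ x, (g x : ℕ) ≤ 3 * d ∧ d ≤ g x := by
    intro g hg x
    have := (hF g hg).1.dist_le x
    rw [(hF g hg).2.1, Fintype.card_fin] at this
    omega
  have harange : ∀ g ∈ F, (a g : ℕ) ≤ 3 * d ∧ d ≤ a g := by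
    intro g hg
    obtain ⟨x, hx⟩ := (ha g hg).exists_eq hmd
    rw [← hx]
    exact hrange g hg x
  let shift : (Cube (Fin d) → Fin (4 * d + 1)) → Cube (Fin d) → Fin (4 * d + 1) := fun g x =>
    Fin.ofNat _ ((g x : ℕ) + 2 * d - a g)
  have hshift : ∀ g ∈ F, ∀ x, (shift g x : ℕ) + a g = g x + 2 * d := by
    intro g hg x
    have h1 := hrange g hg x
    have h2 := harange g hg
    have h3 : (shift g x : ℕ) = ((g x : ℕ) + 2 * d - a g) % (4 * d + 1) := rfl
    rw [Nat.mod_eq_of_lt (by omega)] at h3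
    omega
  have hinj : Set.InjOn shift F := by
    intro g hg g' hg' e
    have h0 := hshift g hg 0
    have h0' := hshift g' hg' 0
    rw [(hF g hg).2.1] at h0
    rw [(hF g' hg').2.1, ← e] at h0'
    funext x
    apply Fin.ext
    have h1 := hshift g hg x
    have h1' := hshift g' hg' x
    rw [← e] at h1'
    omega
  have hne : (⟨0, by omega⟩ : Fin d) ≠ ⟨1, by omega⟩ := by simp
  have main := card_few_defects_le hne (L := 4 * d + 1) (by omega) (p := p)
    (a := ⟨2 * d, by omega⟩) (K := K) (l := l) (q := q) (by rwa [Fintype.card_fin]) hl0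
    (by rwa [Fintype.card_fin]) (by rwa [Fintype.card_fin]) (F.image shift) (by
      intro h hh
      obtain ⟨g, hg, rfl⟩ := Finset.mem_image.1 hh
      refine ⟨fun x i => ?_, ?_⟩
      · have h1 := hshift g hg x
        have h2 := hshift g hg (x + unit i)
        have h3 := (hF g hg).1 x i
        unfold near at *
        omega
      · refine le_trans ?_ hK
        have := card_defects_le hm (by rwa [Fintype.card_fin]) (ha g hg)
          (Finset.univ.filter fun x => par x = p ∧ shift g x ≠ ⟨2 * d, by omega⟩) (by
            intro x hx
            obtain ⟨-, h1, h2⟩ := Finset.mem_filter.1 hx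
            refine ⟨h1, fun h3 => h2 (Fin.ext ?_)⟩
            have h4 := hshift g hg x
            rw [h3] at h4
            show (shift g x : ℕ) = 2 * d
            omega)
        rwa [Fintype.card_fin] at this)
  rwa [Finset.card_image_of_injOn hinj, Fintype.card_fin] at main

lemma card_rankFun_le (hr : 0 < r) (hrr : r + 1 ≤ 2 ^ r) (h3 : 3 * 2 ^ r ≤ d)
    (h1 : 24 * ((4 * d + 1 : ℕ) : ℝ) ^ 5 * (3 / 4) ^ 2 ^ r ≤ 1)
    (h2 : 8 * ((4 * d + 1 : ℕ) : ℝ) ^ 2 * 4 ^ (d - 2 ^ r) ≤ 2 ^ 2 ^ (d - 2 ^ r - 2 ^ r - 1))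
    (hl : (d + 1) * d ^ 2 ^ r < 2 ^ (l + 1)) (hl0 : 0 < l) (hq : 2 * l * (4 * q + 1) ≤ d)
    (hβ : 2 * (d ^ 2 ^ r * d ^ 2 * (4 * d + 1) ^ 2) ≤ 2 ^ q) :
    ((RankFun d).ncard : ℝ) ≤
      2 * (2 ^ 2 ^ (d - 1) * Real.exp (1 + 2 ^ (d - 1) / 2 ^ ((3 * d - 3) / 2))) +
      2 ^ d * (2 ^ 2 ^ (d - 1) / 2 ^ 2 ^ (2 ^ r - 1 - r)) := by
  classical
  have hm0 : 2 ≤ 2 ^ r := by omega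
  rw [card_rankFun]
  set R := Finset.univ.filter fun g : Cube (Fin d) → Fin (4 * d + 1) =>
      (∀ x i, near (g x) (g (x + unit i))) ∧ (g 0 : ℕ) = 2 * d with hR
  have hRmem : ∀ g ∈ R, IsHom g ∧ (g 0 : ℕ) = 2 * d := fun g hg => (Finset.mem_filter.1 hg).2
  let G : ZMod 2 ⊕ {T : Finset (Fin d) // T.card = 2 ^ r} →
      Finset (Cube (Fin d) → Fin (4 * d + 1)) := Sum.elim
    (fun p => R.filter fun g => ∃ a, HasGround (2 ^ r) p g a)
    (fun T => R.filter fun g => ∀ z p, ¬ OrderedAt g (2 ^ r) T.1 z p)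
  have hcov : R.card ≤ ∑ i, (G i).card := by
    apply card_le_sum_of_cover
    intro g hg
    by_cases h : ∀ T : Finset (Fin d), T.card = 2 ^ r → ∃ z p, OrderedAt g (2 ^ r) T z p
    · obtain ⟨p, a, hpa⟩ := exists_ground_state (by omega) (by rwa [Fintype.card_fin]) h
      exact ⟨Sum.inl p, Finset.mem_filter.2 ⟨hg, a, hpa⟩⟩
    · push Not at h
      obtain ⟨T, hT, h⟩ := h
      exact ⟨Sum.inr ⟨T, hT⟩, Finset.mem_filter.2 ⟨hg, h⟩⟩
  have b1 : ∀ p, ((G (Sum.inl p)).card : ℝ) ≤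
      2 ^ 2 ^ (d - 1) * Real.exp (1 + 2 ^ (d - 1) / 2 ^ ((3 * d - 3) / 2)) := by
    intro p
    apply card_hasGround_le (m := 2 ^ r) (K := d ^ 2 ^ r) (l := l) (q := q) (by omega) (by omega)
      (by omega) le_rfl hl hl0 hq hβ p
    intro g hg
    obtain ⟨c1, c2⟩ := Finset.mem_filter.1 hg
    exact ⟨(hRmem g c1).1, (hRmem g c1).2, c2⟩
  have b2 : ∀ T, ((G (Sum.inr T)).card : ℝ) ≤ 2 ^ 2 ^ (d - 1) / 2 ^ 2 ^ (2 ^ r - 1 - r) := by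
    intro T
    have := card_failing_le_two_pow (ι := Fin d) (L := 4 * d + 1) (k := d - 2 ^ r) hr hrr T.2
      (by rw [Fintype.card_fin]; omega) (by omega) (by omega) (by omega) (by omega) h1 h2
      (G (Sum.inr T)) (by
        intro g hg
        obtain ⟨c1, c2⟩ := Finset.mem_filter.1 hg
        exact ⟨(hRmem g c1).1, c2⟩)
    rwa [Fintype.card_fin] at this
  have hcov' : (R.card : ℝ) ≤ ∑ i, ((G i).card : ℝ) := by exact_mod_cast hcov
  refine hcov'.trans ?_
  rw [Fintype.sum_sum_type]
  refine add_le_add ?_ ?_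
  · refine (Finset.sum_le_card_nsmul _ _ _ fun p _ => b1 p).trans (le_of_eq ?_)
    rw [Finset.card_univ, ZMod.card, nsmul_eq_mul, Nat.cast_ofNat]
  · refine (Finset.sum_le_card_nsmul _ _ _ fun T _ => b2 T).trans ?_
    rw [Finset.card_univ, nsmul_eq_mul]
    refine mul_le_mul_of_nonneg_right ?_ (by positivity)
    have : Fintype.card {T : Finset (Fin d) // T.card = 2 ^ r} ≤ 2 ^ d := by
      refine (Fintype.card_subtype_le _).trans ?_
      rw [Fintype.card_finset, Fintype.card_fin]
    exact_mod_cast this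
section Signings

variable {ι : Type*} [Fintype ι] [DecidableEq ι]

/-- The signings of the points of parity `p + 1` which are constant on the neighbourhood of each
point of `S`. -/
def signings (p : ZMod 2) (S : Finset (Cube ι)) : Finset (Cube ι → ZMod 2) :=
  Finset.univ.filter fun χ =>
    (∀ x, par x = p → χ x = 0) ∧ ∀ x ∈ S, ∀ i j, χ (x + unit i) = χ (x + unit j)

lemma mem_signings {p : ZMod 2} {S : Finset (Cube ι)} {χ : Cube ι → ZMod 2} :
    χ ∈ signings p S ↔
      (∀ x, par x = p → χ x = 0) ∧ ∀ x ∈ S, ∀ i j, χ (x + unit i) = χ (x + unit j) := by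
  simp only [signings, Finset.mem_filter, Finset.mem_univ, true_and]

lemma card_signings_empty [Nonempty ι] (p : ZMod 2) :
    (signings p (∅ : Finset (Cube ι))).card = 2 ^ 2 ^ (Fintype.card ι - 1) := by
  have : signings p (∅ : Finset (Cube ι)) =
      Fintype.piFinset fun x : Cube ι => if par x = p + 1 then Finset.univ else {0} := by
    ext χ
    rw [mem_signings, Fintype.mem_piFinset]
    constructor
    · rintro ⟨h, -⟩ x
      split_ifs with hx
      · exact Finset.mem_univ _
      · rcases zmod_two_eq_or (par x) p with h1 | h1
        · exact Finset.mem_singleton.2 (h x h1)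
        · exact absurd h1 hx
    · intro h
      refine ⟨fun x hx => ?_, fun x hx => absurd hx (Finset.notMem_empty x)⟩
      have h1 := h x
      rw [if_neg (by rw [hx]; simp)] at h1
      exact Finset.mem_singleton.1 h1
  rw [this, Fintype.card_piFinset, ← card_par_eq (ι := ι) (p + 1), Finset.card_filter,
    ← Finset.prod_pow_eq_pow_sum]
  refine Finset.prod_congr rfl fun x _ => ?_
  split_ifs <;> simp [ZMod.card]

lemma card_signings_le_insert [Nonempty ι] (p : ZMod 2) (S : Finset (Cube ι)) (x : Cube ι) :
    (signings p S).card ≤ 2 ^ (Fintype.card ι - 1) * (signings p (insert x S)).card := by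
  obtain ⟨i₀⟩ := ‹Nonempty ι›
  have hT : (Fintype.piFinset fun i : ι => if i = i₀ then ({0} : Finset (ZMod 2))
      else Finset.univ).card = 2 ^ (Fintype.card ι - 1) := by
    rw [Fintype.card_piFinset, ← Finset.mul_prod_erase _ _ (Finset.mem_univ i₀), if_pos rfl,
      Finset.card_singleton, one_mul, Finset.prod_congr rfl (g := fun _ => 2), Finset.prod_const,
      Finset.card_erase_of_mem (Finset.mem_univ _), Finset.card_univ]
    intro i hi
    rw [if_neg (Finset.ne_of_mem_erase hi)]
    simp [ZMod.card]
  rw [← hT, mul_comm]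
  refine Finset.card_le_mul_card_image_of_maps_to
    (f := fun χ : Cube ι → ZMod 2 => fun i => χ (x + unit i) + χ (x + unit i₀)) ?_ _ ?_
  · intro χ _
    refine Fintype.mem_piFinset.2 fun i => ?_
    split_ifs with hi
    · rw [hi, zmod_two_add_self]
      exact Finset.mem_singleton_self _
    · exact Finset.mem_univ _
  · intro b _
    rcases (Finset.filter (fun χ : Cube ι → ZMod 2 =>
      (fun i => χ (x + unit i) + χ (x + unit i₀)) = b) (signings p S)).eq_empty_or_nonempty with
      h | ⟨χ₀, h⟩
    · rw [h]; simp
    · obtain ⟨h1, h2⟩ := Finset.mem_filter.1 h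
      rw [mem_signings] at h1
      apply Finset.card_le_card_of_injOn fun χ => χ + χ₀
      · intro χ hχ
        obtain ⟨h3, h4⟩ := Finset.mem_filter.1 hχ
        rw [mem_signings] at h3
        beta_reduce
        refine Finset.mem_coe.2 (mem_signings.2 ⟨fun y hy => ?_, fun y hy i j => ?_⟩)
        · rw [Pi.add_apply, h3.1 y hy, h1.1 y hy, add_zero]
        · rw [Pi.add_apply, Pi.add_apply]
          rcases Finset.mem_insert.1 hy with rfl | hy
          · have key : ∀ i, χ (y + unit i) + χ₀ (y + unit i) =
                χ (y + unit i₀) + χ₀ (y + unit i₀) := by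
              intro i
              have : χ (y + unit i) + χ (y + unit i₀) = χ₀ (y + unit i) + χ₀ (y + unit i₀) :=
                congrFun (h4.trans h2.symm) i
              have swap : ∀ a b c e : ZMod 2, a + c = b + e → a + b = c + e := by decide
              exact swap _ _ _ _ this
            rw [key i, key j]
          · rw [h3.2 y hy i j, h1.2 y hy i j]
      · intro χ _ χ' _ h
        exact add_right_cancel h

lemma two_pow_le_card_signings [Nonempty ι] (p : ZMod 2) (S : Finset (Cube ι)) :
    2 ^ 2 ^ (Fintype.card ι - 1) ≤
      (2 ^ (Fintype.card ι - 1)) ^ S.card * (signings p S).card := by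
  induction S using Finset.induction_on with
  | empty => rw [card_signings_empty]; simp
  | insert x S hx ih =>
    rw [Finset.card_insert_of_notMem hx, pow_succ, mul_assoc]
    exact ih.trans (Nat.mul_le_mul_left _ (card_signings_le_insert p S x))

/-- The subsets of `A` with at most `k` elements. -/
def smallSubsets {α : Type*} (A : Finset α) (k : ℕ) : Finset (Finset α) :=
  A.powerset.filter fun S => S.card ≤ k

lemma mem_smallSubsets {α : Type*} {A S : Finset α} {k : ℕ} :
    S ∈ smallSubsets A k ↔ S ⊆ A ∧ S.card ≤ k := by
  simp only [smallSubsets, Finset.mem_filter, Finset.mem_powerset]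

lemma sum_smallSubsets {α : Type*} (A : Finset α) {k : ℕ} (hk : k ≤ A.card) (f : ℕ → ℝ) :
    ∑ S ∈ smallSubsets A k, f S.card = ∑ j ∈ Finset.range (k + 1), (A.card.choose j : ℝ) * f j := by
  rw [smallSubsets, Finset.sum_filter,
    Finset.sum_powerset_apply_card (fun j => if j ≤ k then f j else 0)]
  symm
  have hsub : Finset.range (k + 1) ⊆ Finset.range (A.card + 1) :=
    Finset.range_mono (by omega)
  rw [← Finset.sum_subset hsub]
  · refine Finset.sum_congr rfl fun j hj => ?_
    rw [if_pos (by have := Finset.mem_range.1 hj; omega), nsmul_eq_mul]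
  · intro j _ hj
    rw [if_neg (by have := mt Finset.mem_range.2 hj; omega), smul_zero]

lemma card_smallSubsets_le {α : Type*} (A : Finset α) {k : ℕ} (hk : k ≤ A.card) (h0 : 0 < A.card) :
    (smallSubsets A k).card ≤ (k + 1) * A.card ^ k := by
  have h := sum_smallSubsets A hk fun _ => 1
  rw [Finset.sum_const, nsmul_eq_mul, mul_one] at h
  rw [← Nat.cast_le (α := ℝ), h]
  calc ∑ j ∈ Finset.range (k + 1), (A.card.choose j : ℝ) * 1
      ≤ ∑ j ∈ Finset.range (k + 1), (A.card : ℝ) ^ k := by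
        refine Finset.sum_le_sum fun j hj => ?_
        rw [mul_one]
        have h1 := Nat.choose_le_pow A.card j
        have h2 : A.card ^ j ≤ A.card ^ k :=
          Nat.pow_le_pow_right h0 (by have := Finset.mem_range.1 hj; omega)
        exact_mod_cast h1.trans h2
    _ = ((k + 1) * A.card ^ k : ℕ) := by
        rw [Finset.sum_const, Finset.card_range, nsmul_eq_mul]; push_cast; rfl

end Signings
section Height

variable {ι : Type*} [Fintype ι] [DecidableEq ι]

/-- The sign `-1` or `1` encoded by an element of `ZMod 2`. -/
def sign (a : ZMod 2) : ℤ := if a = 0 then -1 else 1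

lemma sign_cases (a : ZMod 2) : sign a = 1 ∨ sign a = -1 := by
  unfold sign; split_ifs <;> simp

lemma sign_injective : Function.Injective sign := by
  intro a b; revert a b; decide

/-- The integer-valued function which vanishes at the points of parity `p` outside `S`, is given
by the signing `χ` at the points of parity `p + 1`, and moves away from zero on `S`. -/
def height (i₀ : ι) (p : ZMod 2) (S : Finset (Cube ι)) (χ : Cube ι → ZMod 2) (x : Cube ι) : ℤ :=
  if par x = p then if x ∈ S then 2 * sign (χ (x + unit i₀)) else 0 else sign (χ x)

variable {i₀ : ι} {p : ZMod 2} {S : Finset (Cube ι)} {χ : Cube ι → ZMod 2}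

lemma abs_height_le (x : Cube ι) : -2 ≤ height i₀ p S χ x ∧ height i₀ p S χ x ≤ 2 := by
  unfold height
  split_ifs
  · rcases sign_cases (χ (x + unit i₀)) with h | h <;> rw [h] <;> simp
  · simp
  · rcases sign_cases (χ x) with h | h <;> rw [h] <;> simp

lemma height_near_of_par (hχ : χ ∈ signings p S) {x : Cube ι} (hx : par x = p) (i : ι) :
    height i₀ p S χ x + 1 = height i₀ p S χ (x + unit i) ∨
      height i₀ p S χ (x + unit i) + 1 = height i₀ p S χ x := by
  have h1 : par (x + unit i) ≠ p := by rw [par_add_unit, hx]; simp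
  unfold height
  rw [if_pos hx, if_neg h1]
  split_ifs with h
  · rw [(mem_signings.1 hχ).2 x h i i₀]
    rcases sign_cases (χ (x + unit i₀)) with h | h <;> rw [h] <;> simp
  · rcases sign_cases (χ (x + unit i)) with h | h <;> rw [h] <;> simp

lemma height_near (hχ : χ ∈ signings p S) (x : Cube ι) (i : ι) :
    height i₀ p S χ x + 1 = height i₀ p S χ (x + unit i) ∨
      height i₀ p S χ (x + unit i) + 1 = height i₀ p S χ x := by
  by_cases hx : par x = p
  · exact height_near_of_par hχ hx i
  · have h1 : par (x + unit i) = p := by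
      rw [par_add_unit, (zmod_two_ne_iff _ _).1 hx, add_assoc, zmod_two_add_self, add_zero]
    have := height_near_of_par (i₀ := i₀) hχ h1 i
    rw [add_add_cancel_self] at this
    exact this.symm

/-- The height function shifted so that it takes the value `2 * d` at the origin. -/
def shifted {d : ℕ} (hd : 2 ≤ d) (i₀ : ι) (p : ZMod 2) (S : Finset (Cube ι)) (χ : Cube ι → ZMod 2)
    (x : Cube ι) : Fin (4 * d + 1) :=
  ⟨(height i₀ p S χ x - height i₀ p S χ 0 + 2 * d).toNat, by
    have h1 := abs_height_le (i₀ := i₀) (p := p) (S := S) (χ := χ) x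
    have h2 := abs_height_le (i₀ := i₀) (p := p) (S := S) (χ := χ) 0
    omega⟩

lemma shifted_val {d : ℕ} (hd : 2 ≤ d) (x : Cube ι) : ((shifted hd i₀ p S χ x : ℕ) : ℤ) =
    height i₀ p S χ x - height i₀ p S χ 0 + 2 * d := by
  have h1 := abs_height_le (i₀ := i₀) (p := p) (S := S) (χ := χ) x
  have h2 := abs_height_le (i₀ := i₀) (p := p) (S := S) (χ := χ) 0
  rw [shifted]
  simp only
  omega

lemma height_eq_add_of_shifted_eq {d : ℕ} (hd : 2 ≤ d) {p' : ZMod 2} {S' : Finset (Cube ι)}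
    {χ' : Cube ι → ZMod 2} (h : shifted hd i₀ p S χ = shifted hd i₀ p' S' χ') :
    ∃ c, ∀ x, height i₀ p S χ x = height i₀ p' S' χ' x + c := by
  refine ⟨height i₀ p S χ 0 - height i₀ p' S' χ' 0, fun x => ?_⟩
  have h1 := shifted_val (i₀ := i₀) (p := p) (S := S) (χ := χ) hd x
  have h2 := shifted_val (i₀ := i₀) (p := p') (S := S') (χ := χ') hd x
  rw [h] at h1
  omega

/-- The pairs of a small set `S` of points of parity `p` and a signing compatible with it,
in which both signs are frequent. -/
def signedSets (ι : Type*) [Fintype ι] [DecidableEq ι] (p : ZMod 2) (k : ℕ) :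
    Finset (Finset (Cube ι) × (Cube ι → ZMod 2)) :=
  Finset.univ.filter fun P => P.1 ∈ smallSubsets (Finset.univ.filter fun x => par x = p) k ∧
    P.2 ∈ signings p P.1 ∧
    ∀ a, k < (Finset.univ.filter fun x => par x = p + 1 ∧ P.2 x = a).card

lemma mem_signedSets {k : ℕ} {P : Finset (Cube ι) × (Cube ι → ZMod 2)} :
    P ∈ signedSets ι p k ↔ P.1 ∈ smallSubsets (Finset.univ.filter fun x => par x = p) k ∧
    P.2 ∈ signings p P.1 ∧
    ∀ a, k < (Finset.univ.filter fun x => par x = p + 1 ∧ P.2 x = a).card := by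
  simp only [signedSets, Finset.mem_filter, Finset.mem_univ, true_and]

lemma shifted_injOn [Nonempty ι] {d k : ℕ} (hd : 2 ≤ d) (hk : 2 * k < 2 ^ (Fintype.card ι - 1)) :
    Set.InjOn (fun P : Finset (Cube ι) × (Cube ι → ZMod 2) => shifted hd i₀ p P.1 P.2)
      (signedSets ι p k) := by
  rintro ⟨S, χ⟩ h ⟨S', χ'⟩ h' heq
  obtain ⟨h1, h2, -⟩ := mem_signedSets.1 h
  obtain ⟨h1', h2', -⟩ := mem_signedSets.1 h'
  rw [mem_smallSubsets] at h1 h1'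
  rw [mem_signings] at h2 h2'
  simp only at h1 h1' h2 h2'
  obtain ⟨c, hc⟩ := height_eq_add_of_shifted_eq hd heq
  simp only at hc
  obtain ⟨x, hx, hxS⟩ : ∃ x ∈ Finset.univ.filter fun x : Cube ι => par x = p, x ∉ S ∪ S' := by
    apply Finset.exists_mem_notMem_of_card_lt_card
    rw [card_par_eq]
    have := Finset.card_union_le S S'
    omega
  have hx := (Finset.mem_filter.1 hx).2
  rw [Finset.mem_union, not_or] at hxS
  have hc0 : c = 0 := by
    have := hc x
    unfold height at this
    rw [if_pos hx, if_neg hxS.1, if_pos hx, if_neg hxS.2] at this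
    omega
  subst hc0
  have hmem : ∀ {S : Finset (Cube ι)} {χ : Cube ι → ZMod 2} {y : Cube ι}, par y = p →
      (y ∈ S ↔ height i₀ p S χ y ≠ 0) := by
    intro S χ y hy
    unfold height
    rw [if_pos hy]
    split_ifs with hS
    · rcases sign_cases (χ (y + unit i₀)) with h | h <;> rw [h] <;> simp [hS]
    · simp [hS]
  refine Prod.ext ?_ ?_
  · ext y
    by_cases hy : par y = p
    · simp only
      rw [hmem (χ := χ) hy, hmem (χ := χ') hy, hc y, add_zero]
    · exact ⟨fun hS => absurd (Finset.mem_filter.1 (h1.1 hS)).2 hy,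
        fun hS => absurd (Finset.mem_filter.1 (h1'.1 hS)).2 hy⟩
  · funext y
    by_cases hy : par y = p
    · exact (h2.1 y hy).trans (h2'.1 y hy).symm
    · apply sign_injective
      have := hc y
      unfold height at this
      rwa [if_neg hy, if_neg hy, add_zero] at this

lemma shifted_ne {d k : ℕ} (hd : 2 ≤ d) {S' : Finset (Cube ι)} {χ' : Cube ι → ZMod 2}
    (h : (S, χ) ∈ signedSets ι p k) (h' : (S', χ') ∈ signedSets ι (p + 1) k) :
    shifted hd i₀ p S χ ≠ shifted hd i₀ (p + 1) S' χ' := by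
  intro heq
  obtain ⟨c, hc⟩ := height_eq_add_of_shifted_eq hd heq
  obtain ⟨h1, -, -⟩ := mem_signedSets.1 h
  obtain ⟨-, -, h2⟩ := mem_signedSets.1 h'
  rw [add_assoc, zmod_two_add_self, add_zero] at h2
  have key : ∀ a, sign a = -c := by
    intro a
    obtain ⟨x, hx, hxS⟩ := Finset.exists_mem_notMem_of_card_lt_card
      ((mem_smallSubsets.1 h1).2.trans_lt (h2 a))
    obtain ⟨hx, hxa⟩ := (Finset.mem_filter.1 hx).2
    have := hc x
    unfold height at this
    rw [if_pos hx, if_neg hxS, if_neg (by rw [hx]; simp), show χ' x = a from hxa] at this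
    omega
  exact absurd (sign_injective ((key 0).trans (key 1).symm)) (by decide)

lemma card_signedSets_add_le [Nonempty ι] {d k : ℕ} (hd : 2 ≤ d)
    (hk : 2 * k < 2 ^ (Fintype.card ι - 1)) :
    (signedSets ι 0 k).card + (signedSets ι 1 k).card ≤
      (Finset.univ.filter fun g : Cube ι → Fin (4 * d + 1) =>
        (∀ x i, near (g x) (g (x + unit i))) ∧ (g 0 : ℕ) = 2 * d).card := by
  obtain ⟨i₀⟩ := ‹Nonempty ι›
  have : Nonempty ι := ⟨i₀⟩
  rw [← Finset.card_image_of_injOn (shifted_injOn (i₀ := i₀) (p := 0) hd hk),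
    ← Finset.card_image_of_injOn (shifted_injOn (i₀ := i₀) (p := 1) hd hk),
    ← Finset.card_union_of_disjoint]
  · apply Finset.card_le_card
    have key : ∀ p, ∀ P ∈ signedSets ι p k, shifted hd i₀ p P.1 P.2 ∈
        (Finset.univ.filter fun g : Cube ι → Fin (4 * d + 1) =>
        (∀ x i, near (g x) (g (x + unit i))) ∧ (g 0 : ℕ) = 2 * d) := by
      rintro p ⟨S, χ⟩ hP
      refine Finset.mem_filter.2 ⟨Finset.mem_univ _, fun x i => ?_, ?_⟩
      · have h0 := height_near (i₀ := i₀) (mem_signedSets.1 hP).2.1 x i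
        have h1 := shifted_val (i₀ := i₀) (p := p) (S := S) (χ := χ) hd x
        have h2 := shifted_val (i₀ := i₀) (p := p) (S := S) (χ := χ) hd (x + unit i)
        simp only at h0 ⊢
        unfold near
        omega
      · have h1 := shifted_val (i₀ := i₀) (p := p) (S := S) (χ := χ) hd 0
        simp only
        omega
    apply Finset.union_subset <;>
    · intro g hg
      obtain ⟨P, hP, rfl⟩ := Finset.mem_image.1 hg
      exact key _ P hP
  · rw [Finset.disjoint_left]
    intro g hg hg'
    obtain ⟨⟨S, χ⟩, hP, rfl⟩ := Finset.mem_image.1 hg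
    obtain ⟨⟨S', χ'⟩, hP', h⟩ := Finset.mem_image.1 hg'
    exact shifted_ne (p := 0) hd hP (by rwa [zero_add]) (by rw [zero_add]; exact h.symm)

end Height
section Count

variable {ι : Type*} [Fintype ι] [DecidableEq ι] {p : ZMod 2}

lemma card_signings_few_le [Nonempty ι] (a : ZMod 2) {k : ℕ} (hk : k ≤ 2 ^ (Fintype.card ι - 1)) :
    ((signings p (∅ : Finset (Cube ι))).filter fun χ =>
      (Finset.univ.filter fun x => par x = p + 1 ∧ χ x = a).card ≤ k).card ≤
      (k + 1) * (2 ^ (Fintype.card ι - 1)) ^ k := by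
  have hc := card_par_eq (ι := ι) (p + 1)
  have h := card_smallSubsets_le (Finset.univ.filter fun x : Cube ι => par x = p + 1) (k := k)
    (by rw [hc]; exact hk) (by rw [hc]; positivity)
  rw [hc] at h
  refine le_trans ?_ h
  apply Finset.card_le_card_of_injOn fun χ : Cube ι → ZMod 2 =>
    Finset.univ.filter fun x => par x = p + 1 ∧ χ x = a
  · intro χ hχ
    beta_reduce
    refine Finset.mem_coe.2 (mem_smallSubsets.2 ⟨fun x hx => ?_, (Finset.mem_filter.1 hχ).2⟩)
    exact Finset.mem_filter.2 ⟨Finset.mem_univ _, (Finset.mem_filter.1 hx).2.1⟩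
  · intro χ hχ χ' hχ' heq
    have h1 := (mem_signings.1 (Finset.mem_filter.1 hχ).1).1
    have h1' := (mem_signings.1 (Finset.mem_filter.1 hχ').1).1
    funext x
    rcases zmod_two_eq_or (par x) p with hx | hx
    · rw [h1 x hx, h1' x hx]
    · have h2 := Finset.ext_iff.1 heq x
      simp only [Finset.mem_filter, Finset.mem_univ, true_and, hx] at h2
      have two : ∀ a b c : ZMod 2, (b = a ↔ c = a) → b = c := by decide
      exact two _ _ _ h2

lemma le_card_signedSets [Nonempty ι] {k : ℕ} (hk : k ≤ 2 ^ (Fintype.card ι - 1)) :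
    (2 : ℝ) ^ 2 ^ (Fintype.card ι - 1) * ∑ j ∈ Finset.range (k + 1),
      ((2 ^ (Fintype.card ι - 1)).choose j : ℝ) * (((2 : ℝ) ^ (Fintype.card ι - 1)) ^ j)⁻¹ ≤
      (signedSets ι p k).card + 2 * ((k + 1) * (2 ^ (Fintype.card ι - 1)) ^ k) ^ 2 := by
  have hc := card_par_eq (ι := ι) p
  have hsub : ((smallSubsets (Finset.univ.filter fun x : Cube ι => par x = p) k).sigma
      fun S => signings p S).card ≤ (signedSets ι p k).card +
      (smallSubsets (Finset.univ.filter fun x : Cube ι => par x = p) k).card *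
      (((signings p (∅ : Finset (Cube ι))).filter fun χ =>
      (Finset.univ.filter fun x => par x = p + 1 ∧ χ x = 0).card ≤ k).card +
      ((signings p (∅ : Finset (Cube ι))).filter fun χ =>
      (Finset.univ.filter fun x => par x = p + 1 ∧ χ x = 1).card ≤ k).card) := by
    refine le_trans ?_ (Nat.add_le_add_left (Nat.mul_le_mul_left _ (Finset.card_union_le _ _)) _)
    rw [← Finset.card_product]
    refine le_trans ?_ (Finset.card_union_le _ _)
    apply Finset.card_le_card_of_injOn fun P => (P.1, P.2)
    · rintro ⟨S, χ⟩ h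
      obtain ⟨h1, h2⟩ := Finset.mem_sigma.1 h
      simp only at h1 h2
      beta_reduce
      simp only
      have h0 : χ ∈ signings p (∅ : Finset (Cube ι)) :=
        mem_signings.2 ⟨(mem_signings.1 h2).1, fun x hx => absurd hx (Finset.notMem_empty x)⟩
      by_cases hfew : ∀ a, k < (Finset.univ.filter fun x => par x = p + 1 ∧ χ x = a).card
      · exact Finset.mem_coe.2 (Finset.mem_union_left _ (mem_signedSets.2 ⟨h1, h2, hfew⟩))
      · push Not at hfew
        obtain ⟨a, ha⟩ := hfew
        refine Finset.mem_coe.2 (Finset.mem_union_right _ (Finset.mem_product.2 ⟨h1, ?_⟩))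
        rcases zmod_two_eq_or a 0 with rfl | rfl
        · exact Finset.mem_union_left _ (Finset.mem_filter.2 ⟨h0, ha⟩)
        · exact Finset.mem_union_right _ (Finset.mem_filter.2 ⟨h0, ha⟩)
    · rintro ⟨S, χ⟩ _ ⟨S', χ'⟩ _ h
      obtain ⟨rfl, rfl⟩ := Prod.mk.inj h
      rfl
  have h0 := card_signings_few_le (p := p) 0 hk
  have h1 := card_signings_few_le (p := p) 1 hk
  have hs := card_smallSubsets_le (Finset.univ.filter fun x : Cube ι => par x = p) (k := k)
    (by rw [hc]; exact hk) (by rw [hc]; positivity)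
  rw [hc] at hs
  have hsum := sum_smallSubsets (Finset.univ.filter fun x : Cube ι => par x = p) (k := k)
    (by rw [hc]; exact hk) fun j => (((2 : ℝ) ^ (Fintype.card ι - 1)) ^ j)⁻¹
  rw [hc] at hsum
  rw [← hsum, Finset.mul_sum]
  have hle : ∑ S ∈ smallSubsets (Finset.univ.filter fun x : Cube ι => par x = p) k,
      (2 : ℝ) ^ 2 ^ (Fintype.card ι - 1) * (((2 : ℝ) ^ (Fintype.card ι - 1)) ^ S.card)⁻¹ ≤
      (((smallSubsets (Finset.univ.filter fun x : Cube ι => par x = p) k).sigma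
      fun S => signings p S).card : ℝ) := by
    rw [Finset.card_sigma, Nat.cast_sum]
    refine Finset.sum_le_sum fun S _ => ?_
    rw [← div_eq_mul_inv, div_le_iff₀ (by positivity), mul_comm]
    exact_mod_cast two_pow_le_card_signings p S
  refine hle.trans ((Nat.cast_le.2 hsub).trans ?_)
  generalize ((signings p (∅ : Finset (Cube ι))).filter fun χ =>
      (Finset.univ.filter fun x => par x = p + 1 ∧ χ x = 0).card ≤ k).card = u at *
  generalize ((signings p (∅ : Finset (Cube ι))).filter fun χ =>
      (Finset.univ.filter fun x => par x = p + 1 ∧ χ x = 1).card ≤ k).card = v at *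
  generalize (smallSubsets (Finset.univ.filter fun x : Cube ι => par x = p) k).card = w at *
  have h3 : w * (u + v) ≤ 2 * ((k + 1) * (2 ^ (Fintype.card ι - 1)) ^ k) ^ 2 := by
    generalize (k + 1) * (2 ^ (Fintype.card ι - 1)) ^ k = T at *
    calc w * (u + v) ≤ T * (T + T) := Nat.mul_le_mul hs (Nat.add_le_add h0 h1)
      _ = 2 * T ^ 2 := by ring
  rw [Nat.cast_add]
  apply add_le_add le_rfl
  exact_mod_cast h3

end Count

lemma le_card_rankFun {d : ℕ} (hd : 2 ≤ d) (hk : 2 * d < 2 ^ (d - 1)) :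
    2 * ((2 : ℝ) ^ 2 ^ (d - 1) * ∑ j ∈ Finset.range (d + 1),
      ((2 ^ (d - 1)).choose j : ℝ) * (((2 : ℝ) ^ (d - 1)) ^ j)⁻¹) ≤
      (RankFun d).ncard + 4 * ((d + 1) * (2 ^ (d - 1)) ^ d) ^ 2 := by
  have : Nonempty (Fin d) := ⟨⟨0, by omega⟩⟩
  have hcard : Fintype.card (Fin d) = d := Fintype.card_fin d
  have h : (signedSets (Fin d) 0 d).card + (signedSets (Fin d) 1 d).card ≤ (RankFun d).ncard := by
    rw [card_rankFun]
    convert card_signedSets_add_le (ι := Fin d) hd (by rwa [hcard])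
  have h0 := le_card_signedSets (ι := Fin d) (p := 0) (k := d) (by rw [hcard]; omega)
  have h1 := le_card_signedSets (ι := Fin d) (p := 1) (k := d) (by rw [hcard]; omega)
  rw [hcard] at h0 h1
  have h' : ((signedSets (Fin d) 0 d).card : ℝ) + (signedSets (Fin d) 1 d).card ≤
    (RankFun d).ncard := by exact_mod_cast h
  linarith
lemma sum_choose_mul_inv_pow_ge {M k : ℕ} (hM : 0 < M) (hk : k ≤ M) :
    (1 - (k : ℝ) ^ 2 / M) * ∑ j ∈ Finset.range (k + 1), (j.factorial : ℝ)⁻¹ ≤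
      ∑ j ∈ Finset.range (k + 1), (M.choose j : ℝ) * ((M : ℝ) ^ j)⁻¹ := by
  have hM' : (0 : ℝ) < M := by exact_mod_cast hM
  rw [Finset.mul_sum]
  refine Finset.sum_le_sum fun j hj => ?_
  have hjk : j ≤ k := by have := Finset.mem_range.1 hj; omega
  have hjk' : (j : ℝ) ≤ k := by exact_mod_cast hjk
  have hkM : (k : ℝ) ≤ M := by exact_mod_cast hk
  have h1 : ((M + 1 - j : ℕ) : ℝ) ^ j ≤ j.factorial * M.choose j := by
    exact_mod_cast (Nat.pow_sub_le_descFactorial M j).trans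
      (Nat.descFactorial_eq_factorial_mul_choose M j).le
  have h2 : (M : ℝ) - j ≤ (M + 1 - j : ℕ) := by
    rw [Nat.cast_sub (by omega)]; push_cast; linarith
  have h3 : 1 - (k : ℝ) ^ 2 / M ≤ (1 + -((j : ℝ) / M)) ^ j := by
    refine le_trans ?_ (one_add_mul_le_pow (a := -((j : ℝ) / M)) ?_ j)
    · rw [mul_neg, ← sub_eq_add_neg, ← mul_div_assoc]
      apply sub_le_sub_left
      apply div_le_div_of_nonneg_right _ hM'.le
      nlinarith [(Nat.cast_nonneg j : (0 : ℝ) ≤ j)]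
    · have : (j : ℝ) / M ≤ 1 := (div_le_one hM').2 (hjk'.trans hkM)
      linarith
  have h4 : (1 + -((j : ℝ) / M)) ^ j = ((M : ℝ) - j) ^ j / (M : ℝ) ^ j := by
    rw [← div_pow]
    congr 1
    field_simp
    ring
  have h5 : ((M : ℝ) - j) ^ j ≤ j.factorial * M.choose j :=
    (pow_le_pow_left₀ (by linarith) h2 j).trans h1
  have hf : (0 : ℝ) < j.factorial := by exact_mod_cast j.factorial_pos
  calc (1 - (k : ℝ) ^ 2 / M) * (j.factorial : ℝ)⁻¹
      ≤ (j.factorial * M.choose j / (M : ℝ) ^ j) * (j.factorial : ℝ)⁻¹ := by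
        apply mul_le_mul_of_nonneg_right _ (inv_nonneg.2 hf.le)
        rw [h4] at h3
        exact h3.trans (div_le_div_of_nonneg_right h5 (by positivity))
    _ = (M.choose j : ℝ) * ((M : ℝ) ^ j)⁻¹ := by field_simp

lemma exp_one_le_sum (d : ℕ) :
    Real.exp 1 - 2 / 2 ^ d ≤ ∑ j ∈ Finset.range (d + 1), (j.factorial : ℝ)⁻¹ := by
  have h := (abs_le.1 (Real.exp_bound (x := 1) (by simp) (Nat.succ_pos d))).2
  simp only [one_pow, abs_one, one_mul, one_div, Nat.succ_eq_add_one] at h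
  have h1 : 2 ^ d ≤ (d + 1).factorial := by
    have := Nat.factorial_mul_pow_le_factorial (m := 1) (n := d)
    rw [add_comm]
    simpa using this
  have h1' : (2 : ℝ) ^ d ≤ (d + 1).factorial := by exact_mod_cast h1
  have h2 : ((d + 1 + 1 : ℕ) : ℝ) / ((d + 1).factorial * (d + 1 : ℕ)) ≤ 2 / 2 ^ d := by
    rw [div_le_div_iff₀ (by positivity) (by positivity)]
    have hd : (0 : ℝ) ≤ d := Nat.cast_nonneg d
    push_cast
    have : (d + 1 + 1 : ℝ) ≤ 2 * (d + 1) := by linarith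
    calc (d + 1 + 1 : ℝ) * 2 ^ d ≤ (2 * (d + 1)) * (d + 1).factorial :=
          mul_le_mul this h1' (by positivity) (by positivity)
      _ = 2 * ((d + 1).factorial * (d + 1)) := by ring
  linarith

lemma two_mul_sq_le_two_pow {d : ℕ} (hd : 8 ≤ d) : 2 * d ^ 2 ≤ 2 ^ (d - 1) := by
  obtain ⟨n, rfl⟩ := Nat.exists_eq_add_of_le hd
  induction n with
  | zero => norm_num
  | succ n ih =>
    have := ih (by omega)
    rw [show 8 + (n + 1) - 1 = (8 + n - 1) + 1 by omega, pow_succ 2 (8 + n - 1)]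
    nlinarith

lemma card_rankFun_ge {d : ℕ} (hd : 8 ≤ d) :
    (2 : ℝ) ^ 2 ^ (d - 1) * (2 * Real.exp 1 - 36 * d ^ 2 / 2 ^ d) ≤ (RankFun d).ncard := by
  have hsq := two_mul_sq_le_two_pow hd
  have h2d : 2 * d < 2 ^ (d - 1) := by nlinarith
  have h := le_card_rankFun (by omega) h2d
  have h1 := sum_choose_mul_inv_pow_ge (M := 2 ^ (d - 1)) (k := d) (by positivity) (by omega)
  have h2 := exp_one_le_sum d
  have hM : (2 : ℝ) ^ d = 2 * 2 ^ (d - 1) := by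
    rw [← pow_succ']; congr 1; omega
  have hd' : (8 : ℝ) ≤ d := by exact_mod_cast hd
  have hsq' : 2 * (d : ℝ) ^ 2 ≤ 2 ^ (d - 1) := by exact_mod_cast hsq
  have h3 : 4 * (((d : ℝ) + 1) * (2 ^ (d - 1)) ^ d) ^ 2 ≤
      2 ^ 2 ^ (d - 1) * (16 * d ^ 2 / 2 ^ d) := by
    have hexp : ((2 : ℝ) ^ (d - 1)) ^ d * (2 ^ (d - 1)) ^ d * 2 ^ d ≤ 2 ^ 2 ^ (d - 1) := by
      rw [← pow_mul, ← pow_add, ← pow_add]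
      apply pow_le_pow_right₀ (by norm_num)
      refine le_trans ?_ hsq
      obtain ⟨e, rfl⟩ : ∃ e, d = e + 1 := ⟨d - 1, by omega⟩
      rw [Nat.add_sub_cancel]
      nlinarith
    generalize (2 : ℝ) ^ 2 ^ (d - 1) = X at *
    rw [← mul_div_assoc, le_div_iff₀ (by positivity)]
    generalize ((2 : ℝ) ^ (d - 1)) ^ d = Y at *
    have h5 : ((d : ℝ) + 1) ^ 2 ≤ 4 * d ^ 2 := by nlinarith
    have hX : 0 ≤ Y * Y * 2 ^ d := mul_nonneg (mul_self_nonneg _) (by positivity)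
    calc 4 * (((d : ℝ) + 1) * Y) ^ 2 * 2 ^ d = 4 * ((d + 1) ^ 2 * (Y * Y * 2 ^ d)) := by ring
      _ ≤ 4 * ((4 * d ^ 2) * X) := by
        apply mul_le_mul_of_nonneg_left _ (by norm_num)
        exact mul_le_mul h5 hexp hX (by positivity)
      _ = X * (16 * d ^ 2) := by ring
  push_cast at h1
  have hX : (0 : ℝ) < 2 ^ 2 ^ (d - 1) := by positivity
  generalize (2 : ℝ) ^ 2 ^ (d - 1) = X at *
  generalize ∑ j ∈ Finset.range (d + 1),
      ((2 ^ (d - 1)).choose j : ℝ) * (((2 : ℝ) ^ (d - 1)) ^ j)⁻¹ = T at *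
  have he : Real.exp 1 < 2.7182818286 := Real.exp_one_lt_d9
  have hlow : Real.exp 1 - 10 * d ^ 2 / 2 ^ d ≤ T := by
    refine le_trans ?_ h1
    have hnn : 0 ≤ 1 - (d : ℝ) ^ 2 / 2 ^ (d - 1) := by
      rw [sub_nonneg, div_le_one (by positivity)]
      nlinarith
    refine le_trans ?_ (mul_le_mul_of_nonneg_left h2 hnn)
    rw [show (10 : ℝ) * d ^ 2 / 2 ^ d = 5 * (d ^ 2 / 2 ^ (d - 1)) by rw [hM]; field_simp; norm_num,
      show (2 : ℝ) / 2 ^ d = 1 / 2 ^ (d - 1) by rw [hM]; field_simp]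
    have h6 : 1 / (2 : ℝ) ^ (d - 1) ≤ d ^ 2 / 2 ^ (d - 1) :=
      div_le_div_of_nonneg_right (by nlinarith) (by positivity)
    have h7 : (0 : ℝ) ≤ 1 / 2 ^ (d - 1) := by positivity
    generalize (d : ℝ) ^ 2 / 2 ^ (d - 1) = a at *
    nlinarith
  have := mul_le_mul_of_nonneg_left hlow hX.le
  have e1 : X * (2 * Real.exp 1 - 36 * d ^ 2 / 2 ^ d) =
    2 * (X * (Real.exp 1 - 10 * d ^ 2 / 2 ^ d)) - X * (16 * d ^ 2 / 2 ^ d) := by ring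
  rw [e1]
  linarith
lemma two_pow_mul_pow_four_le {s : ℕ} (hs : 64 ≤ s) : 2 ^ 18 * s ^ 4 ≤ 2 ^ s := by
  obtain ⟨n, rfl⟩ := Nat.exists_eq_add_of_le hs
  clear hs
  induction n with
  | zero => norm_num
  | succ n ih =>
    rw [← add_assoc, pow_succ 2 (64 + n)]
    have h : (64 + n + 1) ^ 4 ≤ 2 * (64 + n) ^ 4 := by
      generalize hk : 64 + n = k
      have hk : 64 ≤ k := by omega
      have h1 : 64 * k ^ 3 ≤ k ^ 4 := by rw [pow_succ k 3, mul_comm]; exact Nat.mul_le_mul_left _ hk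
      have h2 : 64 * k ^ 2 ≤ k ^ 3 := by rw [pow_succ k 2, mul_comm]; exact Nat.mul_le_mul_left _ hk
      have h3 : 64 * k ≤ k ^ 2 := by rw [pow_two]; exact Nat.mul_le_mul_right _ hk
      calc (k + 1) ^ 4 = k ^ 4 + 4 * k ^ 3 + 6 * k ^ 2 + 4 * k + 1 := by ring
        _ ≤ 2 * k ^ 4 := by omega
    calc 2 ^ 18 * (64 + n + 1) ^ 4 ≤ 2 ^ 18 * (2 * (64 + n) ^ 4) := Nat.mul_le_mul_left _ h
      _ = 2 ^ 18 * (64 + n) ^ 4 * 2 := by ring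
      _ ≤ _ := Nat.mul_le_mul_right _ ih

lemma exp_add_le {d : ℕ} (hd : 3 ≤ d) :
    Real.exp (1 + 2 ^ (d - 1) / 2 ^ ((3 * d - 3) / 2)) ≤ Real.exp 1 * (1 + 4 * (3 / 4) ^ d) := by
  obtain ⟨t, ht⟩ : ∃ t, t = (d - 1) / 2 := ⟨_, rfl⟩
  have h1 : (2 : ℝ) ^ (d - 1) / 2 ^ ((3 * d - 3) / 2) = (1 / 2) ^ t := by
    rw [show (3 * d - 3) / 2 = (d - 1) + t by omega, pow_add, one_div, inv_pow]
    field_simp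
  have h2 : (1 / 2 : ℝ) ^ t ≤ 2 * (3 / 4) ^ d := by
    have h3 : (3 / 4 : ℝ) ^ (2 * t + 2) ≤ (3 / 4) ^ d :=
      pow_le_pow_of_le_one (by norm_num) (by norm_num) (by omega)
    have h4 : (1 / 2 : ℝ) ^ t ≤ (9 / 16) ^ t := pow_le_pow_left₀ (by norm_num) (by norm_num) t
    have h5 : (3 / 4 : ℝ) ^ (2 * t + 2) = (9 / 16) ^ t * (9 / 16) := by
      rw [pow_add, pow_mul]; norm_num
    have h6 : (0 : ℝ) ≤ (1 / 2) ^ t := by positivity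
    linarith
  have h7 : (1 / 2 : ℝ) ^ t ≤ 1 := pow_le_one₀ (by norm_num) (by norm_num)
  have h8 : (0 : ℝ) ≤ (1 / 2) ^ t := by positivity
  rw [h1, Real.exp_add]
  apply mul_le_mul_of_nonneg_left _ (Real.exp_pos 1).le
  have h9 := Real.abs_exp_sub_one_le (x := (1 / 2) ^ t) (by rwa [abs_of_nonneg h8])
  rw [abs_of_nonneg h8] at h9
  have := le_abs_self (Real.exp ((1 / 2) ^ t) - 1)
  linarith

lemma card_rankFun_le_of_log {d s : ℕ} (hs : 64 ≤ s) (h1 : 2 ^ s ≤ d) (h2 : d < 2 ^ (s + 1)) :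
    ((RankFun d).ncard : ℝ) ≤ 2 * (2 ^ 2 ^ (d - 1) *
      Real.exp (1 + 2 ^ (d - 1) / 2 ^ ((3 * d - 3) / 2))) +
      2 ^ d * (2 ^ 2 ^ (d - 1) / 2 ^ (2 * d)) := by
  obtain ⟨r, m, hm, hm1, hm2, hr, hrs⟩ : ∃ r m : ℕ, m = 2 ^ r ∧ 64 * s < m ∧ m ≤ 128 * s ∧
      0 < r ∧ r ≤ s + 7 := by
    refine ⟨Nat.log 2 s + 7, _, rfl, ?_, ?_, by omega, ?_⟩
    · have := Nat.lt_pow_succ_log_self (b := 2) (by norm_num) s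
      rw [pow_succ] at this
      rw [pow_add]
      omega
    · have := Nat.pow_log_le_self 2 (x := s) (by omega)
      rw [pow_add]
      omega
    · have := Nat.log_le_self 2 s
      omega
  have hpoly := (two_pow_mul_pow_four_le hs).trans h1
  have hs1 : s ≤ s ^ 4 := Nat.le_self_pow (by norm_num) s
  have hs2 : 64 * s ≤ s ^ 2 := by rw [pow_two]; exact Nat.mul_le_mul_right _ hs
  have hd1 : d ≤ 2 ^ (s + 1) := h2.le
  have hd4 : 4 * d + 1 ≤ 2 ^ (s + 4) := by
    rw [show s + 4 = s + 1 + 3 by rfl, pow_add 2 (s + 1)]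
    omega
  have hdm : ∀ n, d ^ n ≤ 2 ^ ((s + 1) * n) := fun n => by
    rw [pow_mul]; exact Nat.pow_le_pow_left hd1 n
  have key := card_rankFun_le (d := d) (r := r) (l := (s + 1) * (m + 1))
    (q := 1 + (s + 1) * (m + 2) + 2 * (s + 4)) hr Nat.lt_two_pow_self ?_ ?_ ?_ ?_ ?_ ?_ ?_
  · refine key.trans (add_le_add le_rfl ?_)
    apply mul_le_mul_of_nonneg_left _ (by positivity)
    apply div_le_div_of_nonneg_left (by positivity) (by positivity)
    apply pow_le_pow_right₀ (by norm_num)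
    rw [← hm]
    calc 2 * d ≤ 2 ^ (s + 2) := by rw [pow_succ 2 (s + 1)]; omega
      _ ≤ 2 ^ (m - 1 - r) := Nat.pow_le_pow_right (by norm_num) (by omega)
  · rw [← hm]; omega
  · rw [← hm]
    have e1 : ((4 * d + 1 : ℕ) : ℝ) ^ 5 ≤ 2 ^ (5 * s + 20) := by
      rw [show 5 * s + 20 = (s + 4) * 5 by ring, pow_mul]
      exact pow_le_pow_left₀ (Nat.cast_nonneg _) (by exact_mod_cast hd4) 5
    have e2 : (3 / 4 : ℝ) ^ m ≤ (1 / 2) ^ (26 * s) := by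
      calc (3 / 4 : ℝ) ^ m ≤ (3 / 4) ^ (64 * s) :=
            pow_le_pow_of_le_one (by norm_num) (by norm_num) hm1.le
        _ = ((3 / 4) ^ 64) ^ s := pow_mul _ _ _
        _ ≤ ((1 / 2) ^ 26) ^ s := pow_le_pow_left₀ (by positivity) (by norm_num) s
        _ = _ := (pow_mul _ _ _).symm
    have e3 : (2 : ℝ) ^ (5 * s + 25) ≤ 2 ^ (26 * s) :=
      pow_le_pow_right₀ (by norm_num) (by omega)
    calc 24 * ((4 * d + 1 : ℕ) : ℝ) ^ 5 * (3 / 4) ^ m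
        ≤ (32 * 2 ^ (5 * s + 20)) * (1 / 2) ^ (26 * s) := by
          apply mul_le_mul _ e2 (by positivity) (by positivity)
          exact mul_le_mul (by norm_num) e1 (by positivity) (by norm_num)
      _ = 2 ^ (5 * s + 25) * (1 / 2) ^ (26 * s) := by
          rw [show 5 * s + 25 = 5 * s + 20 + 5 by rfl, pow_add _ (5 * s + 20)]; ring
      _ ≤ 2 ^ (26 * s) * (1 / 2) ^ (26 * s) :=
          mul_le_mul_of_nonneg_right e3 (by positivity)
      _ = 1 := by rw [← mul_pow]; norm_num
  · rw [← hm]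
    have e1 : 8 * (4 * d + 1) ^ 2 * 4 ^ (d - m) ≤ 2 ^ 2 ^ (d - m - m - 1) := by
      calc 8 * (4 * d + 1) ^ 2 * 4 ^ (d - m) ≤ 2 ^ 3 * (2 ^ (s + 4)) ^ 2 * 2 ^ (2 * d) := by
            apply Nat.mul_le_mul
            · exact Nat.mul_le_mul (by norm_num) (Nat.pow_le_pow_left hd4 2)
            · rw [pow_mul]
              exact Nat.pow_le_pow_right (by norm_num) (Nat.sub_le _ _)
        _ = 2 ^ (3 + (s + 4) * 2 + 2 * d) := by rw [← pow_mul, ← pow_add, ← pow_add]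
        _ ≤ 2 ^ 2 ^ (s + 3) := by
            apply Nat.pow_le_pow_right (by norm_num)
            have := two_pow_mul_pow_four_le hs
            rw [pow_succ] at h2
            rw [pow_add 2 s]
            omega
        _ ≤ _ := by
            apply Nat.pow_le_pow_right (by norm_num)
            apply Nat.pow_le_pow_right (by norm_num)
            omega
    exact_mod_cast e1
  · rw [← hm]
    calc (d + 1) * d ^ m ≤ 2 ^ (s + 1) * 2 ^ ((s + 1) * m) := Nat.mul_le_mul h2 (hdm m)
      _ = 2 ^ ((s + 1) * (m + 1)) := by rw [← pow_add]; congr 1; ring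
      _ < _ := Nat.pow_lt_pow_right (by norm_num) (by omega)
  · positivity
  · refine le_trans ?_ hpoly
    have hl : (s + 1) * (m + 1) ≤ 150 * s ^ 2 := by
      calc (s + 1) * (m + 1) ≤ (s + 1) * (128 * s + 1) := Nat.mul_le_mul_left _ (by omega)
        _ = 128 * s ^ 2 + 129 * s + 1 := by ring
        _ ≤ _ := by omega
    have hq : 4 * (1 + (s + 1) * (m + 2) + 2 * (s + 4)) + 1 ≤ 700 * s ^ 2 := by
      have : (s + 1) * (m + 2) ≤ (s + 1) * (128 * s + 2) := Nat.mul_le_mul_left _ (by omega)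
      have e : (s + 1) * (128 * s + 2) = 128 * s ^ 2 + 130 * s + 2 := by ring
      omega
    calc _ ≤ 2 * (150 * s ^ 2) * (700 * s ^ 2) :=
          Nat.mul_le_mul (Nat.mul_le_mul_left _ hl) hq
      _ = 210000 * s ^ 4 := by ring
      _ ≤ _ := Nat.mul_le_mul_right _ (by norm_num)
  · rw [← hm]
    calc 2 * (d ^ m * d ^ 2 * (4 * d + 1) ^ 2)
        ≤ 2 * (2 ^ ((s + 1) * m) * 2 ^ ((s + 1) * 2) * (2 ^ (s + 4)) ^ 2) := by
          apply Nat.mul_le_mul_left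
          exact Nat.mul_le_mul (Nat.mul_le_mul (hdm m) (hdm 2)) (Nat.pow_le_pow_left hd4 2)
      _ = 2 ^ (1 + (s + 1) * (m + 2) + 2 * (s + 4)) := by
          rw [← pow_mul, ← pow_add, ← pow_add, ← pow_succ']
          congr 1
          ring

lemma card_rankFun_le_exp {d : ℕ} (hd : 2 ^ 64 ≤ d) :
    ((RankFun d).ncard : ℝ) ≤ 2 ^ 2 ^ (d - 1) * (2 * Real.exp 1 + 30 * (3 / 4) ^ d) := by
  have hs : 64 ≤ Nat.log 2 d := (Nat.le_log_iff_pow_le (by norm_num) (by omega)).2 hd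
  have h := card_rankFun_le_of_log hs (Nat.pow_log_le_self 2 (by omega))
    (Nat.lt_pow_succ_log_self (by norm_num) d)
  have h1 := exp_add_le (d := d) (by omega)
  have h2 : (2 : ℝ) ^ d / 2 ^ (2 * d) ≤ (3 / 4) ^ d := by
    rw [pow_mul, ← div_pow]
    exact pow_le_pow_left₀ (by norm_num) (by norm_num) d
  have he : Real.exp 1 < 2.7182818286 := Real.exp_one_lt_d9
  have h3 : (0 : ℝ) ≤ (3 / 4) ^ d := by positivity
  have hX : (0 : ℝ) < 2 ^ 2 ^ (d - 1) := by positivity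
  refine h.trans ?_
  generalize (2 : ℝ) ^ 2 ^ (d - 1) = X at *
  rw [mul_div_left_comm, ← mul_assoc, mul_comm 2 X, mul_assoc, ← mul_add]
  apply mul_le_mul_of_nonneg_left _ hX.le
  nlinarith
lemma eventually_error_le : ∀ᶠ d : ℕ in Filter.atTop,
    30 * (3 / 4 : ℝ) ^ d ≤ Real.exp (-(1 / 10) * d) ∧
    36 * (d : ℝ) ^ 2 / 2 ^ d ≤ Real.exp (-(1 / 10) * d) := by
  have hexp : ∀ d : ℕ, (9 / 10 : ℝ) ^ d ≤ Real.exp (-(1 / 10) * d) := fun d => by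
    rw [mul_comm, Real.exp_nat_mul]
    apply pow_le_pow_left₀ (by norm_num)
    have := Real.add_one_le_exp (-(1 / 10) : ℝ)
    linarith
  have h1 := (tendsto_pow_atTop_nhds_zero_of_lt_one (r := (5 / 6 : ℝ)) (by norm_num)
    (by norm_num)).eventually_le_const (show (0 : ℝ) < 1 / 30 by norm_num)
  have h2 := (tendsto_pow_const_mul_const_pow_of_abs_lt_one 2 (r := (5 / 9 : ℝ))
    (by rw [abs_of_pos] <;> norm_num)).eventually_le_const (show (0 : ℝ) < 1 / 36 by norm_num)
  filter_upwards [h1, h2] with d h1 h2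
  have h0 : (0 : ℝ) ≤ (9 / 10) ^ d := by positivity
  constructor <;> refine le_trans ?_ (hexp d)
  · rw [show (3 / 4 : ℝ) = 5 / 6 * (9 / 10) by norm_num, mul_pow]
    nlinarith
  · rw [div_eq_mul_inv, ← inv_pow, show (2⁻¹ : ℝ) = 5 / 9 * (9 / 10) by norm_num, mul_pow]
    nlinarith

end CubeHom

theorem count_rank_functions :
    (∃ c > (0:ℝ), ∃ d₀ : ℕ, ∀ d : ℕ, d₀ ≤ d →
      |((RankFun d).ncard : ℝ) - 2 * Real.exp 1 * 2 ^ 2 ^ (d - 1)| ≤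
        Real.exp (-c * d) * 2 ^ 2 ^ (d - 1)) ∧
    (∃ C > (0:ℝ), ∀ d : ℕ, 1 ≤ d →
      ((RankFun d).ncard : ℝ) ≤ C * 2 ^ 2 ^ (d - 1)) := by
  have main : ∃ c > (0:ℝ), ∃ d₀ : ℕ, ∀ d : ℕ, d₀ ≤ d →
      |((RankFun d).ncard : ℝ) - 2 * Real.exp 1 * 2 ^ 2 ^ (d - 1)| ≤
        Real.exp (-c * d) * 2 ^ 2 ^ (d - 1) := by
    obtain ⟨d₁, h⟩ := Filter.eventually_atTop.1 CubeHom.eventually_error_le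
    refine ⟨1 / 10, by norm_num, d₁ + 2 ^ 64, fun d hd => ?_⟩
    obtain ⟨h1, h2⟩ := h d (by omega)
    have hu := CubeHom.card_rankFun_le_exp (d := d) (by omega)
    have hl := CubeHom.card_rankFun_ge (d := d) (by omega)
    have hX : (0 : ℝ) < 2 ^ 2 ^ (d - 1) := by positivity
    generalize (2 : ℝ) ^ 2 ^ (d - 1) = X at *
    have hu' := mul_le_mul_of_nonneg_left h1 hX.le
    have hl' := mul_le_mul_of_nonneg_left h2 hX.le
    rw [abs_le]
    constructor <;> linarith
  refine ⟨main, ?_⟩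
  obtain ⟨c, hc, d₀, h⟩ := main
  refine ⟨2 * Real.exp 1 + 1 + ∑ d ∈ Finset.range d₀, ((RankFun d).ncard : ℝ), by positivity,
    fun d _ => ?_⟩
  have hX : (1 : ℝ) ≤ 2 ^ 2 ^ (d - 1) := one_le_pow₀ (by norm_num)
  have hS : (0 : ℝ) ≤ ∑ d ∈ Finset.range d₀, ((RankFun d).ncard : ℝ) :=
    Finset.sum_nonneg fun _ _ => Nat.cast_nonneg _
  have he := Real.exp_pos 1
  rcases lt_or_ge d d₀ with hd | hd
  · have h1 : ((RankFun d).ncard : ℝ) ≤ ∑ d ∈ Finset.range d₀, ((RankFun d).ncard : ℝ) :=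
      Finset.single_le_sum (f := fun d => ((RankFun d).ncard : ℝ))
      (fun _ _ => Nat.cast_nonneg _) (Finset.mem_range.2 hd)
    generalize (2 : ℝ) ^ 2 ^ (d - 1) = X at *
    nlinarith
  · have h1 := (abs_le.1 (h d hd)).2
    have h2 : Real.exp (-c * d) ≤ 1 := by
      rw [Real.exp_le_one_iff, neg_mul, neg_nonpos]
      positivity
    generalize (2 : ℝ) ^ 2 ^ (d - 1) = X at *
    nlinarith
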